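/- Let α ∈ (0,1), D ∈ ℕ, N ≤ D, and let C : [0,1] → Matrix (Fin D) (Fin D) ℝ be α-Hölder continuous with δ|y|² ≤ yᵀC(t)C(t)ᵀy ≤ δ̄|y|² for all y ∈ ℝ^D, t ∈ [0,1], where 0 < δ ≤ δ̄. Let I ∈ ℕ, a₁,…,a_I > 0, τ_Σ := Σ_{i=1}^I 1/a_i, and let C̄(t) be the D×N matrix consisting of the first N columns of C(t). Let g^{(1)},…,g^{(I)} : ℝ^D → ℝ be C² functions with finite Hölder norm |g^{(i)}|_{2+α}. Then there exists T₀ ∈ (0,1] such that for every T < T₀ the coupled PDE system ∂_t u^{(i)} + (1/(2a_i))|λ|² − λᵀ C̄(t)ᵀ ∂_y u^{(i)} + (a_i/2)( |C̄(t)ᵀ∂_y u^{(i)}|² − |C(t)ᵀ∂_y u^{(i)}|² ) + (1/2) tr( ∂_{yy}u^{(i)} C(t)C(t)ᵀ ) = 0 on [0,T)×ℝ^D with terminal condition u^{(i)}(T,y) = g^{(i)}(y), where λ(t,y) := (1/τ_Σ) C̄(t)ᵀ Σ_{j=1}^I ∂_y u^{(j)}(t,y), has a unique solution (u^{(1)},…,u^{(I)})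 with each u^{(i)} of class C^{1,2} and finite parabolic Hölder norm |u^{(i)}|_{2+α}. -/

import Mathlib

noncomputable section

open Real Set Matrix

/-- `Sig C t s = ∫_t^s C(u) C(u)ᵀ du` (entrywise Bochner integral). -/
noncomputable def Sig {D : ℕ} (C : ℝ → Matrix (Fin D) (Fin D) ℝ) (t s : ℝ) :
    Matrix (Fin D) (Fin D) ℝ :=
  fun i j => ∫ u in t..s, (C u * (C u)ᵀ) i j

/-- Uniform ellipticity: `δ |y|² ≤ yᵀ C(t)C(t)ᵀ y ≤ δ' |y|²` for all `t ∈ [0,1]`. -/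
def Ellip (D : ℕ) (δ δ' : ℝ) (C : ℝ → Matrix (Fin D) (Fin D) ℝ) : Prop :=
  ∀ t ∈ Set.Icc (0:ℝ) 1, ∀ y : Fin D → ℝ,
    δ * (∑ i, y i ^ 2) ≤ (∑ i, ∑ j, y i * (C t * (C t)ᵀ) i j * y j) ∧
    (∑ i, ∑ j, y i * (C t * (C t)ᵀ) i j * y j) ≤ δ' * (∑ i, y i ^ 2)

/-- Euclidean norm on `ℝ^D`. -/
noncomputable def en {D : ℕ} (x : Fin D → ℝ) : ℝ := Real.sqrt (∑ i, x i ^ 2)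

/-- First partial derivative in the `d`-th coordinate direction. -/
noncomputable def pd {D : ℕ} (g : (Fin D → ℝ) → ℝ) (d : Fin D) (x : Fin D → ℝ) : ℝ :=
  fderiv ℝ g x (Pi.single d 1)

/-- Second partial derivative. -/
noncomputable def pdd {D : ℕ} (g : (Fin D → ℝ) → ℝ) (d e : Fin D) (x : Fin D → ℝ) : ℝ :=
  fderiv ℝ (fun z => pd g e z) x (Pi.single d 1)

/-- Values `|g x|`. -/
def sup0Set {D : ℕ} (g : (Fin D → ℝ) → ℝ) : Set ℝ := {r | ∃ x, r = |g x|}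

/-- `α`-Hölder quotients of `g : ℝ^D → ℝ`. -/
def hsemiSet {D : ℕ} (α : ℝ) (g : (Fin D → ℝ) → ℝ) : Set ℝ :=
  {r | ∃ x y, x ≠ y ∧ r = |g x - g y| / en (x - y) ^ α}

/-- Values `|h t x|` for `t ∈ [0,T]`. -/
def psupSet {D : ℕ} (T : ℝ) (h : ℝ → (Fin D → ℝ) → ℝ) : Set ℝ :=
  {r | ∃ t x, t ∈ Set.Icc (0:ℝ) T ∧ r = |h t x|}

/-- Parabolic `α`-Hölder quotients of `h` on `[0,T] × ℝ^D`. -/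
def psemiSet {D : ℕ} (T α : ℝ) (h : ℝ → (Fin D → ℝ) → ℝ) : Set ℝ :=
  {r | ∃ t x s y, t ∈ Set.Icc (0:ℝ) T ∧ s ∈ Set.Icc (0:ℝ) T ∧
    ((t, x) : ℝ × (Fin D → ℝ)) ≠ (s, y) ∧
    r = |h t x - h s y| / (Real.sqrt |t - s| + en (x - y)) ^ α}

/-- The market price of risk `λ(t,y) = (1/τ_Σ) C̄(t)ᵀ ∑ⱼ ∂_y u^{(j)}(t,y)`, where
`C̄(t)` consists of the first `N` columns of `C(t)` and `τ_Σ = ∑ᵢ 1/aᵢ`. -/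
noncomputable def lamFun {D N I : ℕ} (hN : N ≤ D) (C : ℝ → Matrix (Fin D) (Fin D) ℝ)
    (a : Fin I → ℝ) (u : Fin I → ℝ → (Fin D → ℝ) → ℝ) (t : ℝ) (y : Fin D → ℝ)
    (n : Fin N) : ℝ :=
  (1 / ∑ j, 1 / a j) * ∑ j : Fin I, ∑ k : Fin D, C t k (Fin.castLE hN n) * pd (u j t) k y

/-- `u = (u^{(1)},…,u^{(I)})` is a `C^{1,2}` solution, with finite parabolic
`|·|_{2+α}` norms, of the coupled PDE system with coupling `λ`. -/
def SysSol {D N I : ℕ} (hN : N ≤ D) (T α : ℝ) (C : ℝ → Matrix (Fin D) (Fin D) ℝ)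
    (a : Fin I → ℝ) (g : Fin I → (Fin D → ℝ) → ℝ)
    (u : Fin I → ℝ → (Fin D → ℝ) → ℝ) : Prop :=
  ∀ i : Fin I,
    ContinuousOn (fun p : ℝ × (Fin D → ℝ) => u i p.1 p.2) (Set.Icc 0 T ×ˢ Set.univ) ∧
    (∀ t ∈ Set.Icc (0:ℝ) T, ContDiff ℝ 2 (u i t)) ∧
    (∀ y : Fin D → ℝ, ∀ t ∈ Set.Icc (0:ℝ) T,
      DifferentiableWithinAt ℝ (fun s => u i s y) (Set.Icc 0 T) t) ∧
    (∀ t ∈ Set.Ico (0:ℝ) T, ∀ y : Fin D → ℝ,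
      derivWithin (fun s => u i s y) (Set.Icc 0 T) t
        + (1 / (2 * a i)) * (∑ n : Fin N, lamFun hN C a u t y n ^ 2)
        - (∑ n : Fin N, lamFun hN C a u t y n *
            (∑ k : Fin D, C t k (Fin.castLE hN n) * pd (u i t) k y))
        + (a i / 2) *
            ((∑ n : Fin N, (∑ k : Fin D, C t k (Fin.castLE hN n) * pd (u i t) k y) ^ 2) -
              (∑ m : Fin D, (∑ k : Fin D, C t k m * pd (u i t) k y) ^ 2))
        + (1/2) * (∑ p, ∑ q, pdd (u i t) p q y * (C t * (C t)ᵀ) q p) = 0) ∧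
    (∀ y, u i T y = g i y) ∧
    BddAbove (psupSet T (u i)) ∧
    BddAbove (psupSet T (fun t y => derivWithin (fun s => u i s y) (Set.Icc 0 T) t)) ∧
    BddAbove (psemiSet T α (fun t y => derivWithin (fun s => u i s y) (Set.Icc 0 T) t)) ∧
    (∀ d, BddAbove (psupSet T (fun t => pd (u i t) d))) ∧
    (∀ d e, BddAbove (psupSet T (fun t => pdd (u i t) d e))) ∧
    (∀ d e, BddAbove (psemiSet T α (fun t => pdd (u i t) d e)))

section

open MeasureTheory ProbabilityTheory Filter Topology

lemma fderiv_apply_eq_sum_pd {D : ℕ} (g : (Fin D → ℝ) → ℝ) (x z : Fin D → ℝ) :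
    fderiv ℝ g x z = ∑ k, z k * pd g k x := by
  conv_lhs => rw [← Finset.univ_sum_single z]
  rw [map_sum]
  refine Finset.sum_congr rfl fun k _ => ?_
  have : (Pi.single k (z k) : Fin D → ℝ) = z k • Pi.single k 1 := by
    rw [← Pi.single_smul, smul_eq_mul, mul_one]
  rw [this, map_smul, smul_eq_mul, pd]

lemma fderiv_eq_sum_pd {D : ℕ} (g : (Fin D → ℝ) → ℝ) :
    fderiv ℝ g = fun x => ∑ k, pd g k x • (ContinuousLinearMap.proj k : (Fin D → ℝ) →L[ℝ] ℝ) := by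
  funext x
  ext1 z
  simp [fderiv_apply_eq_sum_pd, mul_comm]

lemma contDiff_one_of_pd {D : ℕ} {g : (Fin D → ℝ) → ℝ} (hd : Differentiable ℝ g)
    (hc : ∀ k, Continuous (pd g k)) : ContDiff ℝ 1 g := by
  rw [contDiff_one_iff_fderiv]
  refine ⟨hd, ?_⟩
  rw [fderiv_eq_sum_pd]
  fun_prop

lemma contDiff_two_of_pd {D : ℕ} {g : (Fin D → ℝ) → ℝ} (hd : Differentiable ℝ g)
    (hc : ∀ k, ContDiff ℝ 1 (pd g k)) : ContDiff ℝ 2 g := by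
  rw [show (2 : WithTop ℕ∞) = 1 + 1 by norm_num, contDiff_succ_iff_fderiv]
  refine ⟨hd, by simp, ?_⟩
  rw [fderiv_eq_sum_pd]
  fun_prop

lemma ContDiff.pd {D : ℕ} {n : ℕ} {g : (Fin D → ℝ) → ℝ} (hg : ContDiff ℝ (n + 1 : ℕ) g)
    (k : Fin D) : ContDiff ℝ n (pd g k) := by
  have h : ContDiff ℝ n (fderiv ℝ g) := by
    refine hg.fderiv_right ?_
    norm_cast
  exact h.clm_apply contDiff_const

lemma ContDiff.pd_one {D : ℕ} {g : (Fin D → ℝ) → ℝ} (hg : ContDiff ℝ 2 g)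
    (k : Fin D) : ContDiff ℝ 1 (_root_.pd g k) := by
  have := ContDiff.pd (n := 1) (g := g) (by exact_mod_cast hg) k
  exact_mod_cast this

lemma ContDiff.continuous_pd {D : ℕ} {g : (Fin D → ℝ) → ℝ} (hg : ContDiff ℝ 1 g)
    (k : Fin D) : Continuous (_root_.pd g k) :=
  (hg.continuous_fderiv (by simp)).clm_apply continuous_const

lemma pdd_eq {D : ℕ} (g : (Fin D → ℝ) → ℝ) (d e : Fin D) : pdd g d e = pd (pd g e) d := rfl

lemma norm_single_one {D : ℕ} (k : Fin D) : ‖(Pi.single k 1 : Fin D → ℝ)‖ = 1 := by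
  rw [Pi.norm_single, norm_one]

lemma abs_pd_le_of_lip {D : ℕ} {g : (Fin D → ℝ) → ℝ} {L : ℝ} (hL0 : 0 ≤ L)
    (hL : ∀ x y, |g x - g y| ≤ L * ‖x - y‖) (k : Fin D) (x : Fin D → ℝ) : |pd g k x| ≤ L := by
  have hl : LipschitzWith ⟨L, hL0⟩ g := LipschitzWith.of_dist_le_mul fun x y => by
    rw [dist_eq_norm, dist_eq_norm]; exact hL x y
  have h1 : ‖fderiv ℝ g x‖ ≤ L := norm_fderiv_le_of_lipschitz ℝ hl
  have h2 := (fderiv ℝ g x).le_opNorm (Pi.single k 1)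
  rw [norm_single_one, mul_one] at h2
  exact h2.trans h1

lemma lip_of_abs_pd_le {D : ℕ} {g : (Fin D → ℝ) → ℝ} {L : ℝ} (hg : Differentiable ℝ g)
    (hL0 : 0 ≤ L) (hL : ∀ k x, |pd g k x| ≤ L) (x y : Fin D → ℝ) :
    |g x - g y| ≤ D * L * ‖x - y‖ := by
  have hb : ∀ z, ‖fderiv ℝ g z‖ ≤ D * L := fun z => by
    refine ContinuousLinearMap.opNorm_le_bound _ (by positivity) fun w => ?_
    rw [fderiv_apply_eq_sum_pd, Real.norm_eq_abs]
    refine (Finset.abs_sum_le_sum_abs _ _).trans ?_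
    calc ∑ k, |w k * pd g k z| ≤ ∑ _k : Fin D, ‖w‖ * L := by
          refine Finset.sum_le_sum fun k _ => ?_
          rw [abs_mul]
          exact mul_le_mul (norm_le_pi_norm w k) (hL k z) (abs_nonneg _) (norm_nonneg _)
      _ = D * L * ‖w‖ := by simp; ring
  have := Convex.norm_image_sub_le_of_norm_fderiv_le (𝕜 := ℝ) (f := g) (s := univ)
    (fun z _ => hg z) (fun z _ => hb z) convex_univ (mem_univ y) (mem_univ x)
  simpa using this

lemma pd_add {D : ℕ} {f g : (Fin D → ℝ) → ℝ} (hf : Differentiable ℝ f) (hg : Differentiable ℝ g)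
    (k : Fin D) : pd (fun x => f x + g x) k = fun x => pd f k x + pd g k x := by
  funext x
  simp only [pd]
  rw [fderiv_fun_add (hf x) (hg x)]
  rfl

lemma pd_sub {D : ℕ} {f g : (Fin D → ℝ) → ℝ} (hf : Differentiable ℝ f) (hg : Differentiable ℝ g)
    (k : Fin D) : pd (fun x => f x - g x) k = fun x => pd f k x - pd g k x := by
  funext x
  simp only [pd]
  rw [fderiv_fun_sub (hf x) (hg x)]
  rfl

/-- A point evaluation of a partial derivative as a limit of difference quotients. -/
lemma tendsto_quot_pd {D : ℕ} {g : (Fin D → ℝ) → ℝ} {x : Fin D → ℝ} (hg : DifferentiableAt ℝ g x)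
    (k : Fin D) :
    Tendsto (fun n : ℕ => ((n : ℝ) + 1) *
      (g (x + ((n : ℝ) + 1)⁻¹ • Pi.single k 1) - g x)) atTop (𝓝 (pd g k x)) := by
  have h := hg.hasFDerivAt.hasLineDerivAt (Pi.single k 1)
  have h2 := h.tendsto_slope_zero_right
  have h3 : Tendsto (fun n : ℕ => ((n : ℝ) + 1)⁻¹) atTop (𝓝[>] 0) := by
    refine tendsto_nhdsWithin_iff.2 ⟨?_, Eventually.of_forall fun n => ?_⟩
    · simpa using tendsto_one_div_add_atTop_nhds_zero_nat (𝕜 := ℝ)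
    · simp only [mem_Ioi]; positivity
  have h4 := h2.comp h3
  simp only [Function.comp_def, inv_inv, smul_eq_mul] at h4
  exact h4

/-- The standard Gaussian measure on `ℝ^D`. -/
def stdGauss (D : ℕ) : Measure (Fin D → ℝ) := Measure.pi fun _ => gaussianReal 0 1

instance (D : ℕ) : IsProbabilityMeasure (stdGauss D) := by
  unfold stdGauss; infer_instance

lemma charFunDual_stdGauss {D : ℕ} (L : StrongDual ℝ (Fin D → ℝ)) :
    charFunDual (stdGauss D) L = Complex.exp (-(∑ i, (L (Pi.single i 1)) ^ 2 : ℝ) / 2) := by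
  rw [stdGauss, charFunDual_pi]
  have : ∀ i, charFunDual (gaussianReal 0 1) (L.comp (.single ℝ (fun _ => ℝ) i)) =
      Complex.exp (-((L (Pi.single i 1)) ^ 2 : ℝ) / 2) := fun i => by
    have h := charFun_gaussianReal (μ := 0) (v := 1) (L (Pi.single i 1))
    rw [charFun_apply_real] at h
    rw [charFunDual_apply]
    have h2 : ∀ x : ℝ, (L.comp (.single ℝ (fun _ => ℝ) i)) x = L (Pi.single i 1) * x := fun x => by
      have : (Pi.single i x : Fin D → ℝ) = x • Pi.single i 1 := by
        rw [← Pi.single_smul, smul_eq_mul, mul_one]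
      simp only [ContinuousLinearMap.comp_apply, ContinuousLinearMap.single_apply]
      rw [this, map_smul, smul_eq_mul, mul_comm]
    simp_rw [h2]
    push_cast
    rw [h]
    congr 1
    push_cast
    simp
    ring
  simp_rw [this]
  rw [← Complex.exp_sum]
  congr 1
  push_cast
  rw [neg_div, Finset.sum_div, ← Finset.sum_neg_distrib]
  exact Finset.sum_congr rfl fun i _ => by ring

instance (D : ℕ) : IsGaussian (stdGauss D) := by
  have h := map_pi_eq_stdGaussian (ι := Fin D)
  have h2 : stdGauss D = (stdGaussian (EuclideanSpace ℝ (Fin D))).map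
      (EuclideanSpace.equiv (Fin D) ℝ).toContinuousLinearMap := by
    rw [← h, Measure.map_map (by fun_prop) (by fun_prop)]
    exact Measure.map_id.symm
  rw [h2]
  infer_instance

lemma integrable_exp_stdGauss (D : ℕ) (a : ℝ) :
    Integrable (fun w : Fin D → ℝ => ∏ i, exp (a * |w i|)) (stdGauss D) := by
  unfold stdGauss
  refine Integrable.fintype_prod (f := fun _ x => exp (a * |x|)) fun i => ?_
  refine ((integrable_exp_mul_gaussianReal (μ := 0) (v := 1) a).add
    (integrable_exp_mul_gaussianReal (μ := 0) (v := 1) (-a))).mono' (by fun_prop) ?_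
  refine Eventually.of_forall fun x => ?_
  simp only [Pi.add_apply, Real.norm_eq_abs, abs_exp]
  rcases abs_cases x with ⟨h, _⟩ | ⟨h, _⟩ <;> rw [h]
  · linarith [exp_pos (-a * x)]
  · rw [mul_neg, ← neg_mul]; linarith [exp_pos (a * x)]

lemma integrable_norm_rpow_stdGauss (D : ℕ) {p : ℝ} (hp : 0 ≤ p) :
    Integrable (fun w : Fin D → ℝ => ‖w‖ ^ p) (stdGauss D) := by
  have := (IsGaussian.memLp_id (stdGauss D) (ENNReal.ofReal p) (by simp)).integrable_norm_rpow'
  simpa [ENNReal.toReal_ofReal hp] using this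

lemma integrable_eval_stdGauss {D : ℕ} (i : Fin D) :
    Integrable (fun w : Fin D → ℝ => w i) (stdGauss D) := by
  have := integrable_norm_rpow_stdGauss D (p := 1) zero_le_one
  simp only [rpow_one] at this
  exact this.mono' (measurable_pi_apply i).aestronglyMeasurable (Eventually.of_forall fun w => norm_le_pi_norm w i)

lemma integral_eval_stdGauss {D : ℕ} (i : Fin D) : ∫ w, w i ∂(stdGauss D) = 0 := by
  have := integral_fintype_prod_eq_prod (μ := fun _ : Fin D => gaussianReal 0 1)
    (fun k x => if k = i then x else (1:ℝ))
  simp only [Finset.prod_ite_eq'] at this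
  simp only [Finset.mem_univ, if_true] at this
  rw [stdGauss, this]
  refine Finset.prod_eq_zero (Finset.mem_univ i) ?_
  simp [integral_id_gaussianReal]

lemma integral_sq_gaussianReal_std : ∫ x, x ^ 2 ∂(gaussianReal 0 1) = 1 := by
  have h := variance_id_gaussianReal (μ := 0) (v := 1)
  rw [variance_of_integral_eq_zero (by fun_prop) (by simp [integral_id_gaussianReal])] at h
  simpa using h

lemma integral_eval_mul_stdGauss {D : ℕ} (i j : Fin D) :
    ∫ w, w i * w j ∂(stdGauss D) = if i = j then 1 else 0 := by
  have := integral_fintype_prod_eq_prod (μ := fun _ : Fin D => gaussianReal 0 1)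
    (fun k x => (if k = i then x else (1:ℝ)) * (if k = j then x else (1:ℝ)))
  simp only [Finset.prod_mul_distrib, Finset.prod_ite_eq', Finset.mem_univ, if_true] at this
  rw [stdGauss, this]
  split_ifs with h
  · subst h
    refine Finset.prod_eq_one fun k _ => ?_
    split_ifs
    · simp_rw [← sq]; exact integral_sq_gaussianReal_std
    · simp
  · refine Finset.prod_eq_zero (Finset.mem_univ i) ?_
    simp [h, integral_id_gaussianReal]

/-- Cameron–Martin formula for the standard Gaussian measure. -/
lemma stdGauss_map_add {D : ℕ} (v : Fin D → ℝ) :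
    (stdGauss D).map (fun w => v + w) =
      (stdGauss D).withDensity fun w => ENNReal.ofReal (∏ i, exp (v i * w i - v i ^ 2 / 2)) := by
  have hpos : ∀ w : Fin D → ℝ, 0 ≤ ∏ i, exp (v i * w i - v i ^ 2 / 2) := fun w =>
    Finset.prod_nonneg fun i _ => (exp_pos _).le
  have hint : Integrable (fun w : Fin D → ℝ => ∏ i, exp (v i * w i - v i ^ 2 / 2))
      (stdGauss D) := by
    unfold stdGauss
    refine Integrable.fintype_prod (f := fun i x => exp (v i * x - v i ^ 2 / 2)) fun i => ?_
    have := (integrable_exp_mul_gaussianReal (μ := 0) (v := 1) (v i)).mul_const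
      (exp (-(v i ^ 2 / 2)))
    simpa [sub_eq_add_neg, exp_add] using this
  have : IsProbabilityMeasure ((stdGauss D).map (fun w => v + w)) :=
    Measure.isProbabilityMeasure_map (by fun_prop)
  have : IsFiniteMeasure ((stdGauss D).withDensity
      fun w => ENNReal.ofReal (∏ i, exp (v i * w i - v i ^ 2 / 2))) :=
    isFiniteMeasure_withDensity_ofReal hint.2
  refine Measure.ext_of_charFunDual (funext fun L => ?_)
  rw [charFunDual_map_const_add, charFunDual_stdGauss, charFunDual_apply,
    integral_withDensity_eq_integral_toReal_smul (by fun_prop) (by simp)]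
  have h1 : ∀ w : Fin D → ℝ,
      (ENNReal.ofReal (∏ i, exp (v i * w i - v i ^ 2 / 2))).toReal •
        Complex.exp ((L w : ℂ) * Complex.I) =
      ∏ i, (Complex.exp ((L (Pi.single i 1) * Complex.I + v i) * w i) *
        Complex.exp (-(v i : ℂ) ^ 2 / 2)) := fun w => by
    rw [ENNReal.toReal_ofReal (hpos w)]
    have : L w = ∑ i, L (Pi.single i 1) * w i := by
      conv_lhs => rw [← Finset.univ_sum_single w]
      rw [map_sum]
      refine Finset.sum_congr rfl fun k _ => ?_
      have : (Pi.single k (w k) : Fin D → ℝ) = w k • Pi.single k 1 := by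
        rw [← Pi.single_smul, smul_eq_mul, mul_one]
      rw [this, map_smul, smul_eq_mul, mul_comm]
    rw [this, Complex.real_smul]
    push_cast
    rw [Finset.sum_mul, Complex.exp_sum, ← Finset.prod_mul_distrib]
    refine Finset.prod_congr rfl fun i _ => ?_
    rw [← Complex.exp_add, ← Complex.exp_add]
    congr 1
    ring
  simp_rw [h1]
  rw [stdGauss, integral_fintype_prod_eq_prod (𝕜 := ℂ) (μ := fun _ : Fin D => gaussianReal 0 1)
    (fun i (x : ℝ) => Complex.exp ((L (Pi.single i 1) * Complex.I + v i) * x) *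
        Complex.exp (-(v i : ℂ) ^ 2 / 2))]
  have h2 : ∀ i, ∫ x : ℝ, Complex.exp ((L (Pi.single i 1) * Complex.I + v i) * x) *
        Complex.exp (-(v i : ℂ) ^ 2 / 2) ∂(gaussianReal 0 1) =
      Complex.exp (L (Pi.single i 1) * v i * Complex.I - (L (Pi.single i 1)) ^ 2 / 2) := fun i => by
    rw [integral_mul_const]
    have := complexMGF_id_gaussianReal (μ := 0) (v := 1) (L (Pi.single i 1) * Complex.I + v i)
    simp only [complexMGF, id] at this
    rw [this, ← Complex.exp_add]
    congr 1
    simp only [Complex.ofReal_zero, mul_zero, NNReal.coe_one, Complex.ofReal_one]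
    ring_nf
    simp only [Complex.I_sq]
    ring
  simp_rw [h2]
  rw [← Complex.exp_sum, ← Complex.exp_add]
  congr 1
  have : L v = ∑ i, L (Pi.single i 1) * v i := by
    conv_lhs => rw [← Finset.univ_sum_single v]
    rw [map_sum]
    refine Finset.sum_congr rfl fun k _ => ?_
    have : (Pi.single k (v k) : Fin D → ℝ) = v k • Pi.single k 1 := by
      rw [← Pi.single_smul, smul_eq_mul, mul_one]
    rw [this, map_smul, smul_eq_mul, mul_comm]
  rw [this]
  push_cast
  rw [Finset.sum_sub_distrib, Finset.sum_mul, ← Finset.sum_div]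
  ring

lemma integral_add_stdGauss {D : ℕ} {φ : (Fin D → ℝ) → ℝ} (hφ : Continuous φ) (v : Fin D → ℝ) :
    ∫ w, φ (v + w) ∂(stdGauss D) =
      ∫ w, φ w * ∏ i, exp (v i * w i - v i ^ 2 / 2) ∂(stdGauss D) := by
  rw [← integral_map (φ := fun w => v + w) (f := φ) (by fun_prop) hφ.aestronglyMeasurable,
    stdGauss_map_add, integral_withDensity_eq_integral_toReal_smul (by fun_prop) (by simp)]
  refine integral_congr_ae (Eventually.of_forall fun w => ?_)
  simp only
  rw [ENNReal.toReal_ofReal (Finset.prod_nonneg fun i _ => (exp_pos _).le), smul_eq_mul, mul_comm]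

lemma norm_sum_smul_proj_le {D : ℕ} {a : Fin D → ℝ} {b : ℝ} (h : ∀ i, |a i| ≤ b) :
    ‖∑ i, a i • (ContinuousLinearMap.proj i : (Fin D → ℝ) →L[ℝ] ℝ)‖ ≤ D * b := by
  refine (norm_sum_le _ _).trans ?_
  calc _ ≤ ∑ _i : Fin D, b := by
        refine Finset.sum_le_sum fun i _ => ?_
        rw [norm_smul]
        have h4 : ‖(ContinuousLinearMap.proj i : (Fin D → ℝ) →L[ℝ] ℝ)‖ ≤ 1 :=
          ContinuousLinearMap.opNorm_le_bound _ zero_le_one fun z => by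
            rw [one_mul]; exact norm_le_pi_norm z i
        calc _ ≤ ‖a i‖ * 1 := by gcongr
          _ ≤ b := by rw [mul_one]; exact h i
    _ = _ := by simp

set_option maxHeartbeats 1000000 in
/-- Differentiation of Gaussian averages of a merely continuous function at the origin. -/
lemma hasFDerivAt_stdGauss_zero {D : ℕ} {ψ : (Fin D → ℝ) → ℝ} (hψ : Continuous ψ) {M : ℝ}
    (hM : ∀ x, |ψ x| ≤ M) :
    HasFDerivAt (fun v => ∫ w, ψ (v + w) ∂(stdGauss D))
      (∫ w, ψ w • (∑ i, w i • (ContinuousLinearMap.proj i : (Fin D → ℝ) →L[ℝ] ℝ)) ∂(stdGauss D))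
      0 := by
  have hM0 : 0 ≤ M := (abs_nonneg _).trans (hM 0)
  simp_rw [integral_add_stdGauss hψ, ← exp_sum]
  have hcontexp : ∀ ξ : Fin D → ℝ, Continuous fun w : Fin D → ℝ =>
      ψ w * exp (∑ i, (ξ i * w i - ξ i ^ 2 / 2)) := fun ξ => by fun_prop
  have hexp : ∀ ξ ∈ Metric.ball (0 : Fin D → ℝ) 1, ∀ w : Fin D → ℝ,
      exp (∑ i, (ξ i * w i - ξ i ^ 2 / 2)) ≤ ∏ i, exp (|w i|) := fun ξ hξ w => by
    rw [← exp_sum]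
    refine exp_le_exp.2 (Finset.sum_le_sum fun i _ => ?_)
    have h1 : |ξ i| ≤ 1 := (norm_le_pi_norm ξ i).trans (by simpa using (mem_ball_zero_iff.1 hξ).le)
    have h2 : ξ i * w i ≤ |w i| := by
      calc ξ i * w i ≤ |ξ i * w i| := le_abs_self _
        _ = |ξ i| * |w i| := abs_mul _ _
        _ ≤ 1 * |w i| := by gcongr
        _ = |w i| := one_mul _
    nlinarith [sq_nonneg (ξ i)]
  have hone : ∀ w : Fin D → ℝ, ∀ i, exp (|w i|) ≤ ∏ i, exp (|w i|) := fun w i => by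
    rw [← exp_sum]
    exact exp_le_exp.2 (Finset.single_le_sum (f := fun i => |w i|) (fun i _ => abs_nonneg _)
      (Finset.mem_univ i))
  have key := hasFDerivAt_integral_of_dominated_of_fderiv_le (𝕜 := ℝ) (μ := stdGauss D)
    (F := fun ξ w => ψ w * exp (∑ i, (ξ i * w i - ξ i ^ 2 / 2)))
    (F' := fun ξ w => (ψ w * exp (∑ i, (ξ i * w i - ξ i ^ 2 / 2))) •
      ∑ i, (w i - ξ i) • (ContinuousLinearMap.proj i : (Fin D → ℝ) →L[ℝ] ℝ))
    (x₀ := 0) (s := Metric.ball 0 1) (bound := fun w => M * D * ∏ i, exp (2 * |w i|))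
    (Metric.ball_mem_nhds _ one_pos)
    (Eventually.of_forall fun ξ => (hcontexp ξ).aestronglyMeasurable)
    ?_ ?_ ?_ ?_ ?_
  · simpa using key
  · have : Integrable (fun _ : Fin D → ℝ => M) (stdGauss D) := integrable_const M
    refine this.mono' (hcontexp 0).aestronglyMeasurable (Eventually.of_forall fun w => ?_)
    simpa using hM w
  · refine Continuous.aestronglyMeasurable ?_
    exact (hcontexp 0).smul (by fun_prop)
  · refine Eventually.of_forall fun w ξ hξ => ?_
    rw [norm_smul, norm_mul, Real.norm_eq_abs, Real.norm_eq_abs, abs_exp]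
    have h3 : ‖∑ i, (w i - ξ i) • (ContinuousLinearMap.proj i : (Fin D → ℝ) →L[ℝ] ℝ)‖ ≤
        D * ∏ i, exp (|w i|) := by
      refine norm_sum_smul_proj_le fun i => ?_
      have h5 : |ξ i| ≤ 1 :=
        (norm_le_pi_norm ξ i).trans (by simpa using (mem_ball_zero_iff.1 hξ).le)
      calc |w i - ξ i| ≤ |w i| + 1 := (abs_sub _ _).trans (by gcongr)
        _ ≤ exp (|w i|) := add_one_le_exp _
        _ ≤ _ := hone w i
    calc _ ≤ M * (∏ i, exp (|w i|)) * (D * ∏ i, exp (|w i|)) := by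
          gcongr
          · exact hM w
          · exact hexp ξ hξ w
      _ = M * D * ∏ i, exp (2 * |w i|) := by
          simp_rw [two_mul, exp_add, Finset.prod_mul_distrib]; ring
  · exact (integrable_exp_stdGauss D 2).const_mul _
  · refine Eventually.of_forall fun w ξ _ => ?_
    have h : HasFDerivAt (fun ξ : Fin D → ℝ => ∑ i, (ξ i * w i - ξ i ^ 2 / 2))
        (∑ i, (w i - ξ i) • (ContinuousLinearMap.proj i : (Fin D → ℝ) →L[ℝ] ℝ)) ξ := by
      refine HasFDerivAt.fun_sum fun i _ => ?_
      have h0 : HasFDerivAt (fun ξ : Fin D → ℝ => ξ i)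
        (ContinuousLinearMap.proj i : (Fin D → ℝ) →L[ℝ] ℝ) ξ := hasFDerivAt_apply i ξ
      have h1 := (h0.mul_const (w i)).sub ((h0.pow 2).mul_const (1 / 2))
      refine (h1.congr_of_eventuallyEq (Eventually.of_forall fun ξ => ?_)).congr_fderiv ?_
      · simp only [Pi.sub_apply]; ring
      · ext z
        simp
        ring
    have := (h.exp).const_mul (ψ w)
    refine this.congr_fderiv ?_
    rw [smul_smul]

lemma hasFDerivAt_stdGauss {D : ℕ} {ψ : (Fin D → ℝ) → ℝ} (hψ : Continuous ψ) {M : ℝ}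
    (hM : ∀ x, |ψ x| ≤ M) (v : Fin D → ℝ) :
    HasFDerivAt (fun v => ∫ w, ψ (v + w) ∂(stdGauss D))
      (∫ w, ψ (v + w) • (∑ i, w i • (ContinuousLinearMap.proj i : (Fin D → ℝ) →L[ℝ] ℝ))
        ∂(stdGauss D)) v := by
  have h := hasFDerivAt_stdGauss_zero (ψ := fun x => ψ (v + x)) (by fun_prop) (fun x => hM _)
  have h2 : HasFDerivAt (fun x : Fin D → ℝ => x - v) (ContinuousLinearMap.id ℝ (Fin D → ℝ)) v :=
    (hasFDerivAt_id v).sub_const v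
  have h' : HasFDerivAt (fun ξ => ∫ w, ψ (v + (ξ + w)) ∂(stdGauss D))
      (∫ w, ψ (v + w) • (∑ i, w i • (ContinuousLinearMap.proj i : (Fin D → ℝ) →L[ℝ] ℝ))
        ∂(stdGauss D)) ((fun x => x - v) v) := by
    simp only [sub_self]; exact h
  have := HasFDerivAt.comp (f := fun x => x - v) v h' h2
  refine this.congr_of_eventuallyEq (Eventually.of_forall fun x => ?_) |>.congr_fderiv ?_
  · simp only [Function.comp_apply]
    congr 1
    ext w
    congr 1
    abel
  · ext z; simp

/-- Average of the translates of `φ` with respect to `μ`. -/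
def avg {D : ℕ} (μ : Measure (Fin D → ℝ)) (φ : (Fin D → ℝ) → ℝ) (x : Fin D → ℝ) : ℝ :=
  ∫ y, φ (x + y) ∂μ

lemma avg_map_mulVec {D : ℕ} (B : Matrix (Fin D) (Fin D) ℝ) {φ : (Fin D → ℝ) → ℝ}
    (hφ : Continuous φ) (x : Fin D → ℝ) :
    avg ((stdGauss D).map (fun w => B *ᵥ w)) φ x = ∫ w, φ (x + B *ᵥ w) ∂(stdGauss D) := by
  unfold avg
  rw [integral_map (by fun_prop) (by fun_prop)]

lemma continuous_mulVec_const {D : ℕ} (B : Matrix (Fin D) (Fin D) ℝ) :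
    Continuous fun w : Fin D → ℝ => B *ᵥ w := by fun_prop

lemma avg_map_smooth {D : ℕ} {B B' : Matrix (Fin D) (Fin D) ℝ} (hB : B * B' = 1)
    {η : ℝ} (hη : ∀ i j, |B' i j| ≤ η) {φ : (Fin D → ℝ) → ℝ}
    (hφ : Continuous φ) {M : ℝ} (hM : ∀ x, |φ x| ≤ M) :
    ContDiff ℝ 1 (avg ((stdGauss D).map (fun w => B *ᵥ w)) φ) ∧
    ∀ k x, |pd (avg ((stdGauss D).map (fun w => B *ᵥ w)) φ) k x| ≤
      D * (∫ w, ‖w‖ ∂(stdGauss D)) * M * η := by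
  have hM0 : 0 ≤ M := (abs_nonneg _).trans (hM 0)
  have h1 : avg ((stdGauss D).map (fun w => B *ᵥ w)) φ =
      (fun v => ∫ w, φ (B *ᵥ (v + w)) ∂(stdGauss D)) ∘ fun x => B' *ᵥ x := by
    funext x
    rw [avg_map_mulVec B hφ]
    simp only [Function.comp_apply, mulVec_add, mulVec_mulVec, hB, one_mulVec]
  have hint : Integrable (fun w : Fin D → ℝ => ‖w‖) (stdGauss D) := by
    simpa using integrable_norm_rpow_stdGauss D (p := 1) zero_le_one
  have hintF : ∀ x, Integrable (fun w : Fin D → ℝ => φ (x + B *ᵥ w) •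
      (∑ i, w i • (ContinuousLinearMap.proj i : (Fin D → ℝ) →L[ℝ] ℝ))) (stdGauss D) := fun x => by
    refine (hint.const_mul (M * D)).mono' ?_ (Eventually.of_forall fun w => ?_)
    · exact Continuous.aestronglyMeasurable (by fun_prop)
    · rw [norm_smul, mul_assoc]
      refine mul_le_mul (hM _) ?_ (norm_nonneg _) hM0
      exact norm_sum_smul_proj_le fun i => norm_le_pi_norm w i
  have hd : ∀ x, HasFDerivAt (avg ((stdGauss D).map (fun w => B *ᵥ w)) φ)
      ((∫ w, φ (x + B *ᵥ w) • (∑ i, w i • (ContinuousLinearMap.proj i : (Fin D → ℝ) →L[ℝ] ℝ))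
        ∂(stdGauss D)).comp (Matrix.toLin' B').toContinuousLinearMap) x := fun x => by
    have h2 := hasFDerivAt_stdGauss (ψ := fun z => φ (B *ᵥ z)) (by fun_prop) (fun z => hM _)
      (B' *ᵥ x)
    simp only [mulVec_add, mulVec_mulVec, hB, one_mulVec] at h2
    have h3 : HasFDerivAt (fun x => B' *ᵥ x) (Matrix.toLin' B').toContinuousLinearMap x :=
      (Matrix.toLin' B').toContinuousLinearMap.hasFDerivAt
    rw [h1]
    have := HasFDerivAt.comp x (g := fun v => ∫ w, φ (B *ᵥ (v + w)) ∂(stdGauss D))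
      (by simpa only [mulVec_add] using h2) h3
    exact this
  have hpd : ∀ k, pd (avg ((stdGauss D).map (fun w => B *ᵥ w)) φ) k = fun x =>
      ∫ w, φ (x + B *ᵥ w) * (∑ i, w i * B' i k) ∂(stdGauss D) := fun k => by
    funext x
    rw [pd, (hd x).fderiv, ContinuousLinearMap.comp_apply,
      ContinuousLinearMap.integral_apply (hintF x)]
    congr 1
    ext w
    simp
  have hle : ∀ k (w : Fin D → ℝ), |∑ i, w i * B' i k| ≤ D * ‖w‖ * η := fun k w => by
    refine (Finset.abs_sum_le_sum_abs _ _).trans ?_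
    calc _ ≤ ∑ _i : Fin D, ‖w‖ * η := by
          refine Finset.sum_le_sum fun i _ => ?_
          rw [abs_mul]
          exact mul_le_mul (norm_le_pi_norm w i) (hη i k) (abs_nonneg _) (norm_nonneg _)
      _ = _ := by simp; ring
  have hbd : ∀ k x (w : Fin D → ℝ), |φ (x + B *ᵥ w) * (∑ i, w i * B' i k)| ≤
      (M * D * η) * ‖w‖ := fun k x w => by
    rw [abs_mul]
    calc _ ≤ M * (D * ‖w‖ * η) := mul_le_mul (hM _) (hle k w) (abs_nonneg _) hM0
      _ = _ := by ring
  refine ⟨contDiff_one_of_pd (fun x => (hd x).differentiableAt) fun k => ?_, fun k x => ?_⟩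
  · rw [hpd k]
    refine continuous_of_dominated (bound := fun w => (M * D * η) * ‖w‖) (fun x => ?_)
      (fun x => Eventually.of_forall fun w => hbd k x w) (hint.const_mul _)
      (Eventually.of_forall fun w => by fun_prop)
    exact Continuous.aestronglyMeasurable (by fun_prop)
  · rw [hpd k, ← Real.norm_eq_abs]
    refine (norm_integral_le_of_norm_le (hint.const_mul (M * D * η))
      (Eventually.of_forall fun w => hbd k x w)).trans (le_of_eq ?_)
    rw [integral_const_mul]
    ring

/-- A family of centred transition laws with covariance `∫_t^s A`, together with the moment and
smoothing bounds satisfied by the Gaussian ones. -/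
structure EvolFam {D : ℕ} (A : ℝ → Matrix (Fin D) (Fin D) ℝ) (c : ℝ)
    (μ : ℝ → ℝ → Measure (Fin D → ℝ)) : Prop where
  c_one : 1 ≤ c
  prob : ∀ t s, IsProbabilityMeasure (μ t s)
  comp : ∀ t s r, t ≤ s → s ≤ r → ∀ φ : (Fin D → ℝ) → ℝ, Continuous φ →
    ∀ M, (∀ x, |φ x| ≤ M) → avg (μ t s) (avg (μ s r) φ) = avg (μ t r) φ
  mom_int : ∀ t s, t ≤ s → ∀ p ∈ Icc (0:ℝ) 3, Integrable (fun y => ‖y‖ ^ p) (μ t s)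
  mom : ∀ t s, t ≤ s → ∀ p ∈ Icc (0:ℝ) 3, ∫ y, ‖y‖ ^ p ∂(μ t s) ≤ c * (s - t) ^ (p / 2)
  mean : ∀ t s, t ≤ s → ∀ i, ∫ y, y i ∂(μ t s) = 0
  cov : ∀ t s, t ≤ s → ∀ i j, ∫ y, y i * y j ∂(μ t s) = ∫ u in t..s, A u i j
  smooth : ∀ t s, t < s → ∀ φ : (Fin D → ℝ) → ℝ, Continuous φ →
    ∀ M, (∀ x, |φ x| ≤ M) → ContDiff ℝ 1 (avg (μ t s) φ) ∧
      ∀ k x, |pd (avg (μ t s) φ) k x| ≤ c * M * (s - t) ^ (-(1/2) : ℝ)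

lemma sum_quad_mul_transpose {D : ℕ} (B : Matrix (Fin D) (Fin D) ℝ) (y : Fin D → ℝ) :
    ∑ i, ∑ j, y i * (B * Bᵀ) i j * y j = ∑ k, (∑ i, y i * B i k) ^ 2 := by
  simp_rw [Matrix.mul_apply, Matrix.transpose_apply, sq, Finset.sum_mul_sum, Finset.mul_sum,
    Finset.sum_mul]
  rw [Finset.sum_comm]
  conv_rhs => rw [Finset.sum_comm]
  rw [Finset.sum_comm]
  refine Finset.sum_congr rfl fun i _ => ?_
  rw [Finset.sum_comm]
  exact Finset.sum_congr rfl fun j _ => Finset.sum_congr rfl fun k _ => by ring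

lemma charFunDual_map_stdGauss {D : ℕ} (B : Matrix (Fin D) (Fin D) ℝ)
    (L : StrongDual ℝ (Fin D → ℝ)) :
    charFunDual ((stdGauss D).map (fun w => B *ᵥ w)) L =
      Complex.exp (-(∑ i, ∑ j, L (Pi.single i 1) * (B * Bᵀ) i j * L (Pi.single j 1) : ℝ) / 2) := by
  have h := charFunDual_map (μ := stdGauss D) (Matrix.toLin' B).toContinuousLinearMap L
  have h' : ((stdGauss D).map (fun w => B *ᵥ w)) =
      (stdGauss D).map (Matrix.toLin' B).toContinuousLinearMap := rfl
  rw [h', h, charFunDual_stdGauss, sum_quad_mul_transpose]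
  congr 4
  refine Finset.sum_congr rfl fun k _ => ?_
  congr 1
  have : (Matrix.toLin' B).toContinuousLinearMap (Pi.single k 1) = ∑ i, B i k • (Pi.single i 1 : Fin D → ℝ) := by
    ext i
    simp [Finset.sum_apply, Pi.single_apply]
  rw [ContinuousLinearMap.comp_apply, this, map_sum]
  exact Finset.sum_congr rfl fun i _ => by rw [map_smul, smul_eq_mul, mul_comm]

lemma map_stdGauss_conv {D : ℕ} {B₁ B₂ B₃ : Matrix (Fin D) (Fin D) ℝ}
    (h : B₁ * B₁ᵀ + B₂ * B₂ᵀ = B₃ * B₃ᵀ) :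
    ((stdGauss D).map (fun w => B₁ *ᵥ w)) ∗ ((stdGauss D).map (fun w => B₂ *ᵥ w)) =
      (stdGauss D).map (fun w => B₃ *ᵥ w) := by
  have hp : ∀ B : Matrix (Fin D) (Fin D) ℝ,
      IsProbabilityMeasure ((stdGauss D).map (fun w => B *ᵥ w)) := fun B =>
    Measure.isProbabilityMeasure_map (by fun_prop)
  have := hp B₁
  have := hp B₂
  have := hp B₃
  refine Measure.ext_of_charFunDual ?_
  funext L
  rw [charFunDual_conv, charFunDual_map_stdGauss, charFunDual_map_stdGauss,
    charFunDual_map_stdGauss, ← Complex.exp_add, ← h]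
  congr 1
  simp_rw [Matrix.add_apply, mul_add, add_mul, Finset.sum_add_distrib]
  push_cast
  ring

lemma avg_map_stdGauss_comp {D : ℕ} {B₁ B₂ B₃ : Matrix (Fin D) (Fin D) ℝ}
    (h : B₁ * B₁ᵀ + B₂ * B₂ᵀ = B₃ * B₃ᵀ) {φ : (Fin D → ℝ) → ℝ} (hφ : Continuous φ)
    {M : ℝ} (hM : ∀ x, |φ x| ≤ M) :
    avg ((stdGauss D).map (fun w => B₁ *ᵥ w)) (avg ((stdGauss D).map (fun w => B₂ *ᵥ w)) φ) =
      avg ((stdGauss D).map (fun w => B₃ *ᵥ w)) φ := by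
  have hp : ∀ B : Matrix (Fin D) (Fin D) ℝ,
      IsProbabilityMeasure ((stdGauss D).map (fun w => B *ᵥ w)) := fun B =>
    Measure.isProbabilityMeasure_map (by fun_prop)
  have := hp B₁
  have := hp B₂
  funext x
  unfold avg
  rw [← map_stdGauss_conv h, integral_conv]
  · simp only [add_assoc]
  · have : Integrable (fun _ : Fin D → ℝ => M) (((stdGauss D).map (fun w => B₁ *ᵥ w)) ∗
      ((stdGauss D).map (fun w => B₂ *ᵥ w))) := integrable_const M
    exact this.mono' (by fun_prop) (Eventually.of_forall fun y => hM _)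

lemma abs_le_sqrt_sum_sq {D : ℕ} (v : Fin D → ℝ) (i : Fin D) {b : ℝ} (h : ∑ k, v k ^ 2 ≤ b) :
    |v i| ≤ √b := by
  refine abs_le_sqrt (le_trans ?_ h)
  exact Finset.single_le_sum (f := fun k => v k ^ 2) (fun k _ => sq_nonneg _) (Finset.mem_univ i)

section Square
variable {D : ℕ} {B : Matrix (Fin D) (Fin D) ℝ} {lo hi : ℝ}

lemma abs_entry_le (hB : ∀ y : Fin D → ℝ, ∑ k, (∑ i, y i * B i k) ^ 2 ≤ hi * ∑ i, y i ^ 2)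
    (i j : Fin D) : |B i j| ≤ √hi := by
  refine abs_le_sqrt_sum_sq (fun k => B i k) j ?_
  simpa [Pi.single_apply] using hB (Pi.single i 1)

lemma norm_mulVec_le_of_entry {b : ℝ} (hb : ∀ i j, |B i j| ≤ b) (hb0 : 0 ≤ b) (w : Fin D → ℝ) :
    ‖B *ᵥ w‖ ≤ D * b * ‖w‖ := by
  refine (pi_norm_le_iff_of_nonneg (by positivity)).2 fun i => ?_
  rw [Matrix.mulVec, dotProduct]
  refine (norm_sum_le _ _).trans ?_
  calc _ ≤ ∑ _k : Fin D, b * ‖w‖ := by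
        refine Finset.sum_le_sum fun k _ => ?_
        rw [norm_mul]
        exact mul_le_mul (hb i k) (norm_le_pi_norm w k) (norm_nonneg _) hb0
    _ = _ := by simp; ring

lemma exists_inverse_entry_le (hlo : 0 < lo)
    (hB : ∀ y : Fin D → ℝ, lo * ∑ i, y i ^ 2 ≤ ∑ k, (∑ i, y i * B i k) ^ 2) :
    ∃ B' : Matrix (Fin D) (Fin D) ℝ, B * B' = 1 ∧ ∀ i j, |B' i j| ≤ (√lo)⁻¹ := by
  have hdet : IsUnit B.det := by
    rw [isUnit_iff_ne_zero]
    intro h0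
    obtain ⟨v, hv0, hv⟩ := Matrix.exists_vecMul_eq_zero_iff.2 h0
    have h1 := hB v
    have h2 : ∀ k, ∑ i, v i * B i k = 0 := fun k => by
      simpa [Matrix.vecMul, dotProduct] using congrFun hv k
    simp only [h2] at h1
    simp only [ne_eq, OfNat.ofNat_ne_zero, not_false_eq_true, zero_pow, Finset.sum_const_zero] at h1
    have h3 : ∑ i, v i ^ 2 ≤ 0 := by
      by_contra hcon
      push Not at hcon
      nlinarith
    apply hv0
    funext i
    have h4 := abs_le_sqrt_sum_sq v i h3
    simpa using h4
  refine ⟨B⁻¹, Matrix.mul_nonsing_inv B hdet, fun i j => ?_⟩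
  have h1 := hB (fun j => B⁻¹ i j)
  have h2 : ∀ k, ∑ j, B⁻¹ i j * B j k = if i = k then 1 else 0 := fun k => by
    rw [← Matrix.mul_apply, Matrix.nonsing_inv_mul B hdet, Matrix.one_apply]
  simp only [h2] at h1
  have h3 : ∑ j, (B⁻¹ i j) ^ 2 ≤ lo⁻¹ := by
    have h4 : lo * ∑ j, (B⁻¹ i j) ^ 2 ≤ 1 := by simpa using h1
    calc _ = lo⁻¹ * (lo * ∑ j, (B⁻¹ i j) ^ 2) := by rw [inv_mul_cancel_left₀ hlo.ne']
      _ ≤ lo⁻¹ * 1 := by gcongr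
      _ = lo⁻¹ := mul_one _
  have := abs_le_sqrt_sum_sq (fun j => B⁻¹ i j) j h3
  rwa [sqrt_inv] at this

lemma integral_mul_map_stdGauss (i j : Fin D) :
    ∫ y, y i * y j ∂((stdGauss D).map (fun w => B *ᵥ w)) = (B * Bᵀ) i j := by
  rw [integral_map (by fun_prop) (by fun_prop)]
  have h1 : ∀ k l, Integrable (fun w : Fin D → ℝ => B i k * B j l * (w k * w l)) (stdGauss D) :=
    fun k l => by
      refine Integrable.const_mul ?_ _
      have := integrable_norm_rpow_stdGauss D (p := 2) zero_le_two
      refine this.mono' (by fun_prop) (Eventually.of_forall fun w => ?_)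
      rw [norm_mul, rpow_two, sq]
      exact mul_le_mul (norm_le_pi_norm w k) (norm_le_pi_norm w l) (norm_nonneg _) (norm_nonneg _)
  have h2 : ∀ w : Fin D → ℝ, (B *ᵥ w) i * (B *ᵥ w) j = ∑ k, ∑ l, B i k * B j l * (w k * w l) :=
    fun w => by
      simp only [Matrix.mulVec, dotProduct]
      rw [Finset.sum_mul_sum]
      exact Finset.sum_congr rfl fun k _ => Finset.sum_congr rfl fun l _ => by ring
  simp only [h2]
  rw [integral_finsetSum _ fun k _ => integrable_finsetSum _ fun l _ => h1 k l]
  simp_rw [integral_finsetSum _ fun l _ => h1 _ l, integral_const_mul, integral_eval_mul_stdGauss]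
  simp [Matrix.mul_apply]

lemma integral_eval_map_stdGauss (i : Fin D) :
    ∫ y, y i ∂((stdGauss D).map (fun w => B *ᵥ w)) = 0 := by
  have hm : Measurable fun y : Fin D → ℝ => y i := measurable_pi_apply i
  rw [integral_map (f := fun y : Fin D → ℝ => y i) (by fun_prop) hm.aestronglyMeasurable]
  simp only [Matrix.mulVec, dotProduct]
  rw [integral_finsetSum _ fun k _ => (integrable_eval_stdGauss k).const_mul _]
  simp [integral_const_mul, integral_eval_stdGauss]

lemma moment_map_stdGauss {b p : ℝ} (hb : ∀ w, ‖B *ᵥ w‖ ≤ b * ‖w‖) (hb0 : 0 ≤ b) (hp : 0 ≤ p) :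
    Integrable (fun y => ‖y‖ ^ p) ((stdGauss D).map (fun w => B *ᵥ w)) ∧
    ∫ y, ‖y‖ ^ p ∂((stdGauss D).map (fun w => B *ᵥ w)) ≤ b ^ p * ∫ w, ‖w‖ ^ p ∂(stdGauss D) := by
  have hm : Measurable fun y : Fin D → ℝ => ‖y‖ ^ p := measurable_norm.pow_const p
  have hle : ∀ w, ‖B *ᵥ w‖ ^ p ≤ b ^ p * ‖w‖ ^ p := fun w => by
    rw [← mul_rpow hb0 (norm_nonneg _)]
    exact rpow_le_rpow (norm_nonneg _) (hb w) hp
  have hi := (integrable_norm_rpow_stdGauss D hp).const_mul (b ^ p)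
  have hi' : Integrable (fun w => ‖B *ᵥ w‖ ^ p) (stdGauss D) := by
    refine hi.mono' (hm.comp (continuous_mulVec_const B).measurable).aestronglyMeasurable
      (Eventually.of_forall fun w => ?_)
    rw [Real.norm_eq_abs, abs_of_nonneg (by positivity)]
    exact hle w
  refine ⟨?_, ?_⟩
  · rw [integrable_map_measure hm.aestronglyMeasurable (by fun_prop)]
    exact hi'
  · rw [integral_map (by fun_prop) hm.aestronglyMeasurable, ← integral_const_mul]
    exact integral_mono hi' hi hle

end Square

lemma sum_mul_integral_mul {D : ℕ} {A : ℝ → Matrix (Fin D) (Fin D) ℝ}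
    (hc : ∀ i j, Continuous fun t => A t i j) (t s : ℝ) (y : Fin D → ℝ) :
    ∑ i, ∑ j, y i * (∫ u in t..s, A u i j) * y j =
      ∫ u in t..s, ∑ i, ∑ j, y i * A u i j * y j := by
  have h1 : ∀ i j, IntervalIntegrable (fun u => y i * A u i j * y j) volume t s := fun i j =>
    (((hc i j).const_mul (y i)).mul_const (y j)).intervalIntegrable _ _
  rw [intervalIntegral.integral_finsetSum fun i _ => by
    have := IntervalIntegrable.sum Finset.univ fun j (_ : j ∈ Finset.univ) => h1 i j
    rwa [Finset.sum_fn] at this]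
  refine Finset.sum_congr rfl fun i _ => ?_
  rw [intervalIntegral.integral_finsetSum fun j _ => h1 i j]
  refine Finset.sum_congr rfl fun j _ => ?_
  rw [intervalIntegral.integral_mul_const, intervalIntegral.integral_const_mul]

open scoped MatrixOrder in
lemma exists_mul_transpose_eq {D : ℕ} {S : Matrix (Fin D) (Fin D) ℝ} (hS : S.PosSemidef) :
    ∃ B : Matrix (Fin D) (Fin D) ℝ, B * Bᵀ = S := by
  refine ⟨CFC.sqrt S, ?_⟩
  have h : (CFC.sqrt S)ᵀ = CFC.sqrt S := by
    rw [← Matrix.conjTranspose_eq_transpose_of_trivial]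
    exact (CFC.sqrt_nonneg S).isSelfAdjoint
  rw [h, CFC.sqrt_mul_sqrt_self _ hS.nonneg]

lemma exists_evolFam {D : ℕ} {A : ℝ → Matrix (Fin D) (Fin D) ℝ} {δ δ' : ℝ} (hδ : 0 < δ)
    (hδ' : 0 < δ') (hc : ∀ i j, Continuous fun t => A t i j) (hsymm : ∀ t i j, A t i j = A t j i)
    (hlo : ∀ t (y : Fin D → ℝ), δ * ∑ i, y i ^ 2 ≤ ∑ i, ∑ j, y i * A t i j * y j)
    (hhi : ∀ t (y : Fin D → ℝ), ∑ i, ∑ j, y i * A t i j * y j ≤ δ' * ∑ i, y i ^ 2) :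
    ∃ c μ, EvolFam A c μ := by
  have hquadc : ∀ y : Fin D → ℝ, Continuous fun u => ∑ i, ∑ j, y i * A u i j * y j := fun y =>
    continuous_finsetSum _ fun i _ => continuous_finsetSum _ fun j _ =>
      ((hc i j).const_mul (y i)).mul_const (y j)
  have hex : ∀ t s : ℝ, ∃ B : Matrix (Fin D) (Fin D) ℝ,
      t ≤ s → ∀ i j, (B * Bᵀ) i j = ∫ u in t..s, A u i j := fun t s => by
    by_cases hts : t ≤ s
    · have hpos : (Matrix.of fun i j => ∫ u in t..s, A u i j).PosSemidef := by
        refine Matrix.PosSemidef.of_dotProduct_mulVec_nonneg ?_ fun y => ?_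
        · ext i j
          simp only [Matrix.conjTranspose_apply, Matrix.of_apply, star_trivial, hsymm _ j i]
        · have : star y ⬝ᵥ (Matrix.of (fun i j => ∫ u in t..s, A u i j) *ᵥ y) =
              ∑ i, ∑ j, y i * (∫ u in t..s, A u i j) * y j := by
            simp [dotProduct, Matrix.mulVec, Finset.mul_sum, mul_assoc]
          rw [this, sum_mul_integral_mul hc]
          refine intervalIntegral.integral_nonneg hts fun u _ => ?_
          exact le_trans (by positivity) (hlo u y)
      obtain ⟨B, hB⟩ := exists_mul_transpose_eq hpos
      exact ⟨B, fun _ i j => by rw [hB, Matrix.of_apply]⟩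
    · exact ⟨0, fun h => absurd h hts⟩
  choose B hB using hex
  have hquad : ∀ t s, t ≤ s → ∀ y : Fin D → ℝ,
      ∑ k, (∑ i, y i * B t s i k) ^ 2 = ∫ u in t..s, ∑ i, ∑ j, y i * A u i j * y j := by
    intro t s hts y
    rw [← sum_quad_mul_transpose, ← sum_mul_integral_mul hc]
    simp only [hB t s hts]
  have hint : ∀ t s, t ≤ s → ∀ y : Fin D → ℝ,
      δ * (s - t) * ∑ i, y i ^ 2 ≤ ∑ k, (∑ i, y i * B t s i k) ^ 2 ∧
      ∑ k, (∑ i, y i * B t s i k) ^ 2 ≤ δ' * (s - t) * ∑ i, y i ^ 2 := by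
    intro t s hts y
    rw [hquad t s hts]
    constructor
    · have := intervalIntegral.integral_mono_on (μ := volume) (f := fun _ => δ * ∑ i, y i ^ 2) hts
        intervalIntegrable_const ((hquadc y).intervalIntegrable t s) (fun u _ => hlo u y)
      refine le_trans (le_of_eq ?_) this
      simp; ring
    · have := intervalIntegral.integral_mono_on (μ := volume) (g := fun _ => δ' * ∑ i, y i ^ 2) hts
        ((hquadc y).intervalIntegrable t s) intervalIntegrable_const (fun u _ => hhi u y)
      refine this.trans (le_of_eq ?_)
      simp; ring
  set m := ∫ w : Fin D → ℝ, ‖w‖ ^ (3:ℝ) ∂(stdGauss D) with hm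
  set m1 := ∫ w : Fin D → ℝ, ‖w‖ ∂(stdGauss D) with hm1
  have hm0 : 0 ≤ m := integral_nonneg fun w => by positivity
  have hm10 : 0 ≤ m1 := integral_nonneg fun w => by positivity
  set b := D * √δ' with hb
  have hb0 : 0 ≤ b := by positivity
  set c1 := (1 + b) ^ (3:ℝ) * (1 + m) with hc1
  set c2 := D * m1 * (√δ)⁻¹ with hc2
  have hc10 : 1 ≤ c1 := by
    have h1 : 1 ≤ (1 + b) ^ (3:ℝ) := one_le_rpow (by linarith) (by norm_num)
    nlinarith
  have hc20 : 0 ≤ c2 := by positivity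
  have hmv : ∀ t s, t ≤ s → ∀ w, ‖B t s *ᵥ w‖ ≤ b * √(s - t) * ‖w‖ := by
    intro t s hts w
    have h1 := abs_entry_le (B := B t s) (hi := δ' * (s - t)) (fun y => (hint t s hts y).2)
    have := norm_mulVec_le_of_entry h1 (by positivity) w
    rwa [sqrt_mul hδ'.le, ← mul_assoc] at this
  refine ⟨c1 + c2, fun t s => (stdGauss D).map (fun w => B t s *ᵥ w), ?_, ?_, ?_, ?_, ?_, ?_, ?_, ?_⟩
  · linarith
  · exact fun t s => Measure.isProbabilityMeasure_map (by fun_prop)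
  · intro t s r hts hsr φ hφ M hM
    refine avg_map_stdGauss_comp ?_ hφ hM
    ext i j
    rw [Matrix.add_apply, hB t s hts, hB s r hsr, hB t r (hts.trans hsr)]
    exact intervalIntegral.integral_add_adjacent_intervals ((hc i j).intervalIntegrable _ _)
      ((hc i j).intervalIntegrable _ _)
  · intro t s hts p hp
    exact (moment_map_stdGauss (hmv t s hts) (by positivity) hp.1).1
  · intro t s hts p hp
    refine (moment_map_stdGauss (hmv t s hts) (by positivity) hp.1).2.trans ?_
    have h0 : 0 ≤ s - t := sub_nonneg.2 hts
    rw [mul_rpow hb0 (sqrt_nonneg _)]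
    have h1 : √(s - t) ^ p = (s - t) ^ (p / 2) := by
      rw [sqrt_eq_rpow, ← rpow_mul h0]; congr 1; ring
    have h2 : b ^ p ≤ (1 + b) ^ (3:ℝ) :=
      (rpow_le_rpow hb0 (by linarith) hp.1).trans (rpow_le_rpow_of_exponent_le (by linarith) hp.2)
    have h3 : ∫ w : Fin D → ℝ, ‖w‖ ^ p ∂(stdGauss D) ≤ 1 + m := by
      have h4 : 1 + m = ∫ w : Fin D → ℝ, (1 + ‖w‖ ^ (3:ℝ)) ∂(stdGauss D) := by
        rw [integral_add (integrable_const _) (integrable_norm_rpow_stdGauss D (by norm_num))]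
        simp [hm]
      rw [h4]
      refine integral_mono (integrable_norm_rpow_stdGauss D hp.1)
        ((integrable_const _).add (integrable_norm_rpow_stdGauss D (by norm_num))) fun w => ?_
      rcases le_total ‖w‖ 1 with h | h
      · have := rpow_le_one (norm_nonneg w) h hp.1
        have : 0 ≤ ‖w‖ ^ (3:ℝ) := by positivity
        show ‖w‖ ^ p ≤ 1 + ‖w‖ ^ (3:ℝ)
        linarith
      · have := rpow_le_rpow_of_exponent_le h hp.2
        show ‖w‖ ^ p ≤ 1 + ‖w‖ ^ (3:ℝ)
        linarith
    have h5 : 0 ≤ ∫ w : Fin D → ℝ, ‖w‖ ^ p ∂(stdGauss D) := integral_nonneg fun w => by positivity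
    rw [h1]
    have h6 : 0 ≤ (s - t) ^ (p / 2) := rpow_nonneg h0 _
    calc _ = b ^ p * (∫ w : Fin D → ℝ, ‖w‖ ^ p ∂(stdGauss D)) * (s - t) ^ (p / 2) := by ring
      _ ≤ c1 * (s - t) ^ (p / 2) := by
        refine mul_le_mul_of_nonneg_right ?_ h6
        exact mul_le_mul h2 h3 h5 (by positivity)
      _ ≤ _ := mul_le_mul_of_nonneg_right (by linarith) h6
  · exact fun t s _ i => integral_eval_map_stdGauss i
  · exact fun t s hts i j => by rw [integral_mul_map_stdGauss, hB t s hts]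
  · intro t s hts φ hφ M hM
    have hM0 : 0 ≤ M := (abs_nonneg _).trans (hM 0)
    have h0 : 0 < s - t := sub_pos.2 hts
    obtain ⟨B', hBB, hB'⟩ := exists_inverse_entry_le (B := B t s) (lo := δ * (s - t))
      (by positivity) (fun y => (hint t s hts.le y).1)
    obtain ⟨h1, h2⟩ := avg_map_smooth hBB hB' hφ hM
    refine ⟨h1, fun k x => (h2 k x).trans ?_⟩
    have h3 : (√(δ * (s - t)))⁻¹ = (√δ)⁻¹ * (s - t) ^ (-(1/2) : ℝ) := by
      rw [sqrt_mul hδ.le, mul_inv, rpow_neg h0.le, ← sqrt_eq_rpow]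
    rw [h3]
    have h6 : 0 ≤ (s - t) ^ (-(1/2) : ℝ) := rpow_nonneg h0.le _
    calc _ = c2 * M * (s - t) ^ (-(1/2) : ℝ) := by rw [hc2]; ring
      _ ≤ _ := by gcongr; linarith

/-- Continuous functions bounded by `M`. -/
structure BC {D : ℕ} (φ : (Fin D → ℝ) → ℝ) (M : ℝ) : Prop where
  cont : Continuous φ
  bdd : ∀ x, |φ x| ≤ M

section Avg
variable {D : ℕ} {φ ψ : (Fin D → ℝ) → ℝ} {M M' : ℝ}

lemma BC.nonneg (h : BC φ M) : 0 ≤ M := (abs_nonneg _).trans (h.bdd 0)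

lemma BC.mono (h : BC φ M) (hM : M ≤ M') : BC φ M' := ⟨h.cont, fun x => (h.bdd x).trans hM⟩

lemma BC.sub (h : BC φ M) (h' : BC ψ M') : BC (fun x => φ x - ψ x) (M + M') :=
  ⟨h.cont.sub h'.cont, fun x => (abs_sub _ _).trans (add_le_add (h.bdd x) (h'.bdd x))⟩

lemma BC.pd_of_lip (h : ContDiff ℝ 1 φ) (hM : 0 ≤ M) (hL : ∀ x y, |φ x - φ y| ≤ M * ‖x - y‖)
    (k : Fin D) : BC (pd φ k) M :=
  ⟨h.continuous_pd k, abs_pd_le_of_lip hM hL k⟩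

variable (μ : Measure (Fin D → ℝ)) [IsProbabilityMeasure μ]

lemma BC.integrable (h : BC φ M) (x : Fin D → ℝ) : Integrable (fun y => φ (x + y)) μ := by
  have hφ := h.cont
  exact (integrable_const M).mono' (Continuous.aestronglyMeasurable (by fun_prop))
    (Eventually.of_forall fun y => h.bdd _)

lemma abs_avg_sub_avg_le (h : BC φ M) (h' : BC ψ M') {x x' : Fin D → ℝ} {b : ℝ}
    (hb : ∀ y, |φ (x + y) - ψ (x' + y)| ≤ b) : |avg μ φ x - avg μ ψ x'| ≤ b := by
  unfold avg
  rw [← integral_sub (h.integrable μ x) (h'.integrable μ x'), ← Real.norm_eq_abs]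
  refine (norm_integral_le_of_norm_le_const (Eventually.of_forall hb)).trans (by simp)

lemma avg_sub (h : BC φ M) (h' : BC ψ M') (x : Fin D → ℝ) :
    avg μ (fun x => φ x - ψ x) x = avg μ φ x - avg μ ψ x :=
  integral_sub (h.integrable μ x) (h'.integrable μ x)

lemma BC.avg (h : BC φ M) : BC (avg μ φ) M := by
  have hφ := h.cont
  refine ⟨?_, fun x => ?_⟩
  · refine continuous_of_dominated (bound := fun _ => M)
      (fun x => Continuous.aestronglyMeasurable (by fun_prop))
      (fun x => Eventually.of_forall fun y => h.bdd _) (integrable_const _)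
      (Eventually.of_forall fun y => by fun_prop)
  · unfold _root_.avg
    rw [← Real.norm_eq_abs]
    exact (norm_integral_le_of_norm_le_const (Eventually.of_forall fun y => h.bdd _)).trans
      (by simp)

lemma avg_holder (h : BC φ M) {H p : ℝ} (hH : ∀ x y, |φ x - φ y| ≤ H * ‖x - y‖ ^ p)
    (x y : Fin D → ℝ) : |avg μ φ x - avg μ φ y| ≤ H * ‖x - y‖ ^ p :=
  abs_avg_sub_avg_le μ h h fun z => by simpa using hH (x + z) (y + z)

lemma avg_lip (h : BC φ M) {L : ℝ} (hL : ∀ x y, |φ x - φ y| ≤ L * ‖x - y‖)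
    (x y : Fin D → ℝ) : |avg μ φ x - avg μ φ y| ≤ L * ‖x - y‖ :=
  abs_avg_sub_avg_le μ h h fun z => by simpa using hL (x + z) (y + z)

lemma abs_avg_sub_self_le (h : BC φ M) {H p : ℝ} (hH : ∀ x y, |φ x - φ y| ≤ H * ‖x - y‖ ^ p)
    (hp : Integrable (fun y => ‖y‖ ^ p) μ) (x : Fin D → ℝ) :
    |avg μ φ x - φ x| ≤ H * ∫ y, ‖y‖ ^ p ∂μ := by
  have h1 : φ x = ∫ _y, φ x ∂μ := by simp
  unfold avg
  rw [h1, ← integral_sub (h.integrable μ x) (integrable_const _), ← Real.norm_eq_abs,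
    ← integral_const_mul]
  refine norm_integral_le_of_norm_le (hp.const_mul _) (Eventually.of_forall fun y => ?_)
  simpa using hH (x + y) x

lemma hasFDerivAt_avg (h : BC φ M) (hd : ContDiff ℝ 1 φ) (hM' : ∀ k, BC (pd φ k) M') (x : Fin D → ℝ) :
    HasFDerivAt (avg μ φ) (∫ y, fderiv ℝ φ (x + y) ∂μ) x ∧
      Integrable (fun y => fderiv ℝ φ (x + y)) μ := by
  have hb : ∀ z, ‖fderiv ℝ φ z‖ ≤ D * M' := fun z => by
    rw [fderiv_eq_sum_pd]
    exact norm_sum_smul_proj_le fun i => (hM' i).bdd z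
  have hc : Continuous (fderiv ℝ φ) := hd.continuous_fderiv (by simp)
  have hm : ∀ x, AEStronglyMeasurable (fun y => fderiv ℝ φ (x + y)) μ := fun x =>
    Continuous.aestronglyMeasurable (hc.comp (continuous_const_add x))
  refine ⟨?_, (integrable_const (D * M')).mono' (hm x) (Eventually.of_forall fun y => hb _)⟩
  exact hasFDerivAt_integral_of_dominated_of_fderiv_le (𝕜 := ℝ) (μ := μ)
    (F := fun x y => φ (x + y)) (F' := fun x y => fderiv ℝ φ (x + y)) (x₀ := x)
    (s := univ) (bound := fun _ => D * M') univ_mem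
    (Eventually.of_forall fun z => (h.integrable μ z).aestronglyMeasurable)
    (h.integrable μ x) (hm x) (Eventually.of_forall fun y z _ => hb _)
    (integrable_const _) (Eventually.of_forall fun y z _ => by
      have := (hd.differentiable (by simp) (z + y)).hasFDerivAt
      exact (hasFDerivAt_comp_add_right y).2 this)

lemma pd_avg (h : BC φ M) (hd : ContDiff ℝ 1 φ) (hM' : ∀ k, BC (pd φ k) M') (k : Fin D) :
    pd (avg μ φ) k = avg μ (pd φ k) := by
  funext x
  obtain ⟨h1, h2⟩ := hasFDerivAt_avg μ h hd hM' x
  rw [pd, h1.fderiv, ContinuousLinearMap.integral_apply h2]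
  rfl

lemma contDiff_one_avg (h : BC φ M) (hd : ContDiff ℝ 1 φ) (hM' : ∀ k, BC (pd φ k) M') :
    ContDiff ℝ 1 (avg μ φ) := by
  refine contDiff_one_of_pd (fun x => (hasFDerivAt_avg μ h hd hM' x).1.differentiableAt) fun k => ?_
  rw [pd_avg μ h hd hM']
  exact ((hM' k).avg μ).cont

lemma contDiff_two_avg (h : BC φ M) (hd : ContDiff ℝ 2 φ) (hM' : ∀ k, BC (pd φ k) M')
    (hM'' : ∀ d e, BC (pdd φ d e) M') : ContDiff ℝ 2 (avg μ φ) ∧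
    ∀ d e, pdd (avg μ φ) d e = avg μ (pdd φ d e) := by
  have hd1 : ContDiff ℝ 1 φ := hd.of_le (by norm_num)
  refine ⟨contDiff_two_of_pd ((contDiff_one_avg μ h hd1 hM').differentiable (by simp)) fun k => ?_,
    fun d e => ?_⟩
  · rw [pd_avg μ h hd1 hM']
    exact contDiff_one_avg μ (hM' k) (hd.pd_one k) fun d => hM'' d k
  · rw [pdd_eq, pd_avg μ h hd1 hM', pd_avg μ (hM' e) (hd.pd_one e) fun d => hM'' d e]
    rfl
end Avg

/-- Bounded Lipschitz functions. -/
structure BL {D : ℕ} (φ : (Fin D → ℝ) → ℝ) (M L : ℝ) : Prop extends BC φ M where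
  L_nonneg : 0 ≤ L
  lip : ∀ x y, |φ x - φ y| ≤ L * ‖x - y‖

lemma le_rpow_mul_rpow {z a b α : ℝ} (hz : 0 ≤ z) (ha : z ≤ a) (hb : z ≤ b) (hα : α ∈ Icc (0:ℝ) 1) :
    z ≤ a ^ (1 - α) * b ^ α := by
  have h1 : z = z ^ (1 - α) * z ^ α := by
    rw [← rpow_add_of_nonneg hz (by linarith [hα.2]) hα.1]; simp
  calc z = z ^ (1 - α) * z ^ α := h1
    _ ≤ _ := mul_le_mul (rpow_le_rpow hz ha (by linarith [hα.2])) (rpow_le_rpow hz hb hα.1)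
      (rpow_nonneg hz _) (rpow_nonneg (hz.trans ha) _)

lemma le_mul_rpow_mul_rpow {z a b α k : ℝ} (hz : 0 ≤ z) (hk : 0 ≤ k) (ha0 : 0 ≤ a) (hb0 : 0 ≤ b)
    (ha : z ≤ k * a) (hb : z ≤ k * b) (hα : α ∈ Icc (0:ℝ) 1) :
    z ≤ k * (a ^ (1 - α) * b ^ α) := by
  refine (le_rpow_mul_rpow hz ha hb hα).trans (le_of_eq ?_)
  rw [mul_rpow hk ha0, mul_rpow hk hb0]
  have : k ^ (1 - α) * k ^ α = k := by
    rw [← rpow_add_of_nonneg hk (by linarith [hα.2]) hα.1]; simp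
  calc _ = (k ^ (1 - α) * k ^ α) * (a ^ (1 - α) * b ^ α) := by ring
    _ = _ := by rw [this]

lemma BL.holder {D : ℕ} {φ : (Fin D → ℝ) → ℝ} {M L α : ℝ} (h : BL φ M L) (hα : α ∈ Icc (0:ℝ) 1)
    (x y : Fin D → ℝ) : |φ x - φ y| ≤ (2 * M + L) * ‖x - y‖ ^ α := by
  have hM := h.toBC.nonneg
  have hL := h.L_nonneg
  have h1 : |φ x - φ y| ≤ (2 * M + L) * 1 := by
    have := (abs_sub _ _).trans (add_le_add (h.bdd x) (h.bdd y))
    linarith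
  have h2 : |φ x - φ y| ≤ (2 * M + L) * ‖x - y‖ := by
    refine (h.lip x y).trans ?_
    gcongr
    linarith
  have := le_mul_rpow_mul_rpow (abs_nonneg _) (by positivity) zero_le_one (norm_nonneg _) h1 h2 hα
  simpa using this

lemma half_rpow_le {h : ℝ} (hh : 0 ≤ h) : (h / 2) ^ (-(1/2) : ℝ) ≤ 2 * h ^ (-(1/2) : ℝ) := by
  rw [div_rpow hh zero_le_two, div_eq_mul_inv, mul_comm, ← rpow_neg zero_le_two, neg_neg]
  have : (2:ℝ) ^ (1/2 : ℝ) ≤ 2 := by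
    calc (2:ℝ) ^ (1/2 : ℝ) ≤ 2 ^ (1:ℝ) := rpow_le_rpow_of_exponent_le one_le_two (by norm_num)
      _ = 2 := rpow_one 2
  gcongr

lemma rpow_neg_half_mul_self {h : ℝ} (hh : 0 < h) : h ^ (-(1/2) : ℝ) * h ^ (-(1/2) : ℝ) = h⁻¹ := by
  rw [← rpow_add hh, ← rpow_neg_one]; norm_num

namespace EvolFam
variable {D : ℕ} {A : ℝ → Matrix (Fin D) (Fin D) ℝ} {c : ℝ} {μ : ℝ → ℝ → Measure (Fin D → ℝ)}
  {φ : (Fin D → ℝ) → ℝ} {M L t s : ℝ}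

lemma abs_avg_sub_self (h : EvolFam A c μ) (hts : t ≤ s) (hφ : BC φ M) {H p : ℝ} (hH0 : 0 ≤ H)
    (hp : p ∈ Icc (0:ℝ) 3)
    (hH : ∀ x y, |φ x - φ y| ≤ H * ‖x - y‖ ^ p) (x : Fin D → ℝ) :
    |avg (μ t s) φ x - φ x| ≤ H * (c * (s - t) ^ (p / 2)) := by
  have := h.prob t s
  refine (abs_avg_sub_self_le (μ t s) hφ hH (h.mom_int t s hts p hp) x).trans ?_
  gcongr
  exact h.mom t s hts p hp

lemma abs_avg_sub_self_lip (h : EvolFam A c μ) (hts : t ≤ s) (hφ : BL φ M L) (x : Fin D → ℝ) :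
    |avg (μ t s) φ x - φ x| ≤ L * (c * (s - t) ^ (1 / 2 : ℝ)) :=
  h.abs_avg_sub_self hts hφ.toBC hφ.L_nonneg (p := 1) (by norm_num)
    (fun x y => by simpa using hφ.lip x y) x

lemma avg_self (h : EvolFam A c μ) (hφ : BL φ M L) : avg (μ t t) φ = φ := by
  funext x
  have := h.abs_avg_sub_self_lip le_rfl hφ x (t := t)
  simp only [sub_self, ne_eq, one_div, inv_eq_zero, OfNat.ofNat_ne_zero, not_false_eq_true,
    zero_rpow, mul_zero] at this
  exact sub_eq_zero.1 (abs_nonpos_iff.1 this)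

lemma bl_avg (h : EvolFam A c μ) (hφ : BL φ M L) : BL (avg (μ t s) φ) M L := by
  have := h.prob t s
  exact ⟨hφ.toBC.avg _, hφ.L_nonneg, avg_lip _ hφ.toBC hφ.lip⟩

lemma pd_avg_bl (h : EvolFam A c μ) (hts : t < s) (hφ : BL φ M L) (k : Fin D) :
    BC (pd (avg (μ t s) φ) k) L :=
  BC.pd_of_lip (h.smooth t s hts φ hφ.cont M hφ.bdd).1 hφ.L_nonneg (h.bl_avg hφ).lip k

lemma smooth_two_aux (h : EvolFam A c μ) (hts : t < s) (hφ : BL φ M L) (e : Fin D) :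
    pd (avg (μ t s) φ) e = avg (μ t ((t + s) / 2)) (pd (avg (μ ((t + s) / 2) s) φ) e) := by
  set m := (t + s) / 2 with hm
  have h1 : t < m := by rw [hm]; linarith
  have h2 : m < s := by rw [hm]; linarith
  have := h.prob t m
  rw [← h.comp t m s h1.le h2.le φ hφ.cont M hφ.bdd]
  exact pd_avg _ (h.bl_avg hφ).toBC (h.smooth m s h2 φ hφ.cont M hφ.bdd).1
    (fun k => h.pd_avg_bl h2 hφ k) e

lemma smooth_two (h : EvolFam A c μ) (hts : t < s) (hφ : BL φ M L) :
    ContDiff ℝ 2 (avg (μ t s) φ) ∧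
    ∀ d e, BC (pdd (avg (μ t s) φ) d e) (2 * c * L * (s - t) ^ (-(1/2) : ℝ)) := by
  have hc := h.c_one
  have hL := hφ.L_nonneg
  set m := (t + s) / 2 with hm
  have h1 : t < m := by rw [hm]; linarith
  have h2 : m < s := by rw [hm]; linarith
  have h3 : m - t = (s - t) / 2 := by rw [hm]; ring
  have h4 : 0 ≤ s - t := by linarith
  have key : ∀ e, ContDiff ℝ 1 (pd (avg (μ t s) φ) e) ∧
      ∀ d x, |pd (pd (avg (μ t s) φ) e) d x| ≤ 2 * c * L * (s - t) ^ (-(1/2) : ℝ) := fun e => by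
    rw [h.smooth_two_aux hts hφ e]
    have hbc := h.pd_avg_bl h2 hφ e
    obtain ⟨h5, h6⟩ := h.smooth t m h1 _ hbc.cont L hbc.bdd
    refine ⟨h5, fun d x => (h6 d x).trans ?_⟩
    rw [h3]
    calc _ ≤ c * L * (2 * (s - t) ^ (-(1/2) : ℝ)) := by
          gcongr
          exact half_rpow_le h4
      _ = _ := by ring
  refine ⟨contDiff_two_of_pd ((h.smooth t s hts φ hφ.cont M hφ.bdd).1.differentiable (by simp))
    fun k => (key k).1, fun d e => ⟨?_, fun x => (key e).2 d x⟩⟩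
  exact (key e).1.continuous_pd d

lemma pdd_lip (h : EvolFam A c μ) (hts : t < s) (hφ : BL φ M L) (d e : Fin D) (x y : Fin D → ℝ) :
    |pdd (avg (μ t s) φ) d e x - pdd (avg (μ t s) φ) d e y| ≤
      16 * D ^ 2 * c ^ 2 * L * (s - t)⁻¹ * ‖x - y‖ := by
  have hc := h.c_one
  have hL := hφ.L_nonneg
  set m := (t + s) / 2 with hm
  have h1 : t < m := by rw [hm]; linarith
  have h2 : m < s := by rw [hm]; linarith
  have h3 : m - t = (s - t) / 2 := by rw [hm]; ring
  have h3' : s - m = (s - t) / 2 := by rw [hm]; ring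
  have h4 : 0 < s - t := by linarith
  have hr : 0 ≤ (s - t) ^ (-(1/2) : ℝ) := by positivity
  obtain ⟨h5, h6⟩ := h.smooth_two h2 hφ
  have hbl : BL (pd (avg (μ m s) φ) e) L (D * (4 * c * L * (s - t) ^ (-(1/2) : ℝ))) := by
    refine ⟨h.pd_avg_bl h2 hφ e, by positivity, fun x y => ?_⟩
    refine lip_of_abs_pd_le ((h5.pd_one e).differentiable (by simp)) (by positivity)
      (fun k x => ((h6 k e).bdd x).trans ?_) x y
    rw [h3']
    calc _ ≤ 2 * c * L * (2 * (s - t) ^ (-(1/2) : ℝ)) := by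
          gcongr
          exact half_rpow_le h4.le
      _ = _ := by ring
  obtain ⟨h7, h8⟩ := h.smooth_two h1 hbl
  rw [pdd_eq, h.smooth_two_aux hts hφ e]
  refine (lip_of_abs_pd_le (L := 16 * D * c ^ 2 * L * (s - t)⁻¹)
    ((h7.pd_one d).differentiable (by simp)) (by positivity)
    (fun k x => ((h8 k d).bdd x).trans ?_) x y).trans (le_of_eq (by ring))
  rw [h3]
  calc _ ≤ 2 * c * (D * (4 * c * L * (s - t) ^ (-(1/2) : ℝ))) * (2 * (s - t) ^ (-(1/2) : ℝ)) := by
        gcongr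
        exact half_rpow_le h4.le
    _ = 16 * D * c ^ 2 * L * ((s - t) ^ (-(1/2) : ℝ) * (s - t) ^ (-(1/2) : ℝ)) := by ring
    _ ≤ _ := by rw [rpow_neg_half_mul_self h4]

lemma pdd_holder (h : EvolFam A c μ) (hts : t < s) (hφ : BL φ M L) {α : ℝ} (hα : α ∈ Icc (0:ℝ) 1)
    (d e : Fin D) (x y : Fin D → ℝ) :
    |pdd (avg (μ t s) φ) d e x - pdd (avg (μ t s) φ) d e y| ≤
      (4 * c + 16 * D ^ 2 * c ^ 2) * L * (s - t) ^ (-((1 + α) / 2)) * ‖x - y‖ ^ α := by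
  have hc := h.c_one
  have hL := hφ.L_nonneg
  have h4 : 0 < s - t := by linarith
  have hr : 0 ≤ (s - t) ^ (-(1/2) : ℝ) := by positivity
  have h1 : |pdd (avg (μ t s) φ) d e x - pdd (avg (μ t s) φ) d e y| ≤
      ((4 * c + 16 * D ^ 2 * c ^ 2) * L) * (s - t) ^ (-(1/2) : ℝ) := by
    have h5 := (h.smooth_two hts hφ).2 d e
    refine ((abs_sub _ _).trans (add_le_add (h5.bdd x) (h5.bdd y))).trans ?_
    have : 0 ≤ 16 * D ^ 2 * c ^ 2 * L * (s - t) ^ (-(1/2) : ℝ) := by positivity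
    linarith
  have h2 : |pdd (avg (μ t s) φ) d e x - pdd (avg (μ t s) φ) d e y| ≤
      ((4 * c + 16 * D ^ 2 * c ^ 2) * L) * ((s - t)⁻¹ * ‖x - y‖) := by
    refine (h.pdd_lip hts hφ d e x y).trans ?_
    have : 0 ≤ 4 * c * L * ((s - t)⁻¹ * ‖x - y‖) := by positivity
    linarith
  refine (le_mul_rpow_mul_rpow (abs_nonneg _) (by positivity) hr (by positivity) h1 h2 hα).trans
    (le_of_eq ?_)
  rw [mul_rpow (by positivity) (norm_nonneg _), ← rpow_neg_one, ← rpow_mul h4.le, ← rpow_mul h4.le]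
  have : (s - t) ^ (-(1/2) * (1 - α)) * (s - t) ^ (-1 * α) = (s - t) ^ (-((1 + α) / 2)) := by
    rw [← rpow_add h4]; congr 1; ring
  rw [← this]
  ring

end EvolFam

section DiffIntegral
variable {D : ℕ} {ν : Measure ℝ} {k : ℝ → (Fin D → ℝ) → ℝ} {b₀ b₁ b₂ : ℝ → ℝ}

lemma aestronglyMeasurable_pd (hk : ∀ᵐ s ∂ν, ContDiff ℝ 1 (k s))
    (hm : ∀ x, AEStronglyMeasurable (fun s => k s x) ν) (i : Fin D) (x : Fin D → ℝ) :
    AEStronglyMeasurable (fun s => pd (k s) i x) ν := by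
  refine aestronglyMeasurable_of_tendsto_ae atTop (f := fun (n : ℕ) s => ((n : ℝ) + 1) *
      (k s (x + ((n : ℝ) + 1)⁻¹ • Pi.single i 1) - k s x)) (fun n => ?_) ?_
  · exact ((hm _).sub (hm _)).const_mul _
  · filter_upwards [hk] with s hs
    exact tendsto_quot_pd (hs.differentiable (by simp) x) i

lemma hasFDerivAt_integral_param (hk : ∀ᵐ s ∂ν, ContDiff ℝ 1 (k s))
    (hm : ∀ x, AEStronglyMeasurable (fun s => k s x) ν)
    (hb₀ : Integrable b₀ ν) (hb₁ : Integrable b₁ ν)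
    (h₀ : ∀ᵐ s ∂ν, ∀ x, |k s x| ≤ b₀ s) (h₁ : ∀ᵐ s ∂ν, ∀ i x, |pd (k s) i x| ≤ b₁ s)
    (x : Fin D → ℝ) :
    HasFDerivAt (fun x => ∫ s, k s x ∂ν) (∫ s, fderiv ℝ (k s) x ∂ν) x ∧
      Integrable (fun s => fderiv ℝ (k s) x) ν := by
  have hmf : AEStronglyMeasurable (fun s => fderiv ℝ (k s) x) ν := by
    simp_rw [fderiv_eq_sum_pd]
    refine Finset.aestronglyMeasurable_fun_sum _ fun i _ => ?_
    exact (aestronglyMeasurable_pd hk hm i x).smul_const _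
  have hbf : ∀ᵐ s ∂ν, ∀ x, ‖fderiv ℝ (k s) x‖ ≤ D * b₁ s := by
    filter_upwards [h₁] with s hs x
    rw [fderiv_eq_sum_pd]
    exact norm_sum_smul_proj_le fun i => hs i x
  refine ⟨?_, (hb₁.const_mul D).mono' hmf (hbf.mono fun s hs => hs x)⟩
  refine hasFDerivAt_integral_of_dominated_of_fderiv_le (𝕜 := ℝ) (μ := ν)
    (F := fun x s => k s x) (F' := fun x s => fderiv ℝ (k s) x) (x₀ := x)
    (s := univ) (bound := fun s => D * b₁ s) univ_mem (Eventually.of_forall hm)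
    (hb₀.mono' (hm x) (h₀.mono fun s hs => hs x)) hmf (hbf.mono fun s hs z _ => hs z)
    (hb₁.const_mul _) ?_
  filter_upwards [hk] with s hs z _
  exact (hs.differentiable (by simp) z).hasFDerivAt

lemma pd_integral_param (hk : ∀ᵐ s ∂ν, ContDiff ℝ 1 (k s))
    (hm : ∀ x, AEStronglyMeasurable (fun s => k s x) ν)
    (hb₀ : Integrable b₀ ν) (hb₁ : Integrable b₁ ν)
    (h₀ : ∀ᵐ s ∂ν, ∀ x, |k s x| ≤ b₀ s) (h₁ : ∀ᵐ s ∂ν, ∀ i x, |pd (k s) i x| ≤ b₁ s) :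
    ContDiff ℝ 1 (fun x => ∫ s, k s x ∂ν) ∧
    ∀ i, pd (fun x => ∫ s, k s x ∂ν) i = fun x => ∫ s, pd (k s) i x ∂ν := by
  have h := hasFDerivAt_integral_param hk hm hb₀ hb₁ h₀ h₁
  have hpd : ∀ i, pd (fun x => ∫ s, k s x ∂ν) i = fun x => ∫ s, pd (k s) i x ∂ν := fun i => by
    funext x
    rw [pd, (h x).1.fderiv, ContinuousLinearMap.integral_apply (h x).2]
    rfl
  refine ⟨contDiff_one_of_pd (fun x => (h x).1.differentiableAt) fun i => ?_, hpd⟩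
  rw [hpd]
  refine continuous_of_dominated (fun x => aestronglyMeasurable_pd hk hm i x)
    (fun x => h₁.mono fun s hs => hs i x) hb₁ ?_
  filter_upwards [hk] with s hs
  exact hs.continuous_pd i

lemma pdd_integral_param (hk : ∀ᵐ s ∂ν, ContDiff ℝ 2 (k s))
    (hm : ∀ x, AEStronglyMeasurable (fun s => k s x) ν)
    (hb₀ : Integrable b₀ ν) (hb₁ : Integrable b₁ ν) (hb₂ : Integrable b₂ ν)
    (h₀ : ∀ᵐ s ∂ν, ∀ x, |k s x| ≤ b₀ s) (h₁ : ∀ᵐ s ∂ν, ∀ i x, |pd (k s) i x| ≤ b₁ s)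
    (h₂ : ∀ᵐ s ∂ν, ∀ d e x, |pdd (k s) d e x| ≤ b₂ s) :
    ContDiff ℝ 2 (fun x => ∫ s, k s x ∂ν) ∧
    (∀ i, pd (fun x => ∫ s, k s x ∂ν) i = fun x => ∫ s, pd (k s) i x ∂ν) ∧
    (∀ d e, pdd (fun x => ∫ s, k s x ∂ν) d e = fun x => ∫ s, pdd (k s) d e x ∂ν) ∧
    ∀ d e x, AEStronglyMeasurable (fun s => pdd (k s) d e x) ν := by
  have hk1 : ∀ᵐ s ∂ν, ContDiff ℝ 1 (k s) := hk.mono fun s hs => hs.of_le (by norm_num)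
  obtain ⟨h3, h4⟩ := pd_integral_param hk1 hm hb₀ hb₁ h₀ h₁
  have hk2 : ∀ i, ∀ᵐ s ∂ν, ContDiff ℝ 1 (pd (k s) i) := fun i => hk.mono fun s hs => hs.pd_one i
  have h5 := fun i => pd_integral_param (hk2 i) (aestronglyMeasurable_pd hk1 hm i) hb₁ hb₂
    (h₁.mono fun s hs => hs i) (h₂.mono fun s hs d => hs d i)
  refine ⟨contDiff_two_of_pd (h3.differentiable (by simp)) fun i => ?_, h4, fun d e => ?_,
    fun d e x => ?_⟩
  · rw [h4]; exact (h5 i).1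
  · rw [pdd_eq, h4, (h5 e).2]; rfl
  · exact aestronglyMeasurable_pd (hk2 e) (aestronglyMeasurable_pd hk1 hm e) d x

end DiffIntegral

lemma intervalIntegrable_sub_rpow {r : ℝ} (hr : -1 < r) (t t' : ℝ) :
    IntervalIntegrable (fun s => (s - t) ^ r) volume t t' := by
  have := (intervalIntegral.intervalIntegrable_rpow' (a := 0) (b := t' - t) hr).comp_sub_right t
  simpa using this

lemma integral_sub_rpow {r : ℝ} (hr : -1 < r) (t t' : ℝ) :
    ∫ s in t..t', (s - t) ^ r = (t' - t) ^ (r + 1) / (r + 1) := by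
  rw [intervalIntegral.integral_comp_sub_right (fun s => s ^ r), integral_rpow (Or.inl hr),
    sub_self, zero_rpow (by linarith), sub_zero]

lemma abs_setIntegral_sub_rpow_le {f : ℝ → ℝ} {K r t t' : ℝ} (hr : -1 < r) (htt : t ≤ t')
    (h : ∀ s ∈ Ioc t t', |f s| ≤ K * (s - t) ^ r) :
    |∫ s in Ioc t t', f s| ≤ K * ((t' - t) ^ (r + 1) / (r + 1)) := by
  rw [← integral_sub_rpow hr, ← intervalIntegral.integral_const_mul,
    intervalIntegral.integral_of_le htt, ← Real.norm_eq_abs]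
  refine norm_integral_le_of_norm_le ?_ ((ae_restrict_iff' measurableSet_Ioc).2
    (Eventually.of_forall h))
  exact ((intervalIntegrable_iff_integrableOn_Ioc_of_le htt).1
    (intervalIntegrable_sub_rpow hr t t')).const_mul K

/-- Source terms: bounded, Lipschitz in space and Hölder in time. -/
structure Src {D : ℕ} (f : ℝ → (Fin D → ℝ) → ℝ) (M L K θ : ℝ) : Prop where
  θ_pos : 0 < θ
  K_nonneg : 0 ≤ K
  bl : ∀ s, BL (f s) M L
  time : ∀ s s' x, |f s x - f s' x| ≤ K * |s - s'| ^ θ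

/-- The Duhamel integral of `f`. -/
def duh {D : ℕ} (μ : ℝ → ℝ → Measure (Fin D → ℝ)) (f : ℝ → (Fin D → ℝ) → ℝ) (t t' : ℝ)
    (x : Fin D → ℝ) : ℝ := ∫ s in Ioc t t', avg (μ t s) (f s) x

namespace EvolFam
variable {D : ℕ} {A : ℝ → Matrix (Fin D) (Fin D) ℝ} {c : ℝ} {μ : ℝ → ℝ → Measure (Fin D → ℝ)}
  {f : ℝ → (Fin D → ℝ) → ℝ} {M L K θ t t' : ℝ}

lemma avg_time (h : EvolFam A c μ) (hf : Src f M L K θ) {s s' : ℝ} (hts : t ≤ s) (hss : s ≤ s')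
    (x : Fin D → ℝ) : |avg (μ t s) (f s) x - avg (μ t s') (f s') x| ≤
      K * |s - s'| ^ θ + L * (c * |s - s'| ^ (1/2 : ℝ)) := by
  have := h.prob t s
  rw [← h.comp t s s' hts hss _ (hf.bl s').cont M (hf.bl s').bdd]
  refine abs_avg_sub_avg_le _ (hf.bl s).toBC (h.bl_avg (hf.bl s')).toBC fun y => ?_
  have h1 := hf.time s s' (x + y)
  have h2 := h.abs_avg_sub_self_lip hss (hf.bl s') (x + y)
  have h3 : |s - s'| = s' - s := by rw [abs_sub_comm, abs_of_nonneg (by linarith)]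
  rw [abs_sub_comm] at h2
  rw [← h3] at h2
  calc _ = |(f s (x + y) - f s' (x + y)) + (f s' (x + y) - avg (μ s s') (f s') (x + y))| := by
        congr 1; ring
    _ ≤ _ := (abs_add_le _ _).trans (add_le_add h1 h2)

lemma continuous_avg_max (h : EvolFam A c μ) (hf : Src f M L K θ) (t : ℝ) :
    Continuous fun p : ℝ × (Fin D → ℝ) => avg (μ t (max p.1 t)) (f (max p.1 t)) p.2 := by
  have htime : ∀ s s' x, t ≤ s → t ≤ s' → |avg (μ t s) (f s) x - avg (μ t s') (f s') x| ≤
      K * |s - s'| ^ θ + L * (c * |s - s'| ^ (1/2 : ℝ)) := by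
    intro s s' x hs hs'
    rcases le_total s s' with hss | hss
    · exact h.avg_time hf hs hss x
    · rw [abs_sub_comm, abs_sub_comm s s']
      exact h.avg_time hf hs' hss x
  rw [continuous_iff_continuousAt]
  intro p₀
  refine tendsto_iff_norm_sub_tendsto_zero.2 ?_
  refine squeeze_zero (fun _ => norm_nonneg _) (g := fun p : ℝ × (Fin D → ℝ) =>
    (K * |max p.1 t - max p₀.1 t| ^ θ + L * (c * |max p.1 t - max p₀.1 t| ^ (1/2 : ℝ))) +
      L * ‖p.2 - p₀.2‖) (fun p => ?_) ?_
  · rw [Real.norm_eq_abs]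
    refine (abs_sub_le _ (avg (μ t (max p₀.1 t)) (f (max p₀.1 t)) p.2) _).trans ?_
    exact add_le_add (htime _ _ _ (le_max_right _ _) (le_max_right _ _))
      ((h.bl_avg (hf.bl _)).lip _ _)
  · have hθ := hf.θ_pos
    have hc : Continuous fun p : ℝ × (Fin D → ℝ) =>
        (K * |max p.1 t - max p₀.1 t| ^ θ + L * (c * |max p.1 t - max p₀.1 t| ^ (1/2 : ℝ))) +
        L * ‖p.2 - p₀.2‖ := by
      have h1 : Continuous fun p : ℝ × (Fin D → ℝ) => |max p.1 t - max p₀.1 t| ^ θ :=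
        Continuous.rpow_const (by fun_prop) fun _ => Or.inr hθ.le
      have h2 : Continuous fun p : ℝ × (Fin D → ℝ) => |max p.1 t - max p₀.1 t| ^ (1/2 : ℝ) :=
        Continuous.rpow_const (by fun_prop) fun _ => Or.inr (by norm_num)
      fun_prop
    have := hc.tendsto p₀
    simpa [zero_rpow hθ.ne'] using this

lemma aestronglyMeasurable_avg (h : EvolFam A c μ) (hf : Src f M L K θ) (x : Fin D → ℝ) :
    AEStronglyMeasurable (fun s => avg (μ t s) (f s) x) (volume.restrict (Ioc t t')) := by
  have h1 : Continuous fun s => avg (μ t (max s t)) (f (max s t)) x :=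
    (h.continuous_avg_max hf t).comp (by fun_prop : Continuous fun s : ℝ => (s, x))
  refine h1.aestronglyMeasurable.congr ?_
  filter_upwards [ae_restrict_mem measurableSet_Ioc] with s hs
  rw [max_eq_left hs.1.le]

lemma duh_facts (h : EvolFam A c μ) (hf : Src f M L K θ) (t t' : ℝ) :
    ContDiff ℝ 2 (duh μ f t t') ∧
    (∀ i, pd (duh μ f t t') i = fun x => ∫ s in Ioc t t', pd (avg (μ t s) (f s)) i x) ∧
    (∀ d e, pdd (duh μ f t t') d e = fun x => ∫ s in Ioc t t', pdd (avg (μ t s) (f s)) d e x) ∧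
    (∀ i x, AEStronglyMeasurable (fun s => pd (avg (μ t s) (f s)) i x)
      (volume.restrict (Ioc t t'))) ∧
    ∀ d e x, Integrable (fun s => pdd (avg (μ t s) (f s)) d e x)
      (volume.restrict (Ioc t t')) := by
  have hI : ∀ᵐ s ∂(volume.restrict (Ioc t t')), s ∈ Ioc t t' := ae_restrict_mem measurableSet_Ioc
  have hint : ∀ r : ℝ, -1 < r → Integrable (fun s => (s - t) ^ r) (volume.restrict (Ioc t t')) :=
    fun r hr => (intervalIntegrable_sub_rpow hr t t').1
  have hC2 : ∀ᵐ s ∂(volume.restrict (Ioc t t')), ContDiff ℝ 2 (avg (μ t s) (f s)) :=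
    hI.mono fun s hs => (h.smooth_two hs.1 (hf.bl s)).1
  have hm : ∀ x, AEStronglyMeasurable (fun s => avg (μ t s) (f s) x)
    (volume.restrict (Ioc t t')) := h.aestronglyMeasurable_avg hf
  have hb2 : ∀ᵐ s ∂(volume.restrict (Ioc t t')), ∀ d e x,
      |pdd (avg (μ t s) (f s)) d e x| ≤ 2 * c * L * (s - t) ^ (-(1/2) : ℝ) :=
    hI.mono fun s hs d e => ((h.smooth_two hs.1 (hf.bl s)).2 d e).bdd
  obtain ⟨h1, h2, h3, h4⟩ := pdd_integral_param (ν := volume.restrict (Ioc t t'))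
    (k := fun s => avg (μ t s) (f s))
    (b₀ := fun _ => M) (b₁ := fun _ => L) (b₂ := fun s => 2 * c * L * (s - t) ^ (-(1/2) : ℝ))
    hC2 hm (integrable_const _)
    (integrable_const _) ((hint _ (by norm_num)).const_mul _)
    (Eventually.of_forall fun s => (h.bl_avg (hf.bl s)).bdd)
    (hI.mono fun s hs i => (h.pd_avg_bl hs.1 (hf.bl s) i).bdd) hb2
  refine ⟨h1, h2, h3, aestronglyMeasurable_pd (hC2.mono fun s hs => hs.of_le (by norm_num)) hm,
    fun d e x => ?_⟩
  exact ((hint _ (by norm_num)).const_mul _).mono' (h4 d e x) (hb2.mono fun s hs => hs d e x)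

lemma abs_duh_le (h : EvolFam A c μ) (hf : Src f M L K θ) (htt : t ≤ t') (x : Fin D → ℝ) :
    |duh μ f t t' x| ≤ M * (t' - t) := by
  have := abs_setIntegral_sub_rpow_le (f := fun s => avg (μ t s) (f s) x) (K := M) (r := 0)
    (by norm_num) htt fun s _ => by simpa using (h.bl_avg (hf.bl s)).bdd x
  unfold duh
  simpa using this

lemma abs_pd_duh_le (h : EvolFam A c μ) (hf : Src f M L K θ) (htt : t ≤ t') (i : Fin D)
    (x : Fin D → ℝ) : |pd (duh μ f t t') i x| ≤ 2 * c * M * (t' - t) ^ (1/2 : ℝ) := by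
  rw [(h.duh_facts hf t t').2.1]
  refine (abs_setIntegral_sub_rpow_le (K := c * M) (r := -(1/2)) (by norm_num) htt
    fun s hs => ?_).trans (le_of_eq ?_)
  · exact (h.smooth t s hs.1 (f s) (hf.bl s).cont M (hf.bl s).bdd).2 i x
  · norm_num; ring

lemma abs_pdd_duh_le (h : EvolFam A c μ) (hf : Src f M L K θ) (htt : t ≤ t') (d e : Fin D)
    (x : Fin D → ℝ) : |pdd (duh μ f t t') d e x| ≤ 4 * c * L * (t' - t) ^ (1/2 : ℝ) := by
  rw [(h.duh_facts hf t t').2.2.1]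
  refine (abs_setIntegral_sub_rpow_le (K := 2 * c * L) (r := -(1/2)) (by norm_num) htt
    fun s hs => ?_).trans (le_of_eq ?_)
  · exact ((h.smooth_two hs.1 (hf.bl s)).2 d e).bdd x
  · norm_num; ring

lemma pdd_duh_holder (h : EvolFam A c μ) (hf : Src f M L K θ) (htt : t ≤ t') {α : ℝ}
    (hα : α ∈ Ioo (0:ℝ) 1) (d e : Fin D) (x y : Fin D → ℝ) :
    |pdd (duh μ f t t') d e x - pdd (duh μ f t t') d e y| ≤
      (4 * c + 16 * D ^ 2 * c ^ 2) * L * ((t' - t) ^ ((1 - α) / 2) / ((1 - α) / 2)) *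
        ‖x - y‖ ^ α := by
  obtain ⟨-, -, h3, -, h5⟩ := h.duh_facts hf t t'
  rw [h3, ← integral_sub (h5 d e x) (h5 d e y)]
  refine (abs_setIntegral_sub_rpow_le (K := (4 * c + 16 * D ^ 2 * c ^ 2) * L * ‖x - y‖ ^ α)
    (r := -((1 + α) / 2)) (by linarith [hα.2]) htt fun s hs => ?_).trans (le_of_eq ?_)
  · refine (h.pdd_holder hs.1 (hf.bl s) ⟨hα.1.le, hα.2.le⟩ d e x y).trans (le_of_eq ?_)
    ring
  · rw [show -((1 + α) / 2) + 1 = (1 - α) / 2 by ring]; ring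

end EvolFam

/-- `C^{2+α}` functions with all norms bounded by `G`. -/
structure Dat {D : ℕ} (φ : (Fin D → ℝ) → ℝ) (G α : ℝ) : Prop where
  cd : ContDiff ℝ 2 φ
  bc : BC φ G
  pd_bc : ∀ k, BC (pd φ k) G
  pdd_bc : ∀ d e, BC (pdd φ d e) G
  hol : ∀ d e x y, |pdd φ d e x - pdd φ d e y| ≤ G * ‖x - y‖ ^ α

section DatBasic
variable {D : ℕ} {φ : (Fin D → ℝ) → ℝ} {G α : ℝ}

lemma Dat.bl (h : Dat φ G α) : BL φ G (D * G) where
  toBC := h.bc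
  L_nonneg := by have := h.bc.nonneg; positivity
  lip := lip_of_abs_pd_le (h.cd.differentiable (by simp)) h.bc.nonneg fun k => (h.pd_bc k).bdd

lemma Dat.pd_bl (h : Dat φ G α) (k : Fin D) : BL (pd φ k) G (D * G) where
  toBC := h.pd_bc k
  L_nonneg := by have := h.bc.nonneg; positivity
  lip := lip_of_abs_pd_le ((h.cd.pd_one k).differentiable (by simp)) h.bc.nonneg
    fun d => (h.pdd_bc d k).bdd

lemma taylor_one {h h' h'' : ℝ → ℝ} {K : ℝ} (h1 : ∀ s, HasDerivAt h (h' s) s)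
    (h2 : ∀ s, HasDerivAt h' (h'' s) s) (hK : ∀ s ∈ Icc (0:ℝ) 1, |h'' s - h'' 0| ≤ K) :
    |h 1 - h 0 - h' 0 - h'' 0 / 2| ≤ K := by
  have hK0 : 0 ≤ K := (abs_nonneg _).trans (hK 0 (by simp))
  have step : ∀ s ∈ Icc (0:ℝ) 1, |h' s - h' 0 - s * h'' 0| ≤ K := fun s hs => by
    have := (convex_Icc (0:ℝ) 1).norm_image_sub_le_of_norm_hasDerivWithin_le
      (f := fun s => h' s - s * h'' 0) (f' := fun s => h'' s - 1 * h'' 0) (C := K)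
      (fun z _ => ((h2 z).sub ((hasDerivAt_id z).mul_const _)).hasDerivWithinAt)
      (fun z hz => by simpa using hK z hz) (left_mem_Icc.2 zero_le_one) hs
    have h3 : K * ‖s - 0‖ ≤ K := by
      rw [sub_zero, Real.norm_eq_abs, abs_of_nonneg hs.1]
      exact mul_le_of_le_one_right hK0 hs.2
    refine le_trans (le_of_eq ?_) (this.trans h3)
    rw [Real.norm_eq_abs]; congr 1; ring
  have := (convex_Icc (0:ℝ) 1).norm_image_sub_le_of_norm_hasDerivWithin_le
    (f := fun s => h s - s * h' 0 - s ^ 2 * (h'' 0 / 2))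
    (f' := fun s => h' s - 1 * h' 0 - (2 * s) * (h'' 0 / 2)) (C := K)
    (fun z _ => by
      have := (((h1 z).fun_sub ((hasDerivAt_id' z).mul_const (h' 0))).fun_sub
        ((hasDerivAt_pow 2 z).mul_const (h'' 0 / 2))).hasDerivWithinAt (s := Icc (0:ℝ) 1)
      simpa using this)
    (fun z hz => by
      refine le_trans (le_of_eq ?_) (step z hz)
      rw [Real.norm_eq_abs]; congr 1; ring)
    (left_mem_Icc.2 zero_le_one) (right_mem_Icc.2 zero_le_one)
  refine le_trans (le_of_eq ?_) (this.trans (by simp))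
  rw [Real.norm_eq_abs]; congr 1; ring

lemma abs_sum_sum_le {a : Fin D → Fin D → ℝ} {b : ℝ} (h : ∀ i j, |a i j| ≤ b) :
    |∑ i, ∑ j, a i j| ≤ D ^ 2 * b := by
  refine (Finset.abs_sum_le_sum_abs _ _).trans ?_
  calc _ ≤ ∑ _i : Fin D, ∑ _j : Fin D, b := Finset.sum_le_sum fun i _ =>
        (Finset.abs_sum_le_sum_abs _ _).trans (Finset.sum_le_sum fun j _ => h i j)
    _ = _ := by simp; ring

lemma Dat.taylor (h : Dat φ G α) (hα : 0 ≤ α) (x y : Fin D → ℝ) :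
    |φ (x + y) - φ x - ∑ k, y k * pd φ k x - (∑ i, ∑ j, (y i * y j) * pdd φ i j x) / 2| ≤
      D ^ 2 * G * ‖y‖ ^ (2 + α) := by
  have hG := h.bc.nonneg
  have hline : ∀ s : ℝ, HasDerivAt (fun s : ℝ => x + s • y) y s := fun s => by
    simpa using ((hasDerivAt_id s).smul_const y).const_add x
  have hcomp : ∀ ψ : (Fin D → ℝ) → ℝ, Differentiable ℝ ψ → ∀ s : ℝ,
      HasDerivAt (fun s : ℝ => ψ (x + s • y)) (∑ k, y k * pd ψ k (x + s • y)) s := fun ψ hψ s => by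
    rw [← fderiv_apply_eq_sum_pd]
    exact (hψ _).hasFDerivAt.comp_hasDerivAt s (hline s)
  have h1 := hcomp φ (h.cd.differentiable (by simp))
  have h2 : ∀ s : ℝ, HasDerivAt (fun s : ℝ => ∑ k, y k * pd φ k (x + s • y))
      (∑ i, ∑ j, (y i * y j) * pdd φ i j (x + s • y)) s := fun s => by
    have := HasDerivAt.fun_sum (u := Finset.univ) fun k (_ : k ∈ Finset.univ) =>
      (hcomp (pd φ k) ((h.cd.pd_one k).differentiable (by simp)) s).const_mul (y k)
    refine this.congr_deriv ?_
    rw [Finset.sum_comm]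
    refine Finset.sum_congr rfl fun i _ => ?_
    rw [Finset.mul_sum]
    exact Finset.sum_congr rfl fun j _ => by rw [pdd_eq]; ring
  have := taylor_one h1 h2 (K := D ^ 2 * G * ‖y‖ ^ (2 + α)) fun s hs => by
    rw [← Finset.sum_sub_distrib]
    simp_rw [← Finset.sum_sub_distrib]
    rw [mul_assoc]
    refine abs_sum_sum_le fun i j => ?_
    rw [← mul_sub, abs_mul, abs_mul]
    have h3 : |pdd φ i j (x + s • y) - pdd φ i j (x + (0:ℝ) • y)| ≤ G * ‖y‖ ^ α := by
      refine (h.hol i j _ _).trans ?_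
      gcongr
      have : x + s • y - (x + (0:ℝ) • y) = s • y := by simp
      rw [this, norm_smul, Real.norm_eq_abs, abs_of_nonneg hs.1]
      exact mul_le_of_le_one_left (norm_nonneg _) hs.2
    have h4 : ‖y‖ ^ (2 + α) = ‖y‖ * ‖y‖ * ‖y‖ ^ α := by
      rw [rpow_add_of_nonneg (norm_nonneg _) zero_le_two hα, rpow_two, sq]
    rw [h4]
    calc _ ≤ (‖y‖ * ‖y‖) * (G * ‖y‖ ^ α) := by
          gcongr
          · exact norm_le_pi_norm y i
          · exact norm_le_pi_norm y j
      _ = _ := by ring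
  simpa using this

end DatBasic

namespace EvolFam
variable {D : ℕ} {A : ℝ → Matrix (Fin D) (Fin D) ℝ} {c : ℝ} {μ : ℝ → ℝ → Measure (Fin D → ℝ)}
  {f : ℝ → (Fin D → ℝ) → ℝ} {φ : (Fin D → ℝ) → ℝ} {M L K θ t t' G α : ℝ}

lemma avg_taylor (h : EvolFam A c μ) (hφ : Dat φ G α) (hα : α ∈ Ioo (0:ℝ) 1) (htt : t ≤ t')
    (x : Fin D → ℝ) :
    |avg (μ t t') φ x - φ x - (∑ i, ∑ j, (∫ u in t..t', A u i j) * pdd φ i j x) / 2| ≤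
      D ^ 2 * G * (c * (t' - t) ^ (1 + α / 2)) := by
  have := h.prob t t'
  have hG := hφ.bc.nonneg
  have hi1 : ∀ k, Integrable (fun y : Fin D → ℝ => y k * pd φ k x) (μ t t') := fun k => by
    have := h.mom_int t t' htt 1 (by norm_num)
    simp only [rpow_one] at this
    exact (this.mono' (measurable_pi_apply k).aestronglyMeasurable
      (Eventually.of_forall fun y => norm_le_pi_norm y k)).mul_const _
  have hi2 : ∀ i j, Integrable (fun y : Fin D → ℝ => (y i * y j) * pdd φ i j x) (μ t t') :=
    fun i j => by
      have := h.mom_int t t' htt 2 (by norm_num)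
      refine (this.mono' (by fun_prop) (Eventually.of_forall fun y => ?_)).mul_const _
      rw [norm_mul, rpow_two, sq]
      exact mul_le_mul (norm_le_pi_norm y i) (norm_le_pi_norm y j) (norm_nonneg _) (norm_nonneg _)
  have hi3 := integrable_finsetSum Finset.univ fun k (_ : k ∈ Finset.univ) => hi1 k
  have hi4 := integrable_finsetSum Finset.univ fun i (_ : i ∈ Finset.univ) =>
    integrable_finsetSum Finset.univ fun j (_ : j ∈ Finset.univ) => hi2 i j
  have hi0 := hφ.bc.integrable (μ t t') x
  have hi5 : Integrable (fun y => φ (x + y) - φ x) (μ t t') := hi0.sub (integrable_const _)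
  have hi6 : Integrable (fun y => φ (x + y) - φ x - ∑ k, y k * pd φ k x) (μ t t') := hi5.sub hi3
  have heq : avg (μ t t') φ x - φ x - (∑ i, ∑ j, (∫ u in t..t', A u i j) * pdd φ i j x) / 2 =
      ∫ y, (φ (x + y) - φ x - ∑ k, y k * pd φ k x -
        (∑ i, ∑ j, (y i * y j) * pdd φ i j x) / 2) ∂(μ t t') := by
    rw [integral_sub hi6 (hi4.div_const 2), integral_sub hi5 hi3, integral_sub hi0 (integrable_const _),
      integral_div, integral_finsetSum _ fun k _ => hi1 k,
      integral_finsetSum _ fun i _ => integrable_finsetSum _ fun j _ => hi2 i j]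
    simp_rw [integral_finsetSum _ fun j _ => hi2 _ j, integral_mul_const, h.mean t t' htt,
      h.cov t t' htt]
    simp [avg]
  have hp : 2 + α ∈ Icc (0:ℝ) 3 := ⟨by linarith [hα.1], by linarith [hα.2]⟩
  rw [heq, ← Real.norm_eq_abs]
  refine (norm_integral_le_of_norm_le ((h.mom_int t t' htt _ hp).const_mul (D ^ 2 * G))
    (Eventually.of_forall fun y => hφ.taylor hα.1.le x y)).trans ?_
  rw [integral_const_mul]
  gcongr
  have := h.mom t t' htt _ hp
  rwa [show (2 + α) / 2 = 1 + α / 2 by ring] at this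

lemma avg_duh (h : EvolFam A c μ) (hf : Src f M L K θ) {T : ℝ} (htt : t ≤ t') (x : Fin D → ℝ) :
    avg (μ t t') (duh μ f t' T) x = ∫ s in Ioc t' T, avg (μ t s) (f s) x := by
  have := h.prob t t'
  have hcont := h.continuous_avg_max hf t'
  have h1 : ∀ y, duh μ f t' T y =
      ∫ s in Ioc t' T, avg (μ t' (max s t')) (f (max s t')) y := fun y =>
    setIntegral_congr_fun measurableSet_Ioc fun s hs => by simp only [max_eq_left hs.1.le]
  unfold avg at h1 ⊢
  simp only [h1]
  rw [integral_integral_swap]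
  · refine setIntegral_congr_fun measurableSet_Ioc fun s hs => ?_
    have h2 := congrFun (h.comp t t' s htt hs.1.le _ (hf.bl s).cont M (hf.bl s).bdd) x
    simp only [max_eq_left hs.1.le]
    exact h2
  · refine (integrable_const M).mono' (Continuous.aestronglyMeasurable ?_)
      (Eventually.of_forall fun p => ?_)
    · exact hcont.comp (by fun_prop :
        Continuous fun p : (Fin D → ℝ) × ℝ => ((p.2, x + p.1) : ℝ × (Fin D → ℝ)))
    · exact (h.bl_avg (hf.bl _)).bdd _

/-- The mild solution of the linear backward equation with source `f` and terminal value `φ`. -/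
def _root_.mild {D : ℕ} (μ : ℝ → ℝ → Measure (Fin D → ℝ)) (f : ℝ → (Fin D → ℝ) → ℝ)
    (φ : (Fin D → ℝ) → ℝ) (t t' : ℝ) (x : Fin D → ℝ) : ℝ :=
  avg (μ t t') φ x + duh μ f t t' x

lemma integrableOn_avg (h : EvolFam A c μ) (hf : Src f M L K θ) (x : Fin D → ℝ) :
    IntegrableOn (fun s => avg (μ t s) (f s) x) (Ioc t t') := by
  have : Integrable (fun _ : ℝ => M) (volume.restrict (Ioc t t')) := integrable_const M
  exact this.mono' (h.aestronglyMeasurable_avg hf x)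
    (Eventually.of_forall fun s => (h.bl_avg (hf.bl s)).bdd x)

lemma bc_duh (h : EvolFam A c μ) (hf : Src f M L K θ) (htt : t ≤ t') :
    BC (duh μ f t t') (M * (t' - t)) :=
  ⟨(h.duh_facts hf t t').1.continuous, h.abs_duh_le hf htt⟩

lemma mild_flow (h : EvolFam A c μ) (hf : Src f M L K θ) (hφ : BC φ G) {T : ℝ} (htt : t ≤ t')
    (htT : t' ≤ T) : mild μ f φ t T = mild μ f (mild μ f φ t' T) t t' := by
  have := h.prob t t'
  have := h.prob t' T
  funext x
  have h1 : avg (μ t t') (mild μ f φ t' T) x =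
      avg (μ t t') (avg (μ t' T) φ) x + avg (μ t t') (duh μ f t' T) x :=
    integral_add ((hφ.avg (μ t' T)).integrable _ x) ((h.bc_duh hf htT).integrable _ x)
  have h2 : duh μ f t T x = duh μ f t t' x + ∫ s in Ioc t' T, avg (μ t s) (f s) x := by
    unfold duh
    have hi : IntegrableOn (fun s => avg (μ t s) (f s) x) (Ioc t T) := h.integrableOn_avg hf x
    rw [← Ioc_union_Ioc_eq_Ioc htt htT, setIntegral_union _ measurableSet_Ioc]
    · exact hi.mono_set (Ioc_subset_Ioc_right htT)
    · exact hi.mono_set (Ioc_subset_Ioc_left htt)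
    · exact Ioc_disjoint_Ioc_of_le le_rfl
  show avg (μ t T) φ x + duh μ f t T x = avg (μ t t') (mild μ f φ t' T) x + duh μ f t t' x
  rw [h1, h2, h.comp t t' T htt htT φ hφ.cont G hφ.bdd, h.avg_duh hf htt]
  ring

end EvolFam

/-- The value `½ tr(A D²φ) + f` of the backward generator. -/
def gen {D : ℕ} (A : Matrix (Fin D) (Fin D) ℝ) (φ f : (Fin D → ℝ) → ℝ) (x : Fin D → ℝ) : ℝ :=
  (∑ i, ∑ j, A i j * pdd φ i j x) / 2 + f x

namespace EvolFam
variable {D : ℕ} {A : ℝ → Matrix (Fin D) (Fin D) ℝ} {c : ℝ} {μ : ℝ → ℝ → Measure (Fin D → ℝ)}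
  {f : ℝ → (Fin D → ℝ) → ℝ} {φ : (Fin D → ℝ) → ℝ} {M L K θ t t' G α : ℝ}

lemma mild_facts (h : EvolFam A c μ) (hf : Src f M L K θ) (hφ : Dat φ G α) (t t' : ℝ) :
    ContDiff ℝ 2 (mild μ f φ t t') ∧
    (∀ k, pd (mild μ f φ t t') k = fun x => avg (μ t t') (pd φ k) x + pd (duh μ f t t') k x) ∧
    (∀ d e, pdd (mild μ f φ t t') d e =
      fun x => avg (μ t t') (pdd φ d e) x + pdd (duh μ f t t') d e x) := by
  have := h.prob t t'
  have hd := (h.duh_facts hf t t').1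
  obtain ⟨h1, h2⟩ := contDiff_two_avg (μ t t') hφ.bc hφ.cd hφ.pd_bc hφ.pdd_bc
  have h3 : ∀ k, pd (mild μ f φ t t') k =
      fun x => pd (avg (μ t t') φ) k x + pd (duh μ f t t') k x := fun k =>
    pd_add (h1.differentiable (by simp)) (hd.differentiable (by simp)) k
  refine ⟨h1.add hd, fun k => ?_, fun d e => ?_⟩
  · rw [h3, _root_.pd_avg _ hφ.bc (hφ.cd.of_le (by norm_num)) hφ.pd_bc]
  · rw [pdd_eq, h3, pd_add ((h1.pd_one e).differentiable (by simp))
      ((hd.pd_one e).differentiable (by simp)), ← pdd_eq, ← pdd_eq, h2]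

lemma abs_mild_le (h : EvolFam A c μ) (hf : Src f M L K θ) (hφ : BC φ G) (htt : t ≤ t')
    (x : Fin D → ℝ) : |mild μ f φ t t' x| ≤ G + M * (t' - t) := by
  have := h.prob t t'
  exact (abs_add_le _ _).trans (add_le_add ((hφ.avg _).bdd x) (h.abs_duh_le hf htt x))

lemma abs_pd_mild_le (h : EvolFam A c μ) (hf : Src f M L K θ) (hφ : Dat φ G α) (htt : t ≤ t')
    (k : Fin D) (x : Fin D → ℝ) :
    |pd (mild μ f φ t t') k x| ≤ G + 2 * c * M * (t' - t) ^ (1/2 : ℝ) := by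
  have := h.prob t t'
  rw [(h.mild_facts hf hφ t t').2.1]
  exact (abs_add_le _ _).trans (add_le_add (((hφ.pd_bc k).avg _).bdd x) (h.abs_pd_duh_le hf htt k x))

lemma abs_pdd_mild_le (h : EvolFam A c μ) (hf : Src f M L K θ) (hφ : Dat φ G α) (htt : t ≤ t')
    (d e : Fin D) (x : Fin D → ℝ) :
    |pdd (mild μ f φ t t') d e x| ≤ G + 4 * c * L * (t' - t) ^ (1/2 : ℝ) := by
  have := h.prob t t'
  rw [(h.mild_facts hf hφ t t').2.2]
  exact (abs_add_le _ _).trans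
    (add_le_add (((hφ.pdd_bc d e).avg _).bdd x) (h.abs_pdd_duh_le hf htt d e x))

lemma dat_mild (h : EvolFam A c μ) (hα : α ∈ Ioo (0:ℝ) 1) (hf : Src f M L K θ) (hφ : Dat φ G α)
    (htt : t ≤ t') (ht1 : t' - t ≤ 1) :
    Dat (mild μ f φ t t')
      (G + (2 * c * M + 4 * c * L + (4 * c + 16 * D ^ 2 * c ^ 2) * L / ((1 - α) / 2))) α := by
  have := h.prob t t'
  have hc := h.c_one
  have hM := (hf.bl 0).toBC.nonneg
  have hL := (hf.bl 0).L_nonneg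
  have hα' : 0 < 1 - α := by linarith [hα.2]
  have hh : 0 ≤ t' - t := by linarith
  have hr : (t' - t) ^ (1/2 : ℝ) ≤ 1 := rpow_le_one hh ht1 (by norm_num)
  have hr' : (t' - t) ^ ((1 - α) / 2) ≤ 1 := rpow_le_one hh ht1 (by positivity)
  have hcM : 0 ≤ 2 * c * M := by positivity
  have hMc : M ≤ 2 * c * M := by nlinarith
  have hcL : 0 ≤ 4 * c * L := by positivity
  have hX : 0 ≤ (4 * c + 16 * D ^ 2 * c ^ 2) * L / ((1 - α) / 2) := by positivity
  have h1 : M * (t' - t) ≤ M := mul_le_of_le_one_right hM ht1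
  have h2 : 2 * c * M * (t' - t) ^ (1/2 : ℝ) ≤ 2 * c * M := mul_le_of_le_one_right hcM hr
  have h3 : 4 * c * L * (t' - t) ^ (1/2 : ℝ) ≤ 4 * c * L := mul_le_of_le_one_right hcL hr
  obtain ⟨hcd, hpd, hpdd⟩ := h.mild_facts hf hφ t t'
  refine ⟨hcd, ⟨hcd.continuous, fun x => ?_⟩, fun k => ⟨(hcd.pd_one k).continuous, fun x => ?_⟩,
    fun d e => ⟨(hcd.pd_one e).continuous_pd d, fun x => ?_⟩, fun d e x y => ?_⟩
  · exact (h.abs_mild_le hf hφ.bc htt x).trans (by linarith)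
  · exact (h.abs_pd_mild_le hf hφ htt k x).trans (by linarith)
  · exact (h.abs_pdd_mild_le hf hφ htt d e x).trans (by linarith)
  · rw [hpdd]
    have h4 := avg_holder (μ t t') (hφ.pdd_bc d e) (hφ.hol d e) x y
    have h5 := h.pdd_duh_holder hf htt hα d e x y
    have h6 : (4 * c + 16 * D ^ 2 * c ^ 2) * L * ((t' - t) ^ ((1 - α) / 2) / ((1 - α) / 2)) ≤
        (4 * c + 16 * D ^ 2 * c ^ 2) * L / ((1 - α) / 2) := by
      rw [mul_div_assoc']
      exact div_le_div_of_nonneg_right (mul_le_of_le_one_right (by positivity) hr') (by positivity)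
    have hn : 0 ≤ ‖x - y‖ ^ α := rpow_nonneg (norm_nonneg _) _
    have h7 := mul_le_mul_of_nonneg_right h6 hn
    have h8 := mul_nonneg hcM hn
    have h9 := mul_nonneg hcL hn
    calc _ = |(avg (μ t t') (pdd φ d e) x - avg (μ t t') (pdd φ d e) y) +
        (pdd (duh μ f t t') d e x - pdd (duh μ f t t') d e y)| := by congr 1; ring
      _ ≤ _ := abs_add_le _ _
      _ ≤ _ := by linarith

lemma abs_pd_mild_sub_le (h : EvolFam A c μ) (hf : Src f M L K θ) (hφ : Dat φ G α) (htt : t ≤ t')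
    (k : Fin D) (x : Fin D → ℝ) :
    |pd (mild μ f φ t t') k x - pd φ k x| ≤ (D * G * c + 2 * c * M) * (t' - t) ^ (1/2 : ℝ) := by
  rw [(h.mild_facts hf hφ t t').2.1]
  have h1 := h.abs_avg_sub_self_lip htt (hφ.pd_bl k) x
  have h2 := h.abs_pd_duh_le hf htt k x
  calc _ = |(avg (μ t t') (pd φ k) x - pd φ k x) + pd (duh μ f t t') k x| := by congr 1; ring
    _ ≤ _ := (abs_add_le _ _).trans (add_le_add h1 h2)
    _ = _ := by ring

lemma abs_mild_sub_le (h : EvolFam A c μ) (hf : Src f M L K θ) (hφ : Dat φ G α) (htt : t ≤ t')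
    (ht1 : t' - t ≤ 1) (x : Fin D → ℝ) :
    |mild μ f φ t t' x - φ x| ≤ (D * G * c + M) * (t' - t) ^ (1/2 : ℝ) := by
  have h1 := h.abs_avg_sub_self_lip htt hφ.bl x
  have h2 := h.abs_duh_le hf htt x
  have hh : 0 ≤ t' - t := by linarith
  have h3 : t' - t ≤ (t' - t) ^ (1/2 : ℝ) := by
    simpa using rpow_le_rpow_of_exponent_ge_of_imp hh ht1 (show (1/2 : ℝ) ≤ 1 by norm_num)
      (by norm_num)
  have h4 := mul_le_mul_of_nonneg_left h3 (hf.bl 0).toBC.nonneg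
  calc _ = |(avg (μ t t') φ x - φ x) + duh μ f t t' x| := by unfold mild; congr 1; ring
    _ ≤ _ := (abs_add_le _ _).trans (add_le_add h1 (h2.trans h4))
    _ = _ := by ring

lemma abs_pdd_mild_sub_le (h : EvolFam A c μ) (hα : α ∈ Ioo (0:ℝ) 1) (hf : Src f M L K θ)
    (hφ : Dat φ G α) (htt : t ≤ t') (ht1 : t' - t ≤ 1) (d e : Fin D) (x : Fin D → ℝ) :
    |pdd (mild μ f φ t t') d e x - pdd φ d e x| ≤ (G * c + 4 * c * L) * (t' - t) ^ (α / 2) := by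
  have hc := h.c_one
  have hL := (hf.bl 0).L_nonneg
  rw [(h.mild_facts hf hφ t t').2.2]
  have h1 := h.abs_avg_sub_self htt (hφ.pdd_bc d e) hφ.bc.nonneg
    ⟨hα.1.le, by linarith [hα.2]⟩ (hφ.hol d e) x
  have h2 := h.abs_pdd_duh_le hf htt d e x
  have hh : 0 ≤ t' - t := by linarith
  have h3 : (t' - t) ^ (1/2 : ℝ) ≤ (t' - t) ^ (α / 2) :=
    rpow_le_rpow_of_exponent_ge_of_imp hh ht1 (by linarith [hα.2])
      (fun _ h => absurd h (by have := hα.1; positivity))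
  have h4 := mul_le_mul_of_nonneg_left h3 (show 0 ≤ 4 * c * L by positivity)
  calc _ = |(avg (μ t t') (pdd φ d e) x - pdd φ d e x) + pdd (duh μ f t t') d e x| := by
        congr 1; ring
    _ ≤ _ := (abs_add_le _ _).trans (add_le_add h1 (h2.trans h4))
    _ = _ := by ring

lemma abs_duh_sub_le (h : EvolFam A c μ) (hα : α ∈ Ioo (0:ℝ) 1) (hf : Src f M L K (α / 2))
    (htt : t ≤ t') (ht1 : t' - t ≤ 1) (x : Fin D → ℝ) :
    |duh μ f t t' x - (t' - t) * f t' x| ≤ (L * c + K) * (t' - t) ^ (1 + α / 2) := by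
  have hc := h.c_one
  have hL := (hf.bl 0).L_nonneg
  have hh : 0 ≤ t' - t := by linarith
  have h1 : duh μ f t t' x - (t' - t) * f t' x =
      ∫ s in Ioc t t', (avg (μ t s) (f s) x - f t' x) := by
    rw [integral_sub (h.integrableOn_avg hf x) (integrable_const _)]
    simp [duh, hh]
  have h2 : ∀ s ∈ Ioc t t', |avg (μ t s) (f s) x - f t' x| ≤
      ((L * c + K) * (t' - t) ^ (α / 2)) * (s - t) ^ (0:ℝ) := fun s hs => by
    have h3 := h.abs_avg_sub_self_lip hs.1.le (hf.bl s) x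
    have h4 := hf.time s t' x
    have h5 : (s - t) ^ (1/2 : ℝ) ≤ (t' - t) ^ (α / 2) :=
      (rpow_le_rpow (by linarith [hs.1]) (by linarith [hs.2]) (by norm_num)).trans
        (rpow_le_rpow_of_exponent_ge_of_imp hh ht1 (by linarith [hα.2])
          (fun _ h => absurd h (by have := hα.1; positivity)))
    have h6 : |s - t'| ^ (α / 2) ≤ (t' - t) ^ (α / 2) :=
      rpow_le_rpow (abs_nonneg _) (abs_le.2 ⟨by linarith [hs.1], by linarith [hs.2]⟩)
        (by linarith [hα.1])
    have h7 := mul_le_mul_of_nonneg_left h5 (show 0 ≤ L * c by positivity)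
    have h8 := mul_le_mul_of_nonneg_left h6 hf.K_nonneg
    rw [rpow_zero, mul_one]
    calc _ = |(avg (μ t s) (f s) x - f s x) + (f s x - f t' x)| := by congr 1; ring
      _ ≤ _ := (abs_add_le _ _).trans (add_le_add h3 h4)
      _ ≤ _ := by linarith
  rw [h1]
  refine (abs_setIntegral_sub_rpow_le (by norm_num) htt h2).trans (le_of_eq ?_)
  rw [rpow_add_of_nonneg hh zero_le_one (by linarith [hα.1]), zero_add, rpow_one]
  ring

lemma abs_mild_sub_gen_le (h : EvolFam A c μ) (hα : α ∈ Ioo (0:ℝ) 1) {KA : ℝ} (hKA : 0 ≤ KA)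
    (hAc : ∀ i j, Continuous fun t => A t i j)
    (hA : ∀ s s' i j, |A s i j - A s' i j| ≤ KA * |s - s'| ^ (α / 2))
    (hf : Src f M L K (α / 2)) (hφ : Dat φ G α) (htt : t ≤ t') (ht1 : t' - t ≤ 1)
    (x : Fin D → ℝ) :
    |mild μ f φ t t' x - φ x - (t' - t) * gen (A t') φ (f t') x| ≤
      (D ^ 2 * G * c + D ^ 2 * (KA * G) + (L * c + K)) * (t' - t) ^ (1 + α / 2) := by
  have hh : 0 ≤ t' - t := by linarith
  have hα2 : 0 < α / 2 := by linarith [hα.1]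
  have hG := hφ.bc.nonneg
  have h1 := h.avg_taylor hφ hα htt x
  have h2 := h.abs_duh_sub_le hα hf htt ht1 x
  have h3 : ∀ i j, |((∫ u in t..t', A u i j) - (t' - t) * A t' i j) * pdd φ i j x| ≤
      KA * G * (t' - t) ^ (1 + α / 2) := fun i j => by
    have h4 : (∫ u in t..t', A u i j) - (t' - t) * A t' i j = ∫ u in t..t', (A u i j - A t' i j) := by
      rw [intervalIntegral.integral_sub ((hAc i j).intervalIntegrable _ _)
        intervalIntegrable_const]
      simp
    have h5 : |∫ u in t..t', (A u i j - A t' i j)| ≤ KA * (t' - t) ^ (1 + α / 2) := by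
      rw [← Real.norm_eq_abs]
      refine (intervalIntegral.norm_integral_le_of_norm_le_const
        (C := KA * (t' - t) ^ (α / 2)) fun u hu => ?_).trans (le_of_eq ?_)
      · rw [uIoc_of_le htt] at hu
        refine (hA u t' i j).trans ?_
        gcongr
        exact abs_le.2 ⟨by linarith [hu.1], by linarith [hu.2]⟩
      · rw [abs_of_nonneg hh, rpow_add_of_nonneg hh zero_le_one hα2.le, rpow_one]; ring
    rw [h4, abs_mul]
    calc _ ≤ KA * (t' - t) ^ (1 + α / 2) * G := by
          gcongr
          exact (hφ.pdd_bc i j).bdd x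
      _ = _ := by ring
  have h6 := abs_sum_sum_le h3
  have h7 : ∑ i, ∑ j, ((∫ u in t..t', A u i j) - (t' - t) * A t' i j) * pdd φ i j x =
      (∑ i, ∑ j, (∫ u in t..t', A u i j) * pdd φ i j x) -
        (t' - t) * ∑ i, ∑ j, A t' i j * pdd φ i j x := by
    simp_rw [sub_mul, Finset.sum_sub_distrib, Finset.mul_sum, mul_assoc]
  rw [h7] at h6
  set S₁ := ∑ i, ∑ j, (∫ u in t..t', A u i j) * pdd φ i j x
  set S₂ := ∑ i, ∑ j, A t' i j * pdd φ i j x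
  have h8 : mild μ f φ t t' x - φ x - (t' - t) * gen (A t') φ (f t') x =
      (avg (μ t t') φ x - φ x - S₁ / 2) + (S₁ - (t' - t) * S₂) / 2 +
        (duh μ f t t' x - (t' - t) * f t' x) := by
    simp only [mild, gen, S₂]; ring
  rw [h8]
  have h9 : |(S₁ - (t' - t) * S₂) / 2| ≤ |S₁ - (t' - t) * S₂| := by
    rw [abs_div, abs_two]; linarith [abs_nonneg (S₁ - (t' - t) * S₂)]
  refine (abs_add_three _ _ _).trans ?_
  linarith

end EvolFam

/-- A function with first-order increments controlled by a continuous `R` has derivative `-R`. -/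
lemma hasDerivWithinAt_of_backward_step {w R : ℝ → ℝ} {K H θ T : ℝ} (hθ : 0 < θ) 
    (hw : ∀ t ∈ Icc (0:ℝ) T, ∀ t' ∈ Icc (0:ℝ) T, t ≤ t' →
      |w t - w t' - (t' - t) * R t'| ≤ K * (t' - t) ^ (1 + θ))
    (hR : ∀ t ∈ Icc (0:ℝ) T, ∀ t' ∈ Icc (0:ℝ) T, t ≤ t' → |R t - R t'| ≤ H * (t' - t) ^ θ) {t : ℝ}
    (ht : t ∈ Icc (0:ℝ) T) : HasDerivWithinAt w (-R t) (Icc 0 T) t := by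
  have key : ∀ s ∈ Icc (0:ℝ) T, |w s - w t - (s - t) * (-R t)| ≤ (K + H) * |s - t| ^ θ * |s - t| := by
    intro s hs
    have hp : ∀ z : ℝ, 0 ≤ z → z ^ (1 + θ) = z ^ θ * z := fun z hz => by
      rw [rpow_add_of_nonneg hz zero_le_one hθ.le, rpow_one, mul_comm]
    have hH : 0 ≤ H * |s - t| ^ θ * |s - t| := by
      rcases le_total s t with h | h
      · have := (abs_nonneg _).trans (hR s hs t ht h)
        rw [abs_sub_comm, abs_of_nonneg (sub_nonneg.2 h)]
        exact mul_nonneg this (sub_nonneg.2 h)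
      · have := (abs_nonneg _).trans (hR t ht s hs h)
        rw [abs_of_nonneg (sub_nonneg.2 h)]
        exact mul_nonneg this (sub_nonneg.2 h)
    rcases le_total s t with h | h
    · have h1 := hw s hs t ht h
      rw [hp _ (sub_nonneg.2 h)] at h1
      rw [abs_sub_comm s t, abs_of_nonneg (sub_nonneg.2 h)] at hH ⊢
      calc _ = |w s - w t - (t - s) * R t| := by congr 1; ring
        _ ≤ _ := h1
        _ ≤ _ := by linarith
    · have h1 := hw t ht s hs h
      have h2 := hR t ht s hs h
      rw [hp _ (sub_nonneg.2 h)] at h1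
      rw [abs_of_nonneg (sub_nonneg.2 h)] at hH ⊢
      calc _ = |-(w t - w s - (s - t) * R s) + (s - t) * (R t - R s)| := by congr 1; ring
        _ ≤ _ := abs_add_le _ _
        _ ≤ K * ((s - t) ^ θ * (s - t)) + (s - t) * (H * (s - t) ^ θ) := by
          rw [abs_neg, abs_mul, abs_of_nonneg (sub_nonneg.2 h)]
          exact add_le_add h1 (mul_le_mul_of_nonneg_left h2 (sub_nonneg.2 h))
        _ = _ := by ring
  rw [hasDerivWithinAt_iff_isLittleO]
  have h0 : Tendsto (fun s => (K + H) * |s - t| ^ θ) (𝓝[Icc 0 T] t) (𝓝 0) := by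
    have hc : Continuous fun s => (K + H) * |s - t| ^ θ :=
      continuous_const.mul (Continuous.rpow_const (by fun_prop) fun _ => Or.inr hθ.le)
    have := (hc.tendsto t).mono_left (nhdsWithin_le_nhds (s := Icc 0 T))
    simpa [zero_rpow hθ.ne'] using this
  rw [Asymptotics.isLittleO_iff]
  intro ε hε
  filter_upwards [self_mem_nhdsWithin, h0.eventually (gt_mem_nhds hε)] with s hs hs'
  rw [Real.norm_eq_abs, Real.norm_eq_abs, smul_eq_mul]
  exact (key s hs).trans (mul_le_mul_of_nonneg_right hs'.le (abs_nonneg _))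

/-- Projection of `t` onto `[0, T]`. -/
def clamp (T t : ℝ) : ℝ := max 0 (min t T)

lemma clamp_mem {T : ℝ} (hT : 0 ≤ T) (t : ℝ) : clamp T t ∈ Icc (0:ℝ) T :=
  ⟨le_max_left _ _, max_le hT (min_le_right _ _)⟩

lemma clamp_of_mem {T t : ℝ} (ht : t ∈ Icc (0:ℝ) T) : clamp T t = t := by
  rw [clamp, min_eq_left ht.2, max_eq_right ht.1]

lemma abs_clamp_sub_le (T t s : ℝ) : |clamp T t - clamp T s| ≤ |t - s| := by
  unfold clamp
  refine (abs_max_sub_max_le_max _ _ _ _).trans (max_le (by simp) ?_)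
  exact (abs_min_sub_min_le_max _ _ _ _).trans (max_le le_rfl (by simp))

lemma abs_clamp_sub_rpow_le {T θ θ' : ℝ} (hT : 0 ≤ T) (hT1 : T ≤ 1) (hθ : 0 < θ) (hθθ : θ ≤ θ')
    (t s : ℝ) : |clamp T t - clamp T s| ^ θ' ≤ |t - s| ^ θ := by
  have h1 := clamp_mem hT t
  have h2 := clamp_mem hT s
  have h3 : |clamp T t - clamp T s| ≤ 1 :=
    abs_le.2 ⟨by linarith [h1.1, h2.2], by linarith [h1.2, h2.1]⟩
  refine (rpow_le_rpow_of_exponent_ge_of_imp (abs_nonneg _) h3 hθθ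
    (fun _ h => absurd h (hθ.trans_le hθθ).ne')).trans ?_
  exact rpow_le_rpow (abs_nonneg _) (abs_clamp_sub_le T t s) hθ.le

lemma Src.sub {D : ℕ} {f f' : ℝ → (Fin D → ℝ) → ℝ} {M M' L L' K K' θ : ℝ} (h : Src f M L K θ)
    (h' : Src f' M' L' K' θ) : Src (fun s x => f s x - f' s x) (M + M') (L + L') (K + K') θ where
  θ_pos := h.θ_pos
  K_nonneg := add_nonneg h.K_nonneg h'.K_nonneg
  bl s := ⟨(h.bl s).toBC.sub (h'.bl s).toBC, add_nonneg (h.bl s).L_nonneg (h'.bl s).L_nonneg,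
    fun x y => by
      have h1 := (h.bl s).lip x y
      have h2 := (h'.bl s).lip x y
      calc _ = |(f s x - f s y) - (f' s x - f' s y)| := by congr 1; ring
        _ ≤ _ := (abs_sub _ _).trans (add_le_add h1 h2)
        _ = _ := by ring⟩
  time s s' x := by
    have h1 := h.time s s' x
    have h2 := h'.time s s' x
    calc _ = |(f s x - f s' x) - (f' s x - f' s' x)| := by congr 1; ring
      _ ≤ _ := (abs_sub _ _).trans (add_le_add h1 h2)
      _ = _ := by ring

namespace EvolFam
variable {D : ℕ} {A : ℝ → Matrix (Fin D) (Fin D) ℝ} {c : ℝ} {μ : ℝ → ℝ → Measure (Fin D → ℝ)}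
  {f f' : ℝ → (Fin D → ℝ) → ℝ} {φ : (Fin D → ℝ) → ℝ} {M M' L L' K K' θ t t' G α : ℝ}

lemma pd_mild_sub_mild (h : EvolFam A c μ) (hf : Src f M L K θ) (hf' : Src f' M' L' K' θ)
    (hφ : Dat φ G α) (k : Fin D) (x : Fin D → ℝ) :
    pd (mild μ f φ t t') k x - pd (mild μ f' φ t t') k x =
      ∫ s in Ioc t t', pd (avg (μ t s) (fun y => f s y - f' s y)) k x := by
  have h1 := h.duh_facts hf t t'
  have h2 := h.duh_facts hf' t t'
  have h3 := h.duh_facts (hf.sub hf') t t'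
  have h4 : duh μ (fun s y => f s y - f' s y) t t' = fun x => duh μ f t t' x - duh μ f' t t' x := by
    funext x
    unfold duh
    rw [← integral_sub (h.integrableOn_avg hf x) (h.integrableOn_avg hf' x)]
    refine integral_congr_ae (Eventually.of_forall fun s => ?_)
    have := h.prob t s
    exact avg_sub _ (hf.bl s).toBC (hf'.bl s).toBC x
  rw [(h.mild_facts hf hφ t t').2.1, (h.mild_facts hf' hφ t t').2.1, add_sub_add_left_eq_sub]
  have h5 := congrFun (pd_sub (h1.1.differentiable (by simp)) (h2.1.differentiable (by simp)) k) x
  rw [← h4, h3.2.1] at h5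
  exact h5.symm

lemma abs_pd_avg_sub_le (h : EvolFam A c μ) (hf : Src f M L K θ) (hf' : Src f' M' L' K' θ)
    {s m : ℝ} (hts : t < s) (hm : ∀ x, |f s x - f' s x| ≤ m) (k : Fin D) (x : Fin D → ℝ) :
    |pd (avg (μ t s) (fun y => f s y - f' s y)) k x| ≤ c * m * (s - t) ^ (-(1/2) : ℝ) :=
  (h.smooth t s hts _ ((hf.sub hf').bl s).cont m hm).2 k x

end EvolFam

/-- Local Lipschitz bounds, on the ball of radius `R`, for a family of nonlinearities. -/
structure Nl {D I : ℕ} (F : Fin I → ℝ → (Fin I → Fin D → ℝ) → ℝ) (θ R Λ : ℝ) : Prop where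
  nonneg : 0 ≤ Λ
  bdd : ∀ i t p, ‖p‖ ≤ R → |F i t p| ≤ Λ
  lip : ∀ i t t' p p', ‖p‖ ≤ R → ‖p'‖ ≤ R → |F i t p - F i t' p'| ≤ Λ * (|t - t'| ^ θ + ‖p - p'‖)

/-- The matrix of first derivatives of the family `v` at time `t`. -/
def grad {D I : ℕ} (v : Fin I → ℝ → (Fin D → ℝ) → ℝ) (t : ℝ) (x : Fin D → ℝ) :
    Fin I → Fin D → ℝ := fun j k => pd (v j t) k x

/-- The nonlinearity evaluated along `v`, frozen in time outside `[0, T]`. -/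
def nlSrc {D I : ℕ} (F : Fin I → ℝ → (Fin I → Fin D → ℝ) → ℝ) (T : ℝ)
    (v : Fin I → ℝ → (Fin D → ℝ) → ℝ) (i : Fin I) (s : ℝ) (x : Fin D → ℝ) : ℝ :=
  F i s (grad v (clamp T s) x)

/-- Mild solutions of the coupled system. -/
structure MildSol {D I : ℕ} (μ : ℝ → ℝ → Measure (Fin D → ℝ))
    (F : Fin I → ℝ → (Fin I → Fin D → ℝ) → ℝ) (T θ : ℝ) (g : Fin I → (Fin D → ℝ) → ℝ)
    (M L K R : ℝ) (v : Fin I → ℝ → (Fin D → ℝ) → ℝ) : Prop where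
  src : ∀ i, Src (nlSrc F T v i) M L K θ
  eq : ∀ i, ∀ t ∈ Icc (0:ℝ) T, v i t = mild μ (nlSrc F T v i) (g i) t T
  grad_le : ∀ t ∈ Icc (0:ℝ) T, ∀ x, ‖grad v t x‖ ≤ R

lemma norm_pi_pi_le {D I : ℕ} {p : Fin I → Fin D → ℝ} {r : ℝ} (hr : 0 ≤ r)
    (h : ∀ j k, |p j k| ≤ r) : ‖p‖ ≤ r :=
  (pi_norm_le_iff_of_nonneg hr).2 fun j => (pi_norm_le_iff_of_nonneg hr).2 fun k => h j k

lemma exp_neg_le_rpow {x : ℝ} (hx : 0 < x) : exp (-x) ≤ x ^ (-(1/4) : ℝ) := by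
  rw [exp_neg, rpow_neg hx.le]
  refine inv_anti₀ (rpow_pos_of_pos hx _) ?_
  have h1 : x ^ (1/4 : ℝ) ≤ x + 1 := by
    rcases le_total x 1 with h | h
    · exact (rpow_le_one hx.le h (by norm_num)).trans (by linarith)
    · calc x ^ (1/4 : ℝ) ≤ x ^ (1:ℝ) := rpow_le_rpow_of_exponent_le h (by norm_num)
        _ ≤ x + 1 := by rw [rpow_one]; linarith
  exact h1.trans (add_one_le_exp x)

lemma MildSol.grad_contract {D I : ℕ} {A : ℝ → Matrix (Fin D) (Fin D) ℝ} {c : ℝ}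
    {μ : ℝ → ℝ → Measure (Fin D → ℝ)} (h : EvolFam A c μ)
    {F : Fin I → ℝ → (Fin I → Fin D → ℝ) → ℝ} {T θ R Λ G α M L K M' L' K' : ℝ} (hT1 : T ≤ 1)
    (hF : Nl F θ R Λ) {g : Fin I → (Fin D → ℝ) → ℝ} (hg : ∀ i, Dat (g i) G α)
    {u v : Fin I → ℝ → (Fin D → ℝ) → ℝ} (hu : MildSol μ F T θ g M L K R u)
    (hv : MildSol μ F T θ g M' L' K' R v) {B : ℝ} (hB : 0 ≤ B)
    (hb : ∀ t ∈ Icc (0:ℝ) T, ∀ x,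
      ‖grad u t x - grad v t x‖ ≤ B * exp ((8 * c * Λ + 1) ^ 4 * (T - t))) :
    ∀ t ∈ Icc (0:ℝ) T, ∀ x,
      ‖grad u t x - grad v t x‖ ≤ B / 2 * exp ((8 * c * Λ + 1) ^ 4 * (T - t)) := by
  intro t ht x
  have hc := h.c_one
  have hΛ := hF.nonneg
  set l := 8 * c * Λ + 1 with hl
  have hl1 : 1 ≤ l := by
    have : 0 ≤ 8 * c * Λ := by positivity
    linarith
  have hl4 : 0 < l ^ 4 := by positivity
  refine norm_pi_pi_le (by positivity) fun j k => ?_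
  show |pd (u j t) k x - pd (v j t) k x| ≤ _
  rw [hu.eq j t ht, hv.eq j t ht, h.pd_mild_sub_mild (hu.src j) (hv.src j) (hg j)]
  have key : ∀ s ∈ Ioc t T,
      |pd (avg (μ t s) (fun y => nlSrc F T u j s y - nlSrc F T v j s y)) k x| ≤
        (c * Λ * B * exp (l ^ 4 * (T - t)) * l⁻¹) * (s - t) ^ (-(3/4) : ℝ) := by
    intro s hs
    have hs' : s ∈ Icc (0:ℝ) T := ⟨ht.1.trans hs.1.le, hs.2⟩
    have hst : 0 < s - t := by linarith [hs.1]
    refine (h.abs_pd_avg_sub_le (hu.src j) (hv.src j) hs.1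
      (m := Λ * (B * exp (l ^ 4 * (T - s)))) (fun y => ?_) k x).trans ?_
    · have h1 := hF.lip j s s _ _ (hu.grad_le s hs' y) (hv.grad_le s hs' y)
      unfold nlSrc
      rw [clamp_of_mem hs']
      refine h1.trans ?_
      rw [sub_self, abs_zero, zero_rpow (hu.src j).θ_pos.ne', zero_add]
      exact mul_le_mul_of_nonneg_left (hb s hs' y) hΛ
    · have h2 : exp (l ^ 4 * (T - s)) = exp (l ^ 4 * (T - t)) * exp (-(l ^ 4 * (s - t))) := by
        rw [← exp_add]; congr 1; ring
      have h3 : exp (-(l ^ 4 * (s - t))) ≤ l⁻¹ * (s - t) ^ (-(1/4) : ℝ) := by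
        refine (exp_neg_le_rpow (mul_pos hl4 hst)).trans (le_of_eq ?_)
        rw [mul_rpow hl4.le hst.le]
        congr 1
        rw [← rpow_natCast, ← rpow_mul (by linarith), ← rpow_neg_one]
        norm_num
      have h4 : (s - t) ^ (-(3/4) : ℝ) = (s - t) ^ (-(1/4) : ℝ) * (s - t) ^ (-(1/2) : ℝ) := by
        rw [← rpow_add hst]; norm_num
      rw [h2, h4]
      have h5 : 0 ≤ (s - t) ^ (-(1/2) : ℝ) := rpow_nonneg hst.le _
      calc _ = (c * Λ * B * exp (l ^ 4 * (T - t)) * (s - t) ^ (-(1/2) : ℝ)) *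
            exp (-(l ^ 4 * (s - t))) := by ring
        _ ≤ (c * Λ * B * exp (l ^ 4 * (T - t)) * (s - t) ^ (-(1/2) : ℝ)) *
            (l⁻¹ * (s - t) ^ (-(1/4) : ℝ)) := mul_le_mul_of_nonneg_left h3 (by positivity)
        _ = _ := by ring
  refine (abs_setIntegral_sub_rpow_le (by norm_num) ht.2 key).trans ?_
  have h6 : (T - t) ^ (-(3/4) + 1 : ℝ) ≤ 1 :=
    rpow_le_one (by linarith [ht.2]) (by linarith [ht.1]) (by norm_num)
  have h7 : (T - t) ^ (-(3/4) + 1 : ℝ) / (-(3/4) + 1) ≤ 4 := by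
    rw [div_le_iff₀ (by norm_num)]; linarith
  have h8 : 4 * c * Λ * l⁻¹ ≤ 1 / 2 := by
    rw [← div_eq_mul_inv, div_le_iff₀ (by linarith)]; rw [hl]; linarith
  calc _ ≤ (c * Λ * B * exp (l ^ 4 * (T - t)) * l⁻¹) * 4 :=
        mul_le_mul_of_nonneg_left h7 (by positivity)
    _ = (B * exp (l ^ 4 * (T - t))) * (4 * c * Λ * l⁻¹) := by ring
    _ ≤ (B * exp (l ^ 4 * (T - t))) * (1 / 2) := mul_le_mul_of_nonneg_left h8 (by positivity)
    _ = _ := by ring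

lemma MildSol.unique {D I : ℕ} {A : ℝ → Matrix (Fin D) (Fin D) ℝ} {c : ℝ}
    {μ : ℝ → ℝ → Measure (Fin D → ℝ)} (h : EvolFam A c μ)
    {F : Fin I → ℝ → (Fin I → Fin D → ℝ) → ℝ} {T θ R Λ G α M L K M' L' K' : ℝ} (hT1 : T ≤ 1)
    (hF : Nl F θ R Λ) {g : Fin I → (Fin D → ℝ) → ℝ} (hg : ∀ i, Dat (g i) G α)
    {u v : Fin I → ℝ → (Fin D → ℝ) → ℝ} (hu : MildSol μ F T θ g M L K R u)
    (hv : MildSol μ F T θ g M' L' K' R v) (i : Fin I) {t : ℝ} (ht : t ∈ Icc (0:ℝ) T) :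
    v i t = u i t := by
  have hR : 0 ≤ R := (norm_nonneg _).trans (hu.grad_le t ht 0)
  have hl4 : 0 ≤ (8 * c * Λ + 1) ^ 4 := by positivity
  have hit : ∀ n : ℕ, ∀ t ∈ Icc (0:ℝ) T, ∀ x, ‖grad u t x - grad v t x‖ ≤
      (2 * R) / 2 ^ n * exp ((8 * c * Λ + 1) ^ 4 * (T - t)) := by
    intro n
    induction n with
    | zero =>
      intro t ht x
      have h1 : 1 ≤ exp ((8 * c * Λ + 1) ^ 4 * (T - t)) :=
        one_le_exp (mul_nonneg hl4 (by linarith [ht.2]))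
      have h2 := (norm_sub_le _ _).trans (add_le_add (hu.grad_le t ht x) (hv.grad_le t ht x))
      rw [pow_zero, div_one]
      nlinarith
    | succ n ih =>
      have := hu.grad_contract h hT1 hF hg hv (by positivity) ih
      intro t ht x
      refine (this t ht x).trans (le_of_eq ?_)
      rw [pow_succ]; ring
  have heq : ∀ t ∈ Icc (0:ℝ) T, ∀ x, grad u t x = grad v t x := fun t ht x => by
    have h1 : Tendsto (fun n : ℕ => (2 * R) / 2 ^ n * exp ((8 * c * Λ + 1) ^ 4 * (T - t))) atTop
        (𝓝 0) := by
      have := ((tendsto_inv_atTop_zero.comp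
        (tendsto_pow_atTop_atTop_of_one_lt (one_lt_two (α := ℝ)))).const_mul (2 * R)).mul_const
          (exp ((8 * c * Λ + 1) ^ 4 * (T - t)))
      simpa [div_eq_mul_inv] using this
    have h2 := ge_of_tendsto h1 (Eventually.of_forall fun n => hit n t ht x)
    exact sub_eq_zero.1 (norm_le_zero_iff.1 h2)
  have hsrc : nlSrc F T v i = nlSrc F T u i := by
    funext s x
    unfold nlSrc
    rw [heq _ (clamp_mem (ht.1.trans ht.2) s)]
  rw [hu.eq i t ht, hv.eq i t ht, hsrc]

namespace EvolFam
variable {D : ℕ} {A : ℝ → Matrix (Fin D) (Fin D) ℝ} {c : ℝ} {μ : ℝ → ℝ → Measure (Fin D → ℝ)}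
  {f : ℝ → (Fin D → ℝ) → ℝ} {φ : (Fin D → ℝ) → ℝ} {M L K θ T G α : ℝ}

/-- The `C^{2+α}` bound of `EvolFam.dat_mild`. -/
def datBound (D : ℕ) (c α G M L : ℝ) : ℝ :=
  G + (2 * c * M + 4 * c * L + (4 * c + 16 * D ^ 2 * c ^ 2) * L / ((1 - α) / 2))

lemma dat_mild_Icc (h : EvolFam A c μ) (hα : α ∈ Ioo (0:ℝ) 1) (hf : Src f M L K θ)
    (hφ : Dat φ G α) (hT1 : T ≤ 1) {t : ℝ} (ht : t ∈ Icc (0:ℝ) T) :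
    Dat (mild μ f φ t T) (datBound D c α G M L) α :=
  h.dat_mild hα hf hφ ht.2 (by linarith [ht.1])

lemma abs_pd_mild_time_le (h : EvolFam A c μ) (hα : α ∈ Ioo (0:ℝ) 1) (hf : Src f M L K θ)
    (hφ : Dat φ G α) (hT1 : T ≤ 1) {t t' : ℝ} (ht : t ∈ Icc (0:ℝ) T) (ht' : t' ∈ Icc (0:ℝ) T)
    (k : Fin D) (x : Fin D → ℝ) :
    |pd (mild μ f φ t T) k x - pd (mild μ f φ t' T) k x| ≤
      (D * datBound D c α G M L * c + 2 * c * M) * |t - t'| ^ (1/2 : ℝ) := by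
  wlog htt : t ≤ t' generalizing t t'
  · rw [abs_sub_comm, abs_sub_comm t]
    exact this ht' ht (le_of_not_ge htt)
  rw [abs_sub_comm t, abs_of_nonneg (sub_nonneg.2 htt), h.mild_flow hf hφ.bc htt ht'.2]
  exact h.abs_pd_mild_sub_le hf (h.dat_mild_Icc hα hf hφ hT1 ht') htt k x

end EvolFam

lemma continuous_of_lip_holder {D : ℕ} {E : Type*} [NormedAddCommGroup E]
    {P : ℝ × (Fin D → ℝ) → E} {L K θ : ℝ} (hθ : 0 < θ)
    (hx : ∀ t x y, ‖P (t, x) - P (t, y)‖ ≤ L * ‖x - y‖)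
    (ht : ∀ t s x, ‖P (t, x) - P (s, x)‖ ≤ K * |t - s| ^ θ) : Continuous P := by
  rw [continuous_iff_continuousAt]
  rintro ⟨t₀, x₀⟩
  refine tendsto_iff_norm_sub_tendsto_zero.2 ?_
  refine squeeze_zero (fun _ => norm_nonneg _) (g := fun p : ℝ × (Fin D → ℝ) =>
    L * ‖p.2 - x₀‖ + K * |p.1 - t₀| ^ θ) (fun p => ?_) ?_
  · rw [← sub_add_sub_cancel _ (P (p.1, x₀))]
    exact (norm_add_le _ _).trans (add_le_add (hx _ _ _) (ht _ _ _))
  · have h1 : Continuous fun p : ℝ × (Fin D → ℝ) => |p.1 - t₀| ^ θ :=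
      Continuous.rpow_const (by fun_prop) fun _ => Or.inr hθ.le
    have hc : Continuous fun p : ℝ × (Fin D → ℝ) => L * ‖p.2 - x₀‖ + K * |p.1 - t₀| ^ θ := by
      fun_prop
    have := hc.tendsto (t₀, x₀)
    simpa [zero_rpow hθ.ne'] using this

/-- Bounded functions on space-time, Lipschitz in space and Hölder in time. -/
def lipHolder (D I : ℕ) (R L K θ : ℝ) :
    Set (BoundedContinuousFunction (ℝ × (Fin D → ℝ)) (Fin I → Fin D → ℝ)) :=
  {q | (∀ z, ‖q z‖ ≤ R) ∧ (∀ t x y, ‖q (t, x) - q (t, y)‖ ≤ L * ‖x - y‖) ∧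
    ∀ t s x, ‖q (t, x) - q (s, x)‖ ≤ K * |t - s| ^ θ}

lemma isClosed_lipHolder (D I : ℕ) (R L K θ : ℝ) : IsClosed (lipHolder D I R L K θ) := by
  have hc : ∀ z, Continuous fun q : BoundedContinuousFunction (ℝ × (Fin D → ℝ))
      (Fin I → Fin D → ℝ) => q z := fun z => continuous_eval_const z
  unfold lipHolder
  simp only [Set.ofPred_and, Set.ofPred_forall]
  refine IsClosed.inter ?_ (IsClosed.inter ?_ ?_)
  · exact isClosed_iInter fun z => isClosed_le (hc z).norm continuous_const
  · exact isClosed_iInter fun t => isClosed_iInter fun x => isClosed_iInter fun y =>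
      isClosed_le ((hc _).sub (hc _)).norm continuous_const
  · exact isClosed_iInter fun t => isClosed_iInter fun x => isClosed_iInter fun y =>
      isClosed_le ((hc _).sub (hc _)).norm continuous_const

lemma src_of_lipHolder {D I : ℕ} {F : Fin I → ℝ → (Fin I → Fin D → ℝ) → ℝ} {θ R Λ L K : ℝ}
    (hF : Nl F θ R Λ) (hθ : 0 < θ) (hL : 0 ≤ L) (hK : 0 ≤ K)
    {q : ℝ × (Fin D → ℝ) → Fin I → Fin D → ℝ} (hq : ∀ z, ‖q z‖ ≤ R)
    (hx : ∀ t x y, ‖q (t, x) - q (t, y)‖ ≤ L * ‖x - y‖)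
    (ht : ∀ t s x, ‖q (t, x) - q (s, x)‖ ≤ K * |t - s| ^ θ) (i : Fin I) :
    Src (fun s x => F i s (q (s, x))) Λ (Λ * L) (Λ * (1 + K)) θ := by
  have hΛ := hF.nonneg
  have hlip : ∀ s x y, |F i s (q (s, x)) - F i s (q (s, y))| ≤ Λ * L * ‖x - y‖ := fun s x y => by
    have h1 := hF.lip i s s _ _ (hq (s, x)) (hq (s, y))
    rw [sub_self, abs_zero, zero_rpow hθ.ne', zero_add] at h1
    rw [mul_assoc]
    exact h1.trans (mul_le_mul_of_nonneg_left (hx s x y) hΛ)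
  refine ⟨hθ, by positivity, fun s => ⟨⟨?_, fun x => hF.bdd i s _ (hq _)⟩, by positivity, hlip s⟩,
    fun s s' x => ?_⟩
  · exact (LipschitzWith.of_dist_le_mul (K := ⟨Λ * L, by positivity⟩) fun x y => by
      rw [dist_eq_norm, dist_eq_norm]; exact hlip s x y).continuous
  · refine (hF.lip i s s' _ _ (hq _) (hq _)).trans ?_
    rw [mul_assoc]
    refine mul_le_mul_of_nonneg_left ?_ hΛ
    linarith [ht s s' x]

theorem exists_mildSol {D I : ℕ} {A : ℝ → Matrix (Fin D) (Fin D) ℝ} {c : ℝ}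
    {μ : ℝ → ℝ → Measure (Fin D → ℝ)} (h : EvolFam A c μ)
    {F : Fin I → ℝ → (Fin I → Fin D → ℝ) → ℝ} {Λ G α : ℝ} (hα : α ∈ Ioo (0:ℝ) 1) (hG : 0 ≤ G)
    (hF : Nl F (α / 2) (G + 1) Λ) {g : Fin I → (Fin D → ℝ) → ℝ} (hg : ∀ i, Dat (g i) G α) :
    ∃ T₀ ∈ Ioc (0:ℝ) 1, ∃ M L K, ∀ T, 0 < T → T < T₀ →
      ∃ u, MildSol μ F T (α / 2) g M L K (G + 1) u := by
  have hc := h.c_one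
  have hΛ := hF.nonneg
  have hα2 : 0 < α / 2 := by linarith [hα.1]
  have hα' : 0 < 1 - α := by linarith [hα.2]
  set Lq : ℝ := D * (G + 1) with hLq
  have hLq0 : 0 ≤ Lq := by positivity
  set Lf : ℝ := Λ * Lq with hLf
  have hLf0 : 0 ≤ Lf := by positivity
  set Mq : ℝ := D * EvolFam.datBound D c α G Λ Lf * c + 2 * c * Λ with hMq
  have hMq0 : 0 ≤ Mq := by
    rw [hMq, EvolFam.datBound]; positivity
  set ε : ℝ := (4 * c * (Λ + Lf + 1))⁻¹ with hε
  have hε0 : 0 < ε := by positivity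
  refine ⟨min 1 (ε ^ 2), ⟨by positivity, min_le_left _ _⟩, Λ, Lf, Λ * (1 + Mq), fun T hT hTT => ?_⟩
  have hT1 : T ≤ 1 := hTT.le.trans (min_le_left _ _)
  have hsq : T ^ (1/2 : ℝ) ≤ ε := by
    rw [← sqrt_eq_rpow]
    exact sqrt_le_iff.2 ⟨hε0.le, hTT.le.trans (min_le_right _ _)⟩
  have hpow : ∀ t ∈ Icc (0:ℝ) T, (T - t) ^ (1/2 : ℝ) ≤ ε := fun t ht =>
    (rpow_le_rpow (by linarith [ht.2]) (by linarith [ht.1]) (by norm_num)).trans hsq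
  have hsmall1 : 2 * c * Λ * ε ≤ 1 / 2 := by
    rw [hε, ← div_eq_mul_inv, div_le_iff₀ (by positivity)]
    nlinarith [mul_nonneg (zero_le_one.trans hc) hLf0]
  have hsmall2 : 4 * c * Lf * ε ≤ 1 := by
    rw [hε, ← div_eq_mul_inv, div_le_iff₀ (by positivity)]
    nlinarith [mul_nonneg (zero_le_one.trans hc) hΛ]
  set S := lipHolder D I (G + 1) Lq Mq (α / 2) with hS
  have hsrc : ∀ q : S, ∀ i, Src (fun s x => F i s (q.1 (s, x))) Λ Lf (Λ * (1 + Mq)) (α / 2) :=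
    fun q => src_of_lipHolder hF hα2 hLq0 hMq0 q.2.1 q.2.2.1 q.2.2.2
  let P : S → ℝ × (Fin D → ℝ) → Fin I → Fin D → ℝ := fun q z j k =>
    pd (mild μ (fun s x => F j s (q.1 (s, x))) (g j) (clamp T z.1) T) k z.2
  have hPb : ∀ q z, ‖P q z‖ ≤ G + 1 := fun q z => norm_pi_pi_le (by positivity) fun j k => by
    have ht := clamp_mem hT.le z.1
    refine (h.abs_pd_mild_le (hsrc q j) (hg j) ht.2 k z.2).trans ?_
    have := mul_le_mul_of_nonneg_left (hpow _ ht) (show 0 ≤ 2 * c * Λ by positivity)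
    linarith
  have hPx : ∀ q t x y, ‖P q (t, x) - P q (t, y)‖ ≤ Lq * ‖x - y‖ := fun q t x y =>
    norm_pi_pi_le (by positivity) fun j k => by
      have ht := clamp_mem hT.le t
      have hd := h.dat_mild_Icc hα (hsrc q j) (hg j) hT1 ht
      refine lip_of_abs_pd_le ((hd.cd.pd_one k).differentiable (by simp)) (by positivity)
        (fun d z => ?_) x y
      refine (h.abs_pdd_mild_le (hsrc q j) (hg j) ht.2 d k z).trans ?_
      have := mul_le_mul_of_nonneg_left (hpow _ ht) (show 0 ≤ 4 * c * Lf by positivity)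
      linarith
  have hPt : ∀ q t s x, ‖P q (t, x) - P q (s, x)‖ ≤ Mq * |t - s| ^ (α / 2) := fun q t s x =>
    norm_pi_pi_le (by positivity) fun j k => by
      refine (h.abs_pd_mild_time_le hα (hsrc q j) (hg j) hT1 (clamp_mem hT.le t)
        (clamp_mem hT.le s) k x).trans ?_
      exact mul_le_mul_of_nonneg_left
        (abs_clamp_sub_rpow_le hT.le hT1 hα2 (by linarith [hα.2]) t s) hMq0
  have hex : ∀ q : S, ∃ q' : S, ∀ z, q'.1 z = P q z := fun q =>
    ⟨⟨BoundedContinuousFunction.ofNormedAddCommGroup (P q)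
      (continuous_of_lip_holder hα2 (hPx q) (hPt q)) (G + 1) (hPb q), hPb q, hPx q, hPt q⟩,
      fun z => rfl⟩
  choose Φ hΦ using hex
  have hcontr : ContractingWith (1/2) Φ := by
    refine ⟨by norm_num, LipschitzWith.of_dist_le_mul fun q q' => ?_⟩
    rw [Subtype.dist_eq, BoundedContinuousFunction.dist_le (by positivity)]
    intro z
    rw [hΦ, hΦ, dist_eq_norm]
    have hqq : ∀ z, ‖q.1 z - q'.1 z‖ ≤ dist q q' := fun z => by
      rw [← dist_eq_norm]; exact BoundedContinuousFunction.dist_coe_le_dist z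
    have hd := dist_nonneg (x := q) (y := q')
    refine norm_pi_pi_le (by positivity) fun j k => ?_
    have ht := clamp_mem hT.le z.1
    show |pd (mild μ _ (g j) _ T) k z.2 - pd (mild μ _ (g j) _ T) k z.2| ≤ _
    rw [h.pd_mild_sub_mild (hsrc q j) (hsrc q' j) (hg j)]
    refine (abs_setIntegral_sub_rpow_le (r := -(1/2)) (K := c * (Λ * dist q q')) (by norm_num) ht.2
      fun s hs => h.abs_pd_avg_sub_le (hsrc q j) (hsrc q' j) hs.1 (fun y => ?_) k z.2).trans ?_
    · have h1 := hF.lip j s s _ _ (q.2.1 (s, y)) (q'.2.1 (s, y))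
      rw [sub_self, abs_zero, zero_rpow hα2.ne', zero_add] at h1
      exact h1.trans (mul_le_mul_of_nonneg_left (hqq _) hΛ)
    · have h2 := mul_le_mul_of_nonneg_left (hpow _ ht) (show 0 ≤ 2 * c * Λ by positivity)
      have h3 := mul_le_mul_of_nonneg_right (h2.trans hsmall1) hd
      have h4 : (-(1/2) + 1 : ℝ) = 1/2 := by norm_num
      rw [h4]
      norm_num at h3 ⊢
      linarith
  have hne : Nonempty S := ⟨⟨0, fun z => by simpa using by positivity,
    fun t x y => by simpa using by positivity, fun t s x => by simpa using by positivity⟩⟩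
  have hcompl : CompleteSpace S := (isClosed_lipHolder D I (G + 1) Lq Mq (α / 2)).completeSpace_coe
  set q := ContractingWith.fixedPoint Φ hcontr
  have hfix : Φ q = q := hcontr.fixedPoint_isFixedPt
  let u : Fin I → ℝ → (Fin D → ℝ) → ℝ := fun i t =>
    mild μ (fun s x => F i s (q.1 (s, x))) (g i) t T
  have hgr : ∀ t x, grad u (clamp T t) x = q.1 (t, x) := fun t x => by
    conv_rhs => rw [← hfix, hΦ]
    rfl
  have hnl : ∀ i, nlSrc F T u i = fun s x => F i s (q.1 (s, x)) := fun i => by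
    funext s x
    unfold nlSrc
    rw [hgr]
  refine ⟨u, fun i => ?_, fun i t _ => ?_, fun t ht x => ?_⟩
  · rw [hnl]; exact hsrc q i
  · rw [hnl]
  · have := hgr t x
    rw [clamp_of_mem ht] at this
    rw [this]
    exact q.2.1 _

lemma eq_of_step {f : ℝ → ℝ} {t T K K' θ θ' : ℝ} (hθ : 0 < θ) (hθ' : 0 < θ') (htT : t ≤ T)
    (h1 : ∀ s s', t ≤ s → s ≤ s' → s' ≤ T → |f s' - f s| ≤ K' * (s' - s) ^ θ')
    (h2 : ∀ s s', t ≤ s → s ≤ s' → s' < T → |f s' - f s| ≤ K * (s' - s) ^ (1 + θ)) :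
    f T = f t := by
  refine constant_of_has_deriv_right_zero (a := t) (b := T) (f := f) (fun s hs => ?_)
    (fun s hs => ?_) T ⟨htT, le_rfl⟩
  · refine tendsto_iff_norm_sub_tendsto_zero.2 ?_
    have hc : Continuous fun s' => K' * |s' - s| ^ θ' :=
      continuous_const.mul (Continuous.rpow_const (by fun_prop) fun _ => Or.inr hθ'.le)
    have h0 : Tendsto (fun s' => K' * |s' - s| ^ θ') (𝓝[Icc t T] s) (𝓝 0) := by
      have := (hc.tendsto s).mono_left (nhdsWithin_le_nhds (s := Icc t T))
      simpa [zero_rpow hθ'.ne'] using this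
    refine squeeze_zero' (Eventually.of_forall fun _ => norm_nonneg _) ?_ h0
    filter_upwards [self_mem_nhdsWithin] with s' hs'
    rw [Real.norm_eq_abs]
    rcases le_total s s' with h | h
    · rw [abs_of_nonneg (sub_nonneg.2 h)]
      exact h1 s s' hs.1 h hs'.2
    · rw [abs_sub_comm, abs_sub_comm s', abs_of_nonneg (sub_nonneg.2 h)]
      exact h1 s' s hs'.1 h hs.2
  · rw [hasDerivWithinAt_iff_isLittleO, Asymptotics.isLittleO_iff]
    intro ε hε
    have hc : Continuous fun s' => K * |s' - s| ^ θ :=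
      continuous_const.mul (Continuous.rpow_const (by fun_prop) fun _ => Or.inr hθ.le)
    have h0 : Tendsto (fun s' => K * |s' - s| ^ θ) (𝓝[Ici s] s) (𝓝 0) := by
      have := (hc.tendsto s).mono_left (nhdsWithin_le_nhds (s := Ici s))
      simpa [zero_rpow hθ.ne'] using this
    filter_upwards [Ico_mem_nhdsGE hs.2, h0.eventually (gt_mem_nhds hε)] with s' hs' hlt
    have h3 := h2 s s' hs.1 hs'.1 hs'.2
    rw [abs_of_nonneg (sub_nonneg.2 hs'.1)] at hlt
    rw [smul_zero, sub_zero, Real.norm_eq_abs, Real.norm_eq_abs, abs_of_nonneg (sub_nonneg.2 hs'.1)]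
    refine h3.trans ?_
    rw [rpow_add_of_nonneg (sub_nonneg.2 hs'.1) zero_le_one hθ.le, rpow_one, mul_comm (s' - s),
      ← mul_assoc]
    exact mul_le_mul_of_nonneg_right hlt.le (sub_nonneg.2 hs'.1)

lemma Dat.abs_pd_sub_le {D : ℕ} {φ ψ : (Fin D → ℝ) → ℝ} {B h α : ℝ} (hφ : Dat φ B α)
    (hψ : Dat ψ B α) (hh : 0 ≤ h) (hb : ∀ x, |φ x - ψ x| ≤ B * h) (k : Fin D) (x : Fin D → ℝ) :
    |pd φ k x - pd ψ k x| ≤ (2 * B + 2 * (D * B)) * h ^ (1/2 : ℝ) := by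
  have hB := hφ.bc.nonneg
  rcases hh.eq_or_lt with rfl | hpos
  · have : φ = ψ := funext fun x => sub_eq_zero.1 (abs_nonpos_iff.1 (by simpa using hb x))
    rw [this, sub_self, abs_zero]; positivity
  set ε := h ^ (1/2 : ℝ) with hε
  have hε0 : 0 < ε := rpow_pos_of_pos hpos _
  have hεε : ε * ε = h := by rw [hε, ← sqrt_eq_rpow, mul_self_sqrt hh]
  set e : Fin D → ℝ := Pi.single k 1 with he
  have hcomp : ∀ χ : (Fin D → ℝ) → ℝ, Differentiable ℝ χ → ∀ s : ℝ,
      HasDerivAt (fun s : ℝ => χ (x + s • e)) (pd χ k (x + s • e)) s := fun χ hχ s => by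
    have hline : HasDerivAt (fun s : ℝ => x + s • e) e s := by
      simpa using ((hasDerivAt_id s).smul_const e).const_add x
    exact (hχ _).hasFDerivAt.comp_hasDerivAt s hline
  have hder : ∀ s : ℝ, HasDerivAt (fun s : ℝ => φ (x + s • e) - ψ (x + s • e))
      (pd φ k (x + s • e) - pd ψ k (x + s • e)) s := fun s =>
    (hcomp φ (hφ.cd.differentiable (by simp)) s).sub (hcomp ψ (hψ.cd.differentiable (by simp)) s)
  obtain ⟨r, hr, hr'⟩ := exists_hasDerivAt_eq_slope _ _ hε0
    (fun s _ => (hder s).continuousAt.continuousWithinAt) (fun s _ => hder s)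
  have h1 : |pd φ k (x + r • e) - pd ψ k (x + r • e)| ≤ 2 * B * ε := by
    rw [hr', sub_zero, abs_div, abs_of_pos hε0, div_le_iff₀ hε0, mul_assoc, hεε]
    refine (abs_sub _ _).trans ?_
    linarith [hb (x + ε • e), hb (x + (0:ℝ) • e)]
  have hn : ‖x - (x + r • e)‖ ≤ ε := by
    rw [sub_add_cancel_left, norm_neg, norm_smul, he, norm_single_one, mul_one, Real.norm_eq_abs,
      abs_of_pos hr.1]
    exact hr.2.le
  have hDB : 0 ≤ D * B := by positivity
  have h2 := ((hφ.pd_bl k).lip x (x + r • e)).trans (mul_le_mul_of_nonneg_left hn hDB)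
  have h3 := ((hψ.pd_bl k).lip x (x + r • e)).trans (mul_le_mul_of_nonneg_left hn hDB)
  calc _ = |(pd φ k (x + r • e) - pd ψ k (x + r • e)) + (pd φ k x - pd φ k (x + r • e)) +
        -(pd ψ k x - pd ψ k (x + r • e))| := by congr 1; ring
    _ ≤ _ := abs_add_three _ _ _
    _ ≤ _ := by rw [abs_neg]; linarith

/-- Classical solutions with bounded Hölder norms, `w` being the time derivative of `v`. -/
structure ClassSol {D I : ℕ} (A : ℝ → Matrix (Fin D) (Fin D) ℝ)
    (F : Fin I → ℝ → (Fin I → Fin D → ℝ) → ℝ) (T α : ℝ) (g : Fin I → (Fin D → ℝ) → ℝ) (B : ℝ)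
    (v w : Fin I → ℝ → (Fin D → ℝ) → ℝ) : Prop where
  dat : ∀ i, ∀ t ∈ Icc (0:ℝ) T, Dat (v i t) B α
  deriv : ∀ i x, ∀ t ∈ Icc (0:ℝ) T, HasDerivWithinAt (fun s => v i s x) (w i t x) (Icc 0 T) t
  bdd : ∀ i x, ∀ t ∈ Icc (0:ℝ) T, |w i t x| ≤ B
  hol : ∀ i x, ∀ t ∈ Icc (0:ℝ) T, ∀ s ∈ Icc (0:ℝ) T, |w i t x - w i s x| ≤ B * |t - s| ^ (α / 2)
  eq : ∀ i x, ∀ t ∈ Ico (0:ℝ) T, w i t x = -gen (A t) (v i t) (nlSrc F T v i t) x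
  term : ∀ i, v i T = g i

namespace ClassSol
variable {D I : ℕ} {A : ℝ → Matrix (Fin D) (Fin D) ℝ}
  {F : Fin I → ℝ → (Fin I → Fin D → ℝ) → ℝ} {T α B : ℝ} {g : Fin I → (Fin D → ℝ) → ℝ}
  {v w : Fin I → ℝ → (Fin D → ℝ) → ℝ}

lemma abs_sub_le (h : ClassSol A F T α g B v w) (i : Fin I) (x : Fin D → ℝ) {t s : ℝ}
    (ht : t ∈ Icc (0:ℝ) T) (hs : s ∈ Icc (0:ℝ) T) : |v i t x - v i s x| ≤ B * |t - s| :=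
  (convex_Icc (0:ℝ) T).norm_image_sub_le_of_norm_hasDerivWithin_le
    (fun r hr => h.deriv i x r hr) (fun r hr => h.bdd i x r hr) hs ht

lemma abs_sub_sub_le (h : ClassSol A F T α g B v w) (hα : 0 < α) (hB : 0 ≤ B) (i : Fin I)
    (x : Fin D → ℝ) {s s' : ℝ} (hs : 0 ≤ s) (hss : s ≤ s') (hs' : s' ≤ T) :
    |v i s x - v i s' x + (s' - s) * w i s' x| ≤ B * (s' - s) ^ (1 + α / 2) := by
  have hsub : Icc s s' ⊆ Icc 0 T := Icc_subset_Icc hs hs'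
  have hd : 0 ≤ s' - s := by linarith
  have hs'm : s' ∈ Icc (0:ℝ) T := ⟨hs.trans hss, hs'⟩
  have := (convex_Icc s s').norm_image_sub_le_of_norm_hasDerivWithin_le
    (f := fun r => v i r x - r * w i s' x) (f' := fun r => w i r x - 1 * w i s' x)
    (C := B * (s' - s) ^ (α / 2))
    (fun r hr => ((h.deriv i x r (hsub hr)).mono hsub).fun_sub
      ((hasDerivAt_id' r).mul_const _).hasDerivWithinAt)
    (fun r hr => by
      rw [one_mul, Real.norm_eq_abs]
      refine (h.hol i x r (hsub hr) s' hs'm).trans ?_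
      gcongr
      exact abs_le.2 ⟨by linarith [hr.1], by linarith [hr.2]⟩)
    (right_mem_Icc.2 hss) (left_mem_Icc.2 hss)
  rw [Real.norm_eq_abs, Real.norm_eq_abs, abs_sub_comm s s', abs_of_nonneg hd] at this
  rw [rpow_add_of_nonneg hd zero_le_one (by positivity), rpow_one]
  calc _ = |v i s x - s * w i s' x - (v i s' x - s' * w i s' x)| := by congr 1; ring
    _ ≤ _ := this
    _ = _ := by ring

lemma mildSol (hcl : ClassSol A F T α g B v w) {c : ℝ} {μ : ℝ → ℝ → Measure (Fin D → ℝ)}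
    (h : EvolFam A c μ) (hα : α ∈ Ioo (0:ℝ) 1) (hT0 : 0 ≤ T) (hT1 : T ≤ 1) (hB : 0 ≤ B) {Λ KA : ℝ}
    (hF : Nl F (α / 2) B Λ) (hKA : 0 ≤ KA) (hAc : ∀ i j, Continuous fun t => A t i j)
    (hA : ∀ s s' i j, |A s i j - A s' i j| ≤ KA * |s - s'| ^ (α / 2)) :
    ∃ M L K, MildSol μ F T (α / 2) g M L K B v := by
  have hα2 : 0 < α / 2 := by linarith [hα.1]
  have hDB : 0 ≤ D * B := by positivity
  set H := 2 * B + 2 * (D * B) with hH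
  have hH0 : 0 ≤ H := by positivity
  have hgrad : ∀ t ∈ Icc (0:ℝ) T, ∀ x, ‖grad v t x‖ ≤ B := fun t ht x =>
    norm_pi_pi_le hB fun j k => ((hcl.dat j t ht).pd_bc k).bdd x
  have hsrc : ∀ i, Src (nlSrc F T v i) Λ (Λ * (D * B)) (Λ * (1 + H)) (α / 2) :=
    src_of_lipHolder (q := fun z => grad v (clamp T z.1) z.2) hF hα2 hDB hH0
      (fun z => hgrad _ (clamp_mem hT0 _) _)
      (fun t x y => norm_pi_pi_le (by positivity) fun j k =>
        ((hcl.dat j _ (clamp_mem hT0 t)).pd_bl k).lip x y)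
      (fun t s x => norm_pi_pi_le (by positivity) fun j k =>
        ((hcl.dat j _ (clamp_mem hT0 t)).abs_pd_sub_le (hcl.dat j _ (clamp_mem hT0 s))
          (abs_nonneg _)
          (fun x => hcl.abs_sub_le j x (clamp_mem hT0 t) (clamp_mem hT0 s)) k x).trans
          (mul_le_mul_of_nonneg_left
            (abs_clamp_sub_rpow_le hT0 hT1 hα2 (by linarith [hα.2]) t s) hH0))
  refine ⟨Λ, Λ * (D * B), Λ * (1 + H), hsrc, fun i t ht => ?_, hgrad⟩
  funext x
  set f := nlSrc F T v i with hf
  have hstep : ∀ s s', t ≤ s → s ≤ s' → s' ≤ T → ∀ b,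
      (∀ y, |mild μ f (v i s') s s' y - v i s y| ≤ b) →
      |mild μ f (v i s') t s' x - mild μ f (v i s) t s x| ≤ b := fun s s' hts hss hs' b hb => by
    have hs'm : s' ∈ Icc (0:ℝ) T := ⟨ht.1.trans (hts.trans hss), hs'⟩
    have hsm : s ∈ Icc (0:ℝ) T := ⟨ht.1.trans hts, hss.trans hs'⟩
    rw [h.mild_flow (hsrc i) (hcl.dat i s' hs'm).bc hts hss]
    have := h.prob t s
    show |avg (μ t s) _ x + duh μ f t s x - (avg (μ t s) _ x + duh μ f t s x)| ≤ b
    rw [add_sub_add_right_eq_sub]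
    exact abs_avg_sub_avg_le _
      (h.dat_mild hα (hsrc i) (hcl.dat i s' hs'm) hss (by linarith [hsm.1])).bc
      (hcl.dat i s hsm).bc fun y => hb _
  have := eq_of_step (f := fun s => mild μ f (v i s) t s x) (θ := α / 2) (θ' := 1 / 2) hα2
    (by norm_num) ht.2
    (K := (D ^ 2 * B * c + D ^ 2 * (KA * B) + (Λ * (D * B) * c + Λ * (1 + H))) + B)
    (K' := (D * B * c + Λ) + B)
    (fun s s' hts hss hs' => hstep s s' hts hss hs' _ fun y => ?_)
    (fun s s' hts hss hs' => hstep s s' hts hss hs'.le _ fun y => ?_)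
  · simp only [hcl.term] at this
    rw [this, mild, h.avg_self (hcl.dat i t ht).bl]
    simp [duh]
  · have hs'm : s' ∈ Icc (0:ℝ) T := ⟨ht.1.trans (hts.trans hss), hs'⟩
    have hsm : s ∈ Icc (0:ℝ) T := ⟨ht.1.trans hts, hss.trans hs'⟩
    have hd1 : s' - s ≤ 1 := by linarith [hsm.1]
    have h1 := h.abs_mild_sub_le (hsrc i) (hcl.dat i s' hs'm) hss hd1 y
    have h2 := hcl.abs_sub_le i y hs'm hsm
    rw [abs_of_nonneg (sub_nonneg.2 hss)] at h2
    have h3 : s' - s ≤ (s' - s) ^ (1/2 : ℝ) := by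
      simpa using rpow_le_rpow_of_exponent_ge_of_imp (sub_nonneg.2 hss) hd1
        (show (1/2 : ℝ) ≤ 1 by norm_num) (by norm_num)
    have h4 := mul_le_mul_of_nonneg_left h3 hB
    calc _ = |(mild μ f (v i s') s s' y - v i s' y) + (v i s' y - v i s y)| := by congr 1; ring
      _ ≤ _ := abs_add_le _ _
      _ ≤ _ := by linarith
  · have hs'm : s' ∈ Icc (0:ℝ) T := ⟨ht.1.trans (hts.trans hss), hs'.le⟩
    have hd1 : s' - s ≤ 1 := by linarith [ht.1]
    have h1 := h.abs_mild_sub_gen_le hα hKA hAc hA (hsrc i) (hcl.dat i s' hs'm) hss hd1 y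
    have h2 := hcl.abs_sub_sub_le hα.1 hB i y (ht.1.trans hts) hss hs'.le
    rw [hcl.eq i y s' ⟨hs'm.1, hs'⟩, ← hf] at h2
    calc _ = |(mild μ f (v i s') s s' y - v i s' y - (s' - s) * gen (A s') (v i s') (f s') y) +
          -(v i s y - v i s' y + (s' - s) * -gen (A s') (v i s') (f s') y)| := by congr 1; ring
      _ ≤ _ := abs_add_le _ _
      _ ≤ _ := by rw [abs_neg]; linarith

end ClassSol

lemma Dat.mono {D : ℕ} {φ : (Fin D → ℝ) → ℝ} {G G' α : ℝ} (h : Dat φ G α) (hG : G ≤ G') :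
    Dat φ G' α where
  cd := h.cd
  bc := h.bc.mono hG
  pd_bc k := (h.pd_bc k).mono hG
  pdd_bc d e := (h.pdd_bc d e).mono hG
  hol d e x y := (h.hol d e x y).trans (by gcongr)

lemma abs_gen_le {D : ℕ} {A : Matrix (Fin D) (Fin D) ℝ} {φ f : (Fin D → ℝ) → ℝ} {x : Fin D → ℝ}
    {a b m : ℝ} (hA : ∀ i j, |A i j| ≤ a) (hφ : ∀ i j, |pdd φ i j x| ≤ b) (hf : |f x| ≤ m) :
    |gen A φ f x| ≤ D ^ 2 * (a * b) / 2 + m := by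
  refine (abs_add_le _ _).trans (add_le_add ?_ hf)
  rw [abs_div, abs_two]
  refine div_le_div_of_nonneg_right (abs_sum_sum_le fun i j => ?_) zero_le_two
  rw [abs_mul]
  exact mul_le_mul (hA i j) (hφ i j) (abs_nonneg _) ((abs_nonneg _).trans (hA i j))

lemma abs_gen_sub_gen_le {D : ℕ} {A A' : Matrix (Fin D) (Fin D) ℝ}
    {φ ψ f f' : (Fin D → ℝ) → ℝ} {x y : Fin D → ℝ} {a a' p b q : ℝ} (hA : ∀ i j, |A i j| ≤ a)
    (hA' : ∀ i j, |A i j - A' i j| ≤ a') (hp : ∀ i j, |pdd φ i j x - pdd ψ i j y| ≤ p)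
    (hb : ∀ i j, |pdd ψ i j y| ≤ b) (hq : |f x - f' y| ≤ q) :
    |gen A φ f x - gen A' ψ f' y| ≤ D ^ 2 * (a * p + a' * b) / 2 + q := by
  have h1 : gen A φ f x - gen A' ψ f' y = (∑ i, ∑ j, (A i j * (pdd φ i j x - pdd ψ i j y) +
      (A i j - A' i j) * pdd ψ i j y)) / 2 + (f x - f' y) := by
    have : ∀ i j, A i j * (pdd φ i j x - pdd ψ i j y) + (A i j - A' i j) * pdd ψ i j y =
        A i j * pdd φ i j x - A' i j * pdd ψ i j y := fun i j => by ring
    simp only [this, Finset.sum_sub_distrib, gen]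
    ring
  rw [h1]
  refine (abs_add_le _ _).trans (add_le_add ?_ hq)
  rw [abs_div, abs_two]
  refine div_le_div_of_nonneg_right (abs_sum_sum_le fun i j => ?_) zero_le_two
  refine (abs_add_le _ _).trans ?_
  rw [abs_mul, abs_mul]
  exact add_le_add (mul_le_mul (hA i j) (hp i j) (abs_nonneg _) ((abs_nonneg _).trans (hA i j)))
    (mul_le_mul (hA' i j) (hb i j) (abs_nonneg _) ((abs_nonneg _).trans (hA' i j)))

/-- The time derivative of a solution, as given by the equation. -/
def timeDeriv {D I : ℕ} (A : ℝ → Matrix (Fin D) (Fin D) ℝ)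
    (F : Fin I → ℝ → (Fin I → Fin D → ℝ) → ℝ) (T : ℝ) (u : Fin I → ℝ → (Fin D → ℝ) → ℝ)
    (i : Fin I) (t : ℝ) (x : Fin D → ℝ) : ℝ := -gen (A t) (u i t) (nlSrc F T u i t) x

theorem MildSol.classSol {D I : ℕ} {A : ℝ → Matrix (Fin D) (Fin D) ℝ} {c : ℝ}
    {μ : ℝ → ℝ → Measure (Fin D → ℝ)} (h : EvolFam A c μ)
    {F : Fin I → ℝ → (Fin I → Fin D → ℝ) → ℝ} {T α G M L K R KA a : ℝ} (hα : α ∈ Ioo (0:ℝ) 1)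
    (hT0 : 0 ≤ T) (hT1 : T ≤ 1) (hG : 0 ≤ G) {g : Fin I → (Fin D → ℝ) → ℝ} (hg : ∀ i, Dat (g i) G α)
    (hKA : 0 ≤ KA) (hAc : ∀ i j, Continuous fun t => A t i j)
    (hA : ∀ s s' i j, |A s i j - A s' i j| ≤ KA * |s - s'| ^ (α / 2)) (ha0 : 0 ≤ a)
    (ha : ∀ t i j, |A t i j| ≤ a) {u : Fin I → ℝ → (Fin D → ℝ) → ℝ}
    (hu : MildSol μ F T (α / 2) g M L K R u) :
    ∃ B, 0 ≤ B ∧ ClassSol A F T α g B u (timeDeriv A F T u) ∧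
      (∀ i d e x, ∀ t ∈ Icc (0:ℝ) T, ∀ s ∈ Icc (0:ℝ) T,
        |pdd (u i t) d e x - pdd (u i s) d e x| ≤ B * |t - s| ^ (α / 2)) ∧
      ∀ i x y, ∀ t ∈ Icc (0:ℝ) T,
        |timeDeriv A F T u i t x - timeDeriv A F T u i t y| ≤ B * ‖x - y‖ ^ α := by
  rcases isEmpty_or_nonempty (Fin I) with hI | ⟨⟨i₀⟩⟩
  · exact ⟨0, le_rfl, ⟨isEmptyElim, isEmptyElim, isEmptyElim, isEmptyElim, isEmptyElim,
      isEmptyElim⟩, isEmptyElim, isEmptyElim⟩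
  have hc := h.c_one
  have hα2 : 0 < α / 2 := by linarith [hα.1]
  have hα' : 0 < 1 - α := by linarith [hα.2]
  have hM : 0 ≤ M := ((hu.src i₀).bl 0).toBC.nonneg
  have hL : 0 ≤ L := ((hu.src i₀).bl 0).L_nonneg
  have hK : 0 ≤ K := (hu.src i₀).K_nonneg
  set B₀ := EvolFam.datBound D c α G M L with hB₀
  have hB₀0 : 0 ≤ B₀ := by rw [hB₀, EvolFam.datBound]; positivity
  have hdat : ∀ i, ∀ t ∈ Icc (0:ℝ) T, Dat (u i t) B₀ α := fun i t ht => by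
    rw [hu.eq i t ht]; exact h.dat_mild_Icc hα (hu.src i) (hg i) hT1 ht
  have hflow : ∀ i, ∀ t ∈ Icc (0:ℝ) T, ∀ t' ∈ Icc (0:ℝ) T, t ≤ t' →
      u i t = mild μ (nlSrc F T u i) (u i t') t t' := fun i t ht t' ht' htt => by
    rw [hu.eq i t ht, hu.eq i t' ht']
    exact h.mild_flow (hu.src i) (hg i).bc htt ht'.2
  set B₁ := B₀ * c + 4 * c * L with hB₁
  have hB₁0 : 0 ≤ B₁ := by positivity
  have hpdd : ∀ i d e x, ∀ t ∈ Icc (0:ℝ) T, ∀ t' ∈ Icc (0:ℝ) T,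
      |pdd (u i t) d e x - pdd (u i t') d e x| ≤ B₁ * |t - t'| ^ (α / 2) := by
    intro i d e x t ht t' ht'
    wlog htt : t ≤ t' generalizing t t'
    · rw [abs_sub_comm, abs_sub_comm t]
      exact this t' ht' t ht (le_of_not_ge htt)
    rw [abs_sub_comm t, abs_of_nonneg (sub_nonneg.2 htt), hflow i t ht t' ht' htt]
    exact h.abs_pdd_mild_sub_le hα (hu.src i) (hdat i t' ht') htt (by linarith [ht.1, ht'.2]) d e x
  set B₂ := D ^ 2 * (a * B₀) / 2 + M with hB₂
  set B₃ := D ^ 2 * (a * B₁ + KA * B₀) / 2 + K with hB₃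
  set B₄ := D ^ 2 * (a * B₀ + 0 * B₀) / 2 + (2 * M + L) with hB₄
  have hB₂0 : 0 ≤ B₂ := by positivity
  have hB₃0 : 0 ≤ B₃ := by positivity
  have hB₄0 : 0 ≤ B₄ := by positivity
  have hbdd : ∀ i x, ∀ t ∈ Icc (0:ℝ) T, |timeDeriv A F T u i t x| ≤ B₂ := fun i x t ht => by
    rw [timeDeriv, abs_neg]
    exact abs_gen_le (ha t) (fun d e => ((hdat i t ht).pdd_bc d e).bdd x)
      (((hu.src i).bl t).bdd x)
  have hgtime : ∀ i x, ∀ t ∈ Icc (0:ℝ) T, ∀ s ∈ Icc (0:ℝ) T,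
      |gen (A t) (u i t) (nlSrc F T u i t) x - gen (A s) (u i s) (nlSrc F T u i s) x| ≤
        B₃ * |t - s| ^ (α / 2) := fun i x t ht s hs => by
    refine (abs_gen_sub_gen_le (ha t) (hA t s) (fun d e => hpdd i d e x t ht s hs)
      (fun d e => ((hdat i s hs).pdd_bc d e).bdd x) ((hu.src i).time t s x)).trans (le_of_eq ?_)
    rw [hB₃]; ring
  have htime : ∀ i x, ∀ t ∈ Icc (0:ℝ) T, ∀ s ∈ Icc (0:ℝ) T,
      |timeDeriv A F T u i t x - timeDeriv A F T u i s x| ≤ B₃ * |t - s| ^ (α / 2) :=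
    fun i x t ht s hs => by
      rw [timeDeriv, timeDeriv, neg_sub_neg, abs_sub_comm]
      exact hgtime i x t ht s hs
  have hspace : ∀ i x y, ∀ t ∈ Icc (0:ℝ) T,
      |timeDeriv A F T u i t x - timeDeriv A F T u i t y| ≤ B₄ * ‖x - y‖ ^ α :=
    fun i x y t ht => by
      rw [timeDeriv, timeDeriv, neg_sub_neg, abs_sub_comm]
      refine (abs_gen_sub_gen_le (ha t) (a' := 0) (fun d e => by simp)
        (fun d e => (hdat i t ht).hol d e x y) (fun d e => ((hdat i t ht).pdd_bc d e).bdd y)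
        (((hu.src i).bl t).holder (Ioo_subset_Icc_self hα) x y)).trans (le_of_eq ?_)
      rw [hB₄]; ring
  have hle : ∀ {z r : ℝ}, 0 ≤ r → z ≤ B₁ * r ∨ z ≤ B₃ * r ∨ z ≤ B₄ * r →
      z ≤ (B₀ + B₁ + B₂ + B₃ + B₄) * r := fun {z r} hr hz => by
    rcases hz with hz | hz | hz <;> refine hz.trans (mul_le_mul_of_nonneg_right ?_ hr) <;> linarith
  have hr0 : ∀ r : ℝ, 0 ≤ |r| ^ (α / 2) := fun r => rpow_nonneg (abs_nonneg _) _
  refine ⟨B₀ + B₁ + B₂ + B₃ + B₄, by positivity, ⟨fun i t ht => (hdat i t ht).mono (by linarith),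
    fun i x t ht => ?_, fun i x t ht => (hbdd i x t ht).trans (by linarith),
    fun i x t ht s hs => hle (hr0 _) (Or.inr (Or.inl (htime i x t ht s hs))), fun i x t _ => rfl,
    fun i => ?_⟩,
    fun i d e x t ht s hs => hle (hr0 _) (Or.inl (hpdd i d e x t ht s hs)),
    fun i x y t ht => hle (rpow_nonneg (norm_nonneg _) _)
      (Or.inr (Or.inr (hspace i x y t ht)))⟩
  · refine hasDerivWithinAt_of_backward_step (w := fun s => u i s x)
      (R := fun s => gen (A s) (u i s) (nlSrc F T u i s) x) (θ := α / 2) hα2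
      (K := D ^ 2 * B₀ * c + D ^ 2 * (KA * B₀) + (L * c + K)) (H := B₃)
      (fun s hs s' hs' hss => ?_) (fun s hs s' hs' hss => ?_) ht
    · have := h.abs_mild_sub_gen_le hα hKA hAc hA (hu.src i) (hdat i s' hs') hss
        (by linarith [hs.1, hs'.2]) x
      rwa [← hflow i s hs s' hs' hss] at this
    · rw [← abs_of_nonneg (sub_nonneg.2 hss), abs_sub_comm s' s]
      exact hgtime i x s hs s' hs'
  · rw [hu.eq i T ⟨hT0, le_rfl⟩]
    funext x
    rw [mild, h.avg_self (hg i).bl]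
    simp [duh]

/-- The nonlinearity of the coupled system, as a function of the volatility matrix and of the
gradients. -/
def nonlin {D N I : ℕ} (hN : N ≤ D) (a : Fin I → ℝ) (i : Fin I)
    (z : (Fin D → Fin D → ℝ) × (Fin I → Fin D → ℝ)) : ℝ :=
  (1 / (2 * a i)) * (∑ n : Fin N,
      ((1 / ∑ j, 1 / a j) * ∑ j, ∑ k, z.1 k (Fin.castLE hN n) * z.2 j k) ^ 2)
    - (∑ n : Fin N, ((1 / ∑ j, 1 / a j) * ∑ j, ∑ k, z.1 k (Fin.castLE hN n) * z.2 j k) *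
        (∑ k, z.1 k (Fin.castLE hN n) * z.2 i k))
    + (a i / 2) * ((∑ n : Fin N, (∑ k, z.1 k (Fin.castLE hN n) * z.2 i k) ^ 2) -
        (∑ m, (∑ k, z.1 k m * z.2 i k) ^ 2))

lemma contDiff_nonlin {D N I : ℕ} (hN : N ≤ D) (a : Fin I → ℝ) (i : Fin I) :
    ContDiff ℝ 1 (nonlin hN a i) := by
  unfold nonlin
  fun_prop

lemma exists_nl {D I : ℕ} {f : Fin I → (Fin D → Fin D → ℝ) × (Fin I → Fin D → ℝ) → ℝ}
    (hf : ∀ i, ContDiff ℝ 1 (f i)) {Q : ℝ → Fin D → Fin D → ℝ} {b k θ : ℝ} (hk : 0 ≤ k)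
    (hQ : ∀ t, ‖Q t‖ ≤ b) (hQQ : ∀ t s, ‖Q t - Q s‖ ≤ k * |t - s| ^ θ) (R : ℝ) :
    ∃ Λ, Nl (fun i t p => f i (Q t, p)) θ R Λ := by
  set S := Metric.closedBall (0 : (Fin D → Fin D → ℝ) × (Fin I → Fin D → ℝ)) (max b R) with hS
  have hmem : ∀ t (p : Fin I → Fin D → ℝ), ‖p‖ ≤ R → (Q t, p) ∈ S := fun t p hp => by
    rw [hS, mem_closedBall_zero_iff, Prod.norm_def]
    exact max_le_max (hQ t) hp
  have h1 : ∀ i, ∃ K : NNReal, LipschitzOnWith K (f i) S := fun i =>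
    (hf i).contDiffOn.exists_lipschitzOnWith one_ne_zero (convex_closedBall _ _)
      (isCompact_closedBall _ _)
  choose K hK using h1
  have h2 : ∀ i, ∃ M, ∀ z ∈ S, ‖f i z‖ ≤ M := fun i =>
    (isCompact_closedBall _ _).exists_bound_of_continuousOn (hf i).continuous.continuousOn
  choose M hM using h2
  have hsK : ∀ i, (K i : ℝ) ≤ ∑ j, (K j : ℝ) := fun i =>
    Finset.single_le_sum (f := fun j => (K j : ℝ)) (fun j _ => (K j).2) (Finset.mem_univ i)
  have hsM : ∀ i, M i ≤ ∑ j, |M j| := fun i => (le_abs_self _).trans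
    (Finset.single_le_sum (f := fun j => |M j|) (fun j _ => abs_nonneg _) (Finset.mem_univ i))
  have hK0 : 0 ≤ ∑ j, (K j : ℝ) := Finset.sum_nonneg fun j _ => (K j).2
  have hM0 : 0 ≤ ∑ j, |M j| := Finset.sum_nonneg fun j _ => abs_nonneg _
  refine ⟨∑ j, |M j| + (∑ j, (K j : ℝ)) * (k + 1), by positivity, fun i t p hp => ?_,
    fun i t t' p p' hp hp' => ?_⟩
  · refine (hM i _ (hmem t p hp)).trans ((hsM i).trans ?_)
    have : 0 ≤ (∑ j, (K j : ℝ)) * (k + 1) := by positivity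
    linarith
  · have h3 := (hK i).dist_le_mul _ (hmem t p hp) _ (hmem t' p' hp')
    rw [Real.dist_eq, dist_eq_norm, Prod.norm_def] at h3
    have hr : 0 ≤ |t - t'| ^ θ := rpow_nonneg (abs_nonneg _) _
    have hp0 := norm_nonneg (p - p')
    have h4 : max ‖Q t - Q t'‖ ‖p - p'‖ ≤ (k + 1) * (|t - t'| ^ θ + ‖p - p'‖) :=
      max_le ((hQQ t t').trans (by nlinarith [mul_nonneg hk hp0]))
        (by nlinarith [mul_nonneg hk hr, mul_nonneg hk hp0])
    refine h3.trans ?_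
    calc _ ≤ (∑ j, (K j : ℝ)) * ((k + 1) * (|t - t'| ^ θ + ‖p - p'‖)) :=
          mul_le_mul (hsK i) h4 (le_max_of_le_right hp0) hK0
      _ ≤ _ := by nlinarith [mul_nonneg hM0 (add_nonneg hr hp0)]

/-- The volatility matrix, frozen outside `[0, 1]`. -/
def vol {D : ℕ} (C : ℝ → Matrix (Fin D) (Fin D) ℝ) (t : ℝ) : Fin D → Fin D → ℝ :=
  fun i j => C (clamp 1 t) i j

/-- The diffusion matrix, frozen outside `[0, 1]`. -/
def diffMat {D : ℕ} (C : ℝ → Matrix (Fin D) (Fin D) ℝ) (t : ℝ) : Matrix (Fin D) (Fin D) ℝ :=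
  C (clamp 1 t) * (C (clamp 1 t))ᵀ

lemma diffMat_symm {D : ℕ} (C : ℝ → Matrix (Fin D) (Fin D) ℝ) (t : ℝ) (i j : Fin D) :
    diffMat C t i j = diffMat C t j i := by
  simp only [diffMat, Matrix.mul_apply, Matrix.transpose_apply]
  exact Finset.sum_congr rfl fun k _ => mul_comm _ _

lemma exists_vol_bounds {D : ℕ} {C : ℝ → Matrix (Fin D) (Fin D) ℝ} {α : ℝ}
    (hα : α ∈ Ioo (0:ℝ) 1) (hC : ∃ K, ∀ t ∈ Icc (0:ℝ) 1, ∀ s ∈ Icc (0:ℝ) 1, ∀ i j,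
      |C t i j - C s i j| ≤ K * |t - s| ^ α) :
    ∃ b k, 0 ≤ b ∧ 0 ≤ k ∧ (∀ t i j, |vol C t i j| ≤ b) ∧
      ∀ t s i j, |vol C t i j - vol C s i j| ≤ k * |t - s| ^ (α / 2) := by
  obtain ⟨K, hK⟩ := hC
  have hα2 : 0 < α / 2 := by linarith [hα.1]
  have hm := fun t => clamp_mem zero_le_one t
  have h1 : ∀ t s i j, |vol C t i j - vol C s i j| ≤ max K 0 * |clamp 1 t - clamp 1 s| ^ α :=
    fun t s i j => (hK _ (hm t) _ (hm s) i j).trans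
      (mul_le_mul_of_nonneg_right (le_max_left _ _) (rpow_nonneg (abs_nonneg _) _))
  refine ⟨∑ i, ∑ j, |vol C 0 i j| + max K 0, max K 0, by positivity, le_max_right _ _,
    fun t i j => ?_, fun t s i j => (h1 t s i j).trans (mul_le_mul_of_nonneg_left
      (abs_clamp_sub_rpow_le zero_le_one le_rfl hα2 (by linarith [hα.1]) t s) (le_max_right _ _))⟩
  have h2 : |vol C 0 i j| ≤ ∑ i, ∑ j, |vol C 0 i j| :=
    (Finset.single_le_sum (f := fun j => |vol C 0 i j|) (fun _ _ => abs_nonneg _)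
      (Finset.mem_univ j)).trans (Finset.single_le_sum (f := fun i => ∑ j, |vol C 0 i j|)
        (fun _ _ => Finset.sum_nonneg fun _ _ => abs_nonneg _) (Finset.mem_univ i))
  have h3 : |clamp 1 t - clamp 1 0| ^ α ≤ 1 := by
    refine rpow_le_one (abs_nonneg _) (abs_le.2 ⟨?_, ?_⟩) hα.1.le <;>
      linarith [(hm t).1, (hm t).2, (hm 0).1, (hm 0).2]
  calc _ = |vol C 0 i j + (vol C t i j - vol C 0 i j)| := by congr 1; ring
    _ ≤ _ := abs_add_le _ _
    _ ≤ _ := add_le_add h2 ((h1 t 0 i j).trans (by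
      simpa using mul_le_mul_of_nonneg_left h3 (le_max_right K 0)))

lemma diffMat_bounds {D : ℕ} {C : ℝ → Matrix (Fin D) (Fin D) ℝ} {b k θ : ℝ} (hb0 : 0 ≤ b)
    (hk : 0 ≤ k) (hθ : 0 < θ) (hb : ∀ t i j, |vol C t i j| ≤ b)
    (hkk : ∀ t s i j, |vol C t i j - vol C s i j| ≤ k * |t - s| ^ θ) :
    (∀ t i j, |diffMat C t i j| ≤ D * (b * b)) ∧
    (∀ t s i j, |diffMat C t i j - diffMat C s i j| ≤ D * (2 * b * k) * |t - s| ^ θ) ∧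
    ∀ i j, Continuous fun t => diffMat C t i j := by
  have h0 : ∀ t i j, diffMat C t i j = ∑ l, vol C t i l * vol C t j l := fun t i j => rfl
  have h2 : ∀ t s i j, |diffMat C t i j - diffMat C s i j| ≤ D * (2 * b * k) * |t - s| ^ θ := by
    intro t s i j
    rw [h0, h0, ← Finset.sum_sub_distrib]
    refine (Finset.abs_sum_le_sum_abs _ _).trans ?_
    refine (Finset.sum_le_card_nsmul _ _ (2 * b * k * |t - s| ^ θ) fun l _ => ?_).trans
      (le_of_eq ?_)
    · have e : vol C t i l * vol C t j l - vol C s i l * vol C s j l =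
        (vol C t i l - vol C s i l) * vol C t j l + vol C s i l * (vol C t j l - vol C s j l) := by
        ring
      rw [e]
      refine (abs_add_le _ _).trans ?_
      rw [abs_mul, abs_mul]
      have hr : 0 ≤ |t - s| ^ θ := rpow_nonneg (abs_nonneg _) _
      have e1 := mul_le_mul (hkk t s i l) (hb t j l) (abs_nonneg _) (by positivity)
      have e2 := mul_le_mul (hb s i l) (hkk t s j l) (abs_nonneg _) hb0
      linarith
    · simp; ring
  refine ⟨fun t i j => ?_, h2, fun i j => ?_⟩
  · rw [h0]
    refine (Finset.abs_sum_le_sum_abs _ _).trans ?_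
    refine (Finset.sum_le_card_nsmul _ _ (b * b) fun l _ => ?_).trans (le_of_eq (by simp))
    rw [abs_mul]
    exact mul_le_mul (hb t i l) (hb t j l) (abs_nonneg _) hb0
  · have := continuous_of_lip_holder (D := 0) (E := ℝ)
      (P := fun z => diffMat C z.1 i j) (L := 0) (K := D * (2 * b * k)) hθ (fun t x y => by simp)
      (fun t s x => h2 t s i j)
    exact this.comp (by fun_prop : Continuous fun t : ℝ => (t, (0 : Fin 0 → ℝ)))

lemma norm_le_en {D : ℕ} (x : Fin D → ℝ) : ‖x‖ ≤ en x := by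
  refine (pi_norm_le_iff_of_nonneg (sqrt_nonneg _)).2 fun i => abs_le_sqrt ?_
  exact Finset.single_le_sum (f := fun i => x i ^ 2) (fun j _ => sq_nonneg _) (Finset.mem_univ i)

lemma en_le {D : ℕ} (x : Fin D → ℝ) : en x ≤ D * ‖x‖ := by
  refine sqrt_le_iff.2 ⟨by positivity, ?_⟩
  calc ∑ i, x i ^ 2 ≤ ∑ _i : Fin D, ‖x‖ ^ 2 := Finset.sum_le_sum fun i _ => by
        rw [← sq_abs]
        exact pow_le_pow_left₀ (abs_nonneg _) (norm_le_pi_norm x i) 2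
    _ = D * ‖x‖ ^ 2 := by simp
    _ ≤ (D : ℝ) ^ 2 * ‖x‖ ^ 2 := by
        gcongr
        exact_mod_cast Nat.le_self_pow two_ne_zero D
    _ = _ := by ring

lemma en_rpow_le {D : ℕ} {α : ℝ} (hα : 0 ≤ α) (x : Fin D → ℝ) :
    en x ^ α ≤ (D : ℝ) ^ α * ‖x‖ ^ α := by
  rw [← mul_rpow (Nat.cast_nonneg _) (norm_nonneg _)]
  exact rpow_le_rpow (sqrt_nonneg _) (en_le x) hα

lemma exists_of_bddAbove_sup0Set {D : ℕ} {g : (Fin D → ℝ) → ℝ} (h : BddAbove (sup0Set g)) :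
    ∃ M, ∀ x, |g x| ≤ M := h.imp fun _ hM x => hM ⟨x, rfl⟩

lemma exists_of_bddAbove_psupSet {D : ℕ} {T : ℝ} {h : ℝ → (Fin D → ℝ) → ℝ}
    (hh : BddAbove (psupSet T h)) : ∃ M, ∀ t ∈ Icc (0:ℝ) T, ∀ x, |h t x| ≤ M :=
  hh.imp fun _ hM t ht x => hM ⟨t, x, ht, rfl⟩

lemma bddAbove_psupSet {D : ℕ} {T M : ℝ} {h : ℝ → (Fin D → ℝ) → ℝ}
    (hh : ∀ t ∈ Icc (0:ℝ) T, ∀ x, |h t x| ≤ M) : BddAbove (psupSet T h) :=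
  ⟨M, fun _ ⟨t, x, ht, hr⟩ => hr ▸ hh t ht x⟩

lemma exists_of_bddAbove_hsemiSet {D : ℕ} {α : ℝ} (hα : 0 ≤ α) {g : (Fin D → ℝ) → ℝ}
    (h : BddAbove (hsemiSet α g)) : ∃ H, ∀ x y, |g x - g y| ≤ H * ‖x - y‖ ^ α := by
  obtain ⟨M, hM⟩ := h
  refine ⟨max M 0 * (D : ℝ) ^ α, fun x y => ?_⟩
  rcases eq_or_ne x y with rfl | hxy
  · rw [sub_self, abs_zero]
    have : 0 ≤ max M 0 := le_max_right _ _
    positivity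
  · have hpos : 0 < en (x - y) := (norm_pos_iff.2 (sub_ne_zero.2 hxy)).trans_le (norm_le_en _)
    have h1 := (div_le_iff₀ (rpow_pos_of_pos hpos α)).1 (hM ⟨x, y, hxy, rfl⟩)
    rw [mul_assoc]
    exact (h1.trans (mul_le_mul_of_nonneg_right (le_max_left _ _) (rpow_nonneg hpos.le _))).trans
      (mul_le_mul_of_nonneg_left (en_rpow_le hα _) (le_max_right _ _))

lemma sqrt_rpow {x α : ℝ} (hx : 0 ≤ x) : √x ^ α = x ^ (α / 2) := by
  rw [sqrt_eq_rpow, ← rpow_mul hx]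
  congr 1; ring

lemma exists_of_bddAbove_psemiSet {D : ℕ} {T α : ℝ} (hα : 0 < α) {h : ℝ → (Fin D → ℝ) → ℝ}
    (hh : BddAbove (psemiSet T α h)) : ∃ H,
      (∀ t ∈ Icc (0:ℝ) T, ∀ x y, |h t x - h t y| ≤ H * ‖x - y‖ ^ α) ∧
      ∀ t ∈ Icc (0:ℝ) T, ∀ s ∈ Icc (0:ℝ) T, ∀ x, |h t x - h s x| ≤ H * |t - s| ^ (α / 2) := by
  obtain ⟨M, hM⟩ := hh
  have h0 : ∀ t ∈ Icc (0:ℝ) T, ∀ s ∈ Icc (0:ℝ) T, ∀ x y,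
      |h t x - h s y| ≤ max M 0 * (√|t - s| + en (x - y)) ^ α := by
    intro t ht s hs x y
    have hn : 0 ≤ √|t - s| + en (x - y) := add_nonneg (sqrt_nonneg _) (sqrt_nonneg _)
    rcases eq_or_ne ((t, x) : ℝ × (Fin D → ℝ)) (s, y) with he | he
    · obtain ⟨rfl, rfl⟩ := Prod.mk.inj he
      rw [sub_self, abs_zero]
      exact mul_nonneg (le_max_right _ _) (rpow_nonneg hn _)
    · have hpos : 0 < √|t - s| + en (x - y) := by
        rcases eq_or_ne t s with rfl | hts
        · have hxy : x ≠ y := fun hxy => he (by rw [hxy])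
          have := (norm_pos_iff.2 (sub_ne_zero.2 hxy)).trans_le (norm_le_en _)
          exact add_pos_of_nonneg_of_pos (sqrt_nonneg _) this
        · exact add_pos_of_pos_of_nonneg (sqrt_pos.2 (abs_pos.2 (sub_ne_zero.2 hts)))
            (sqrt_nonneg _)
      have h1 := (div_le_iff₀ (rpow_pos_of_pos hpos α)).1 (hM ⟨t, x, s, y, ht, hs, he, rfl⟩)
      exact h1.trans (mul_le_mul_of_nonneg_right (le_max_left _ _) (rpow_nonneg hn _))
  have hM0 : 0 ≤ max M 0 := le_max_right _ _
  have hD : 0 ≤ (D : ℝ) ^ α := rpow_nonneg (Nat.cast_nonneg _) _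
  refine ⟨max M 0 * ((D : ℝ) ^ α + 1), fun t ht x y => ?_, fun t ht s hs x => ?_⟩
  · refine (h0 t ht t ht x y).trans ?_
    rw [sub_self, abs_zero, sqrt_zero, zero_add, mul_assoc]
    refine mul_le_mul_of_nonneg_left ((en_rpow_le hα.le _).trans ?_) hM0
    exact mul_le_mul_of_nonneg_right (by linarith) (rpow_nonneg (norm_nonneg _) _)
  · refine (h0 t ht s hs x x).trans ?_
    have : en (x - x) = 0 := by simp [en]
    rw [this, add_zero, sqrt_rpow (abs_nonneg _), mul_assoc]
    refine mul_le_mul_of_nonneg_left ?_ hM0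
    exact le_mul_of_one_le_left (rpow_nonneg (abs_nonneg _) _) (by linarith)

lemma bddAbove_psemiSet {D : ℕ} {T α B : ℝ} (hα : 0 < α) (hB : 0 ≤ B)
    {h : ℝ → (Fin D → ℝ) → ℝ}
    (hx : ∀ t ∈ Icc (0:ℝ) T, ∀ x y, |h t x - h t y| ≤ B * ‖x - y‖ ^ α)
    (ht : ∀ t ∈ Icc (0:ℝ) T, ∀ s ∈ Icc (0:ℝ) T, ∀ x, |h t x - h s x| ≤ B * |t - s| ^ (α / 2)) :
    BddAbove (psemiSet T α h) := by
  refine ⟨2 * B, ?_⟩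
  rintro _ ⟨t, x, s, y, htm, hsm, -, rfl⟩
  have h1 : 0 ≤ √|t - s| := sqrt_nonneg _
  have h2 : 0 ≤ en (x - y) := sqrt_nonneg _
  refine div_le_of_le_mul₀ (rpow_nonneg (add_nonneg h1 h2) _) (by positivity) ?_
  have h3 := hx t htm x y
  have h4 := ht t htm s hsm y
  rw [← sqrt_rpow (abs_nonneg _)] at h4
  have h5 : ‖x - y‖ ^ α ≤ (√|t - s| + en (x - y)) ^ α :=
    rpow_le_rpow (norm_nonneg _) ((norm_le_en _).trans (by linarith)) hα.le
  have h6 : √|t - s| ^ α ≤ (√|t - s| + en (x - y)) ^ α := rpow_le_rpow h1 (by linarith) hα.le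
  have h7 := mul_le_mul_of_nonneg_left h5 hB
  have h8 := mul_le_mul_of_nonneg_left h6 hB
  calc _ ≤ |h t x - h t y| + |h t y - h s y| := abs_sub_le _ _ _
    _ ≤ _ := by linarith

lemma exists_uniform_bound {ι : Type*} [Finite ι] {P : ι → ℝ → Prop}
    (hmono : ∀ i M M', M ≤ M' → P i M → P i M') (h : ∀ i, ∃ M, P i M) :
    ∃ M, 0 ≤ M ∧ ∀ i, P i M := by
  choose f hf using h
  obtain ⟨M, hM⟩ := Set.finite_range f |>.bddAbove
  exact ⟨max M 0, le_max_right _ _,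
    fun i => hmono i _ _ ((hM (mem_range_self i)).trans (le_max_left _ _)) (hf i)⟩

lemma dat_of_bounds {D : ℕ} {φ : (Fin D → ℝ) → ℝ} {G α : ℝ} (hφ : ContDiff ℝ 2 φ)
    (h0 : ∀ x, |φ x| ≤ G) (h1 : ∀ k x, |pd φ k x| ≤ G) (h2 : ∀ d e x, |pdd φ d e x| ≤ G)
    (h3 : ∀ d e x y, |pdd φ d e x - pdd φ d e y| ≤ G * ‖x - y‖ ^ α) : Dat φ G α where
  cd := hφ
  bc := ⟨hφ.continuous, h0⟩
  pd_bc k := ⟨(hφ.pd_one k).continuous, h1 k⟩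
  pdd_bc d e := ⟨(hφ.pd_one e).continuous_pd d, h2 d e⟩
  hol := h3

lemma exists_dat {D : ℕ} {α : ℝ} (hα : 0 ≤ α) {g : (Fin D → ℝ) → ℝ}
    (hg : ContDiff ℝ 2 g ∧ BddAbove (sup0Set g) ∧ (∀ d, BddAbove (sup0Set (pd g d))) ∧
      (∀ d e, BddAbove (sup0Set (pdd g d e))) ∧ ∀ d e, BddAbove (hsemiSet α (pdd g d e))) :
    ∃ G, Dat g G α := by
  obtain ⟨hcd, h0, h1, h2, h3⟩ := hg
  obtain ⟨m₀, h0⟩ := exists_of_bddAbove_sup0Set h0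
  obtain ⟨m₁, hm₁, h1⟩ := exists_uniform_bound (fun _ _ _ hM h x => (h x).trans hM)
    fun d => exists_of_bddAbove_sup0Set (h1 d)
  obtain ⟨m₂, hm₂, h2⟩ := exists_uniform_bound (ι := Fin D × Fin D)
    (fun _ _ _ hM h x => (h x).trans hM) fun d => exists_of_bddAbove_sup0Set (h2 d.1 d.2)
  obtain ⟨m₃, hm₃, h3⟩ := exists_uniform_bound (ι := Fin D × Fin D)
    (fun _ _ _ hM h x y => (h x y).trans (by gcongr))
    fun d => exists_of_bddAbove_hsemiSet hα (h3 d.1 d.2)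
  have hm₀ : 0 ≤ m₀ := (abs_nonneg _).trans (h0 0)
  exact ⟨m₀ + m₁ + m₂ + m₃, dat_of_bounds hcd (fun x => (h0 x).trans (by linarith))
    (fun k x => (h1 k x).trans (by linarith)) (fun d e x => (h2 (d, e) x).trans (by linarith))
    fun d e x y => (h3 (d, e) x y).trans
      (mul_le_mul_of_nonneg_right (by linarith) (rpow_nonneg (norm_nonneg _) _))⟩

/-- The nonlinearity of the coupled system, with coefficients frozen outside `[0, 1]`. -/
def sysNl {D N I : ℕ} (hN : N ≤ D) (C : ℝ → Matrix (Fin D) (Fin D) ℝ) (a : Fin I → ℝ)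
    (i : Fin I) (t : ℝ) (p : Fin I → Fin D → ℝ) : ℝ := nonlin hN a i (vol C t, p)

lemma pde_eq_gen {D N I : ℕ} (hN : N ≤ D) (C : ℝ → Matrix (Fin D) (Fin D) ℝ) (a : Fin I → ℝ)
    (u : Fin I → ℝ → (Fin D → ℝ) → ℝ) {T t : ℝ} (hT1 : T ≤ 1) (ht : t ∈ Icc (0:ℝ) T) (i : Fin I)
    (y : Fin D → ℝ) (w : ℝ) :
    w + (1 / (2 * a i)) * (∑ n : Fin N, lamFun hN C a u t y n ^ 2)
        - (∑ n : Fin N, lamFun hN C a u t y n *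
            (∑ k : Fin D, C t k (Fin.castLE hN n) * pd (u i t) k y))
        + (a i / 2) *
            ((∑ n : Fin N, (∑ k : Fin D, C t k (Fin.castLE hN n) * pd (u i t) k y) ^ 2) -
              (∑ m : Fin D, (∑ k : Fin D, C t k m * pd (u i t) k y) ^ 2))
        + (1/2) * (∑ p, ∑ q, pdd (u i t) p q y * (C t * (C t)ᵀ) q p) =
      w + gen (diffMat C t) (u i t) (nlSrc (sysNl hN C a) T u i t) y := by
  have h1 : clamp 1 t = t := clamp_of_mem ⟨ht.1, ht.2.trans hT1⟩
  have h2 : ∑ p, ∑ q, pdd (u i t) p q y * (C t * (C t)ᵀ) q p =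
      ∑ p, ∑ q, diffMat C t p q * pdd (u i t) p q y := by
    refine Finset.sum_congr rfl fun p _ => Finset.sum_congr rfl fun q _ => ?_
    rw [diffMat_symm, diffMat, h1, mul_comm]
  rw [h2]
  simp only [gen, nlSrc, sysNl, nonlin, vol, grad, lamFun, h1, clamp_of_mem ht]
  ring

lemma ClassSol.sysSol {D N I : ℕ} {hN : N ≤ D} {C : ℝ → Matrix (Fin D) (Fin D) ℝ}
    {a : Fin I → ℝ} {g : Fin I → (Fin D → ℝ) → ℝ} {u : Fin I → ℝ → (Fin D → ℝ) → ℝ}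
    {w : Fin I → ℝ → (Fin D → ℝ) → ℝ} {T α B : ℝ} (hα : 0 < α) (hT0 : 0 < T) (hT1 : T ≤ 1)
    (hB : 0 ≤ B) (h : ClassSol (diffMat C) (sysNl hN C a) T α g B u w)
    (hp : ∀ i d e x, ∀ t ∈ Icc (0:ℝ) T, ∀ s ∈ Icc (0:ℝ) T,
        |pdd (u i t) d e x - pdd (u i s) d e x| ≤ B * |t - s| ^ (α / 2))
    (hw : ∀ i x y, ∀ t ∈ Icc (0:ℝ) T, |w i t x - w i t y| ≤ B * ‖x - y‖ ^ α) :
    SysSol hN T α C a g u := by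
  intro i
  have hd : ∀ y, ∀ t ∈ Icc (0:ℝ) T,
      derivWithin (fun s => u i s y) (Icc 0 T) t = w i t y := fun y t ht =>
    (h.deriv i y t ht).derivWithin (uniqueDiffOn_Icc hT0 t ht)
  refine ⟨?_, fun t ht => (h.dat i t ht).cd,
    fun y t ht => (h.deriv i y t ht).differentiableWithinAt, fun t ht y => ?_,
    fun y => congrFun (h.term i) y, bddAbove_psupSet fun t ht => (h.dat i t ht).bc.bdd,
    bddAbove_psupSet fun t ht x => by rw [hd x t ht]; exact h.bdd i x t ht,
    bddAbove_psemiSet hα hB (fun t ht x y => ?_) (fun t ht s hs x => ?_),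
    fun d => bddAbove_psupSet fun t ht => ((h.dat i t ht).pd_bc d).bdd,
    fun d e => bddAbove_psupSet fun t ht => ((h.dat i t ht).pdd_bc d e).bdd,
    fun d e => bddAbove_psemiSet hα hB (fun t ht => (h.dat i t ht).hol d e)
      fun t ht s hs x => hp i d e x t ht s hs⟩
  · have hT := hT0.le
    have hc : Continuous fun p : ℝ × (Fin D → ℝ) => u i (clamp T p.1) p.2 := by
      refine continuous_of_lip_holder (L := D * B) (K := B) one_pos
        (fun t x y => (h.dat i _ (clamp_mem hT t)).bl.lip x y) fun t s x => ?_
      rw [rpow_one]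
      exact (h.abs_sub_le i x (clamp_mem hT t) (clamp_mem hT s)).trans
        (mul_le_mul_of_nonneg_left (abs_clamp_sub_le T t s) hB)
    refine hc.continuousOn.congr fun p hp => ?_
    simp only [clamp_of_mem hp.1]
  · have htm : t ∈ Icc (0:ℝ) T := Ico_subset_Icc_self ht
    rw [pde_eq_gen hN C a u hT1 htm, hd y t htm, h.eq i y t ht]
    ring
  · simp only [hd _ t ht]
    exact hw i x y t ht
  · simp only [hd _ t ht, hd _ s hs]
    exact h.hol i x t ht s hs

lemma SysSol.classSol {D N I : ℕ} {hN : N ≤ D} {C : ℝ → Matrix (Fin D) (Fin D) ℝ}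
    {a : Fin I → ℝ} {g : Fin I → (Fin D → ℝ) → ℝ} {v : Fin I → ℝ → (Fin D → ℝ) → ℝ} {T α : ℝ}
    (hα : 0 < α) (hT1 : T ≤ 1) (h : SysSol hN T α C a g v) (B₀ : ℝ) :
    ∃ B, 0 ≤ B ∧ B₀ ≤ B ∧ ClassSol (diffMat C) (sysNl hN C a) T α g B v
      (fun i t y => derivWithin (fun s => v i s y) (Icc 0 T) t) := by
  have key : ∀ i, ∃ B, (∀ t ∈ Icc (0:ℝ) T, Dat (v i t) B α) ∧
      (∀ x, ∀ t ∈ Icc (0:ℝ) T, |derivWithin (fun s => v i s x) (Icc 0 T) t| ≤ B) ∧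
      ∀ x, ∀ t ∈ Icc (0:ℝ) T, ∀ s ∈ Icc (0:ℝ) T,
        |derivWithin (fun s => v i s x) (Icc 0 T) t -
          derivWithin (fun s => v i s x) (Icc 0 T) s| ≤ B * |t - s| ^ (α / 2) := by
    intro i
    obtain ⟨-, hcd, -, -, -, h0, hw0, hwh, h1, h2, h3⟩ := h i
    obtain ⟨m₀, h0⟩ := exists_of_bddAbove_psupSet h0
    obtain ⟨m₄, hw0⟩ := exists_of_bddAbove_psupSet hw0
    obtain ⟨m₅, -, hwh⟩ := exists_of_bddAbove_psemiSet hα hwh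
    obtain ⟨m₁, hm₁, h1⟩ := exists_uniform_bound (fun _ _ _ hM h t ht x => (h t ht x).trans hM)
      fun d => exists_of_bddAbove_psupSet (h1 d)
    obtain ⟨m₂, hm₂, h2⟩ := exists_uniform_bound (ι := Fin D × Fin D)
      (fun _ _ _ hM h t ht x => (h t ht x).trans hM) fun d => exists_of_bddAbove_psupSet (h2 d.1 d.2)
    obtain ⟨m₃, hm₃, h3⟩ := exists_uniform_bound (ι := Fin D × Fin D)
      (P := fun d H => ∀ t ∈ Icc (0:ℝ) T, ∀ x y,
        |pdd (v i t) d.1 d.2 x - pdd (v i t) d.1 d.2 y| ≤ H * ‖x - y‖ ^ α)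
      (fun _ _ _ hM h t ht x y => (h t ht x y).trans (by gcongr))
      fun d => (exists_of_bddAbove_psemiSet hα (h3 d.1 d.2)).imp fun _ h => h.1
    have e₀ := le_abs_self m₀
    have e₀' := abs_nonneg m₀
    have e₄ := le_abs_self m₄
    have e₄' := abs_nonneg m₄
    have e₅ := le_abs_self m₅
    have e₅' := abs_nonneg m₅
    refine ⟨|m₀| + m₁ + m₂ + m₃ + |m₄| + |m₅|, fun t ht => dat_of_bounds (hcd t ht)
      (fun x => (h0 t ht x).trans (by linarith)) (fun k x => (h1 k t ht x).trans (by linarith))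
      (fun d e x => (h2 (d, e) t ht x).trans (by linarith)) fun d e x y =>
        (h3 (d, e) t ht x y).trans
        (mul_le_mul_of_nonneg_right (by linarith) (rpow_nonneg (norm_nonneg _) _)),
      fun x t ht => (hw0 t ht x).trans (by linarith), fun x t ht s hs => (hwh t ht s hs x).trans
        (mul_le_mul_of_nonneg_right (by linarith) (rpow_nonneg (abs_nonneg _) _))⟩
  obtain ⟨B, hB, hall⟩ := exists_uniform_bound (fun _ _ _ hM h => ⟨fun t ht => (h.1 t ht).mono hM,
    fun x t ht => (h.2.1 x t ht).trans hM, fun x t ht s hs => (h.2.2 x t ht s hs).trans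
      (mul_le_mul_of_nonneg_right hM (rpow_nonneg (abs_nonneg _) _))⟩) key
  have hBB := le_max_left B B₀
  refine ⟨max B B₀, hB.trans hBB, le_max_right _ _, fun i t ht => ((hall i).1 t ht).mono hBB,
    fun i x t ht => ((h i).2.2.1 x t ht).hasDerivWithinAt,
    fun i x t ht => ((hall i).2.1 x t ht).trans hBB,
    fun i x t ht s hs => ((hall i).2.2 x t ht s hs).trans
      (mul_le_mul_of_nonneg_right hBB (rpow_nonneg (abs_nonneg _) _)),
    fun i x t ht => ?_, fun i => funext (h i).2.2.2.2.1⟩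
  have := (h i).2.2.2.1 t ht x
  rw [pde_eq_gen hN C a v hT1 (Ico_subset_Icc_self ht)] at this
  exact eq_neg_of_add_eq_zero_left this

end

theorem stmt8 (D N I : ℕ) (hN : N ≤ D) (δ δ' α : ℝ) (hδ : 0 < δ) (hδδ : δ ≤ δ')
    (hα : α ∈ Set.Ioo (0:ℝ) 1)
    (C : ℝ → Matrix (Fin D) (Fin D) ℝ)
    (hChol : ∃ K, ∀ t ∈ Set.Icc (0:ℝ) 1, ∀ s ∈ Set.Icc (0:ℝ) 1, ∀ i j,
      |C t i j - C s i j| ≤ K * |t - s| ^ α)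
    (hE : Ellip D δ δ' C)
    (a : Fin I → ℝ) (ha : ∀ i, 0 < a i)
    (g : Fin I → (Fin D → ℝ) → ℝ)
    (hg : ∀ i, ContDiff ℝ 2 (g i) ∧
      BddAbove (sup0Set (g i)) ∧
      (∀ d, BddAbove (sup0Set (pd (g i) d))) ∧
      (∀ d e, BddAbove (sup0Set (pdd (g i) d e))) ∧
      (∀ d e, BddAbove (hsemiSet α (pdd (g i) d e)))) :
    ∃ T₀ ∈ Set.Ioc (0:ℝ) 1, ∀ T : ℝ, 0 < T → T < T₀ →
      ∃ u : Fin I → ℝ → (Fin D → ℝ) → ℝ,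
        SysSol hN T α C a g u ∧
        ∀ v, SysSol hN T α C a g v →
          ∀ i : Fin I, ∀ t ∈ Set.Icc (0:ℝ) T, ∀ y, v i t y = u i t y := by
  have hα2 : 0 < α / 2 := by linarith [hα.1]
  obtain ⟨b, k, hb0, hk, hb, hkk⟩ := exists_vol_bounds hα hChol
  obtain ⟨hAb, hAh, hAc⟩ := diffMat_bounds hb0 hk hα2 hb hkk
  have hm := fun t => clamp_mem zero_le_one t
  obtain ⟨c, μ, h⟩ := exists_evolFam hδ (hδ.trans_le hδδ) hAc (diffMat_symm C)
    (fun t y => (hE _ (hm t) y).1) (fun t y => (hE _ (hm t) y).2)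
  have hNl : ∀ R, ∃ Λ, Nl (sysNl hN C a) (α / 2) R Λ :=
    exists_nl (fun i => contDiff_nonlin hN a i) hk (fun t => norm_pi_pi_le hb0 (hb t))
      fun t s => norm_pi_pi_le (mul_nonneg hk (rpow_nonneg (abs_nonneg _) _)) (hkk t s)
  obtain ⟨G, hG, hgd⟩ := exists_uniform_bound (P := fun i G => Dat (g i) G α)
    (fun _ _ _ hM hφ => hφ.mono hM) fun i => exists_dat hα.1.le (hg i)
  obtain ⟨Λ, hF⟩ := hNl (G + 1)
  obtain ⟨T₀, hT₀, M, L, K, hex⟩ := exists_mildSol h hα hG hF hgd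
  have hKA : 0 ≤ D * (2 * b * k) := by positivity
  refine ⟨T₀, hT₀, fun T hT hTT => ?_⟩
  have hT1 : T ≤ 1 := hTT.le.trans hT₀.2
  obtain ⟨u, hu⟩ := hex T hT hTT
  obtain ⟨B, hB, hcl, hp, hw⟩ := hu.classSol h hα hT.le hT1 hG hgd hKA hAc hAh (by positivity) hAb
  refine ⟨u, hcl.sysSol hα.1 hT hT1 hB hp hw, fun v hv i t ht y => ?_⟩
  obtain ⟨R, hR, hGR, hvc⟩ := hv.classSol hα.1 hT1 (G + 1)
  obtain ⟨Λ', hF'⟩ := hNl R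
  obtain ⟨M', L', K', hvm⟩ := hvc.mildSol h hα hT.le hT1 hR hF' hKA hAc hAh
  have hu' : MildSol μ (sysNl hN C a) T (α / 2) g M L K R u :=
    ⟨hu.src, hu.eq, fun t ht x => (hu.grad_le t ht x).trans hGR⟩
  exact congrFun (hu'.unique h hT1 hF' hgd hvm i ht) y
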